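/- arXiv:2309.01996 — 4 statements merged into one kernel-verified Lean document; each statement's English description precedes it below -/
import Mathlib

section
/- Let Ω be a domain in ℂⁿ, z₀ ∈ Ω, and 1 < p ≤ 2. Suppose f = u + iv is holomorphic on Ω with v(z₀) = 0, and suppose |u|^p admits a harmonic majorant on Ω. Then |f|^p admits a harmonic majorant on Ω and inf{F(z₀) : F harmonic on Ω, |f|^p ≤ F on Ω} ≤ (p/(p−1)) · inf{U(z₀) : U harmonic on Ω, |u|^p ≤ U on Ω}; that is, ‖f‖_{p,z₀} ≤ (p/(p−1))^{1/p} ‖u‖_{p,z₀}. -/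
open Real MeasureTheory Set

/-- A real-valued function on an open set `Ω ⊆ ℂⁿ` is harmonic if it is `C²` there and its
Laplacian with respect to the underlying real coordinates of `ℂⁿ ≅ ℝ^{2n}` vanishes identically. -/
def HarmonicOnCn {n : ℕ} (U : EuclideanSpace ℂ (Fin n) → ℝ)
    (Ω : Set (EuclideanSpace ℂ (Fin n))) : Prop :=
  ContDiffOn ℝ 2 U Ω ∧ ∀ z ∈ Ω,
    (∑ j : Fin n,
      (fderiv ℝ (fderiv ℝ U) z (EuclideanSpace.single j (1:ℂ)) (EuclideanSpace.single j (1:ℂ)) +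
        fderiv ℝ (fderiv ℝ U) z (EuclideanSpace.single j Complex.I)
          (EuclideanSpace.single j Complex.I))) = 0

section part1
open Real MeasureTheory Set Filter Topology
open scoped RealInnerProductSpace

set_option linter.unusedSectionVars false

section abstractPart
variable {E : Type*} [NormedAddCommGroup E] [InnerProductSpace ℝ E] [FiniteDimensional ℝ E]
variable {ι : Type*} [Fintype ι]

noncomputable def lapB (b : OrthonormalBasis ι ℝ E) (U : E → ℝ) (z : E) : ℝ :=
  ∑ i, fderiv ℝ (fderiv ℝ U) z (b i) (b i)

def HarmB (b : OrthonormalBasis ι ℝ E) (U : E → ℝ) (Ω : Set E) : Prop :=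
  ContDiffOn ℝ 2 U Ω ∧ ∀ z ∈ Ω, lapB b U z = 0

def VisSub (b : OrthonormalBasis ι ℝ E) (g : E → ℝ) (Ω : Set E) : Prop :=
  ∀ x ∈ Ω, ∀ φ : E → ℝ, ContDiffAt ℝ 2 φ x → IsLocalMax (fun y => g y - φ y) x → 0 ≤ lapB b φ x

lemma fderiv_contDiffAt {F : Type*} [NormedAddCommGroup F] [NormedSpace ℝ F] {U : E → F} {z : E} (h : ContDiffAt ℝ 2 U z) : ContDiffAt ℝ 1 (fderiv ℝ U) z :=
  h.fderiv_right (by norm_num)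

lemma fderiv2_add {F : Type*} [NormedAddCommGroup F] [NormedSpace ℝ F] {U V : E → F} {z : E}
    (hU : ContDiffAt ℝ 2 U z) (hV : ContDiffAt ℝ 2 V z) :
    fderiv ℝ (fderiv ℝ (fun x => U x + V x)) z
      = fderiv ℝ (fderiv ℝ U) z + fderiv ℝ (fderiv ℝ V) z := by
  have h1 : fderiv ℝ (fun x => U x + V x) =ᶠ[𝓝 z] fun x => fderiv ℝ U x + fderiv ℝ V x := by
    filter_upwards [hU.eventually (by simp), hV.eventually (by simp)] with x h1 h2
    exact fderiv_fun_add (h1.differentiableAt (by simp)) (h2.differentiableAt (by simp))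
  rw [h1.fderiv_eq]
  exact fderiv_fun_add ((fderiv_contDiffAt hU).differentiableAt (by simp))
    ((fderiv_contDiffAt hV).differentiableAt (by simp))

lemma fderiv2_const_smul {F : Type*} [NormedAddCommGroup F] [NormedSpace ℝ F] {U : E → F} {z : E}
    (c : ℝ) (hU : ContDiffAt ℝ 2 U z) :
    fderiv ℝ (fderiv ℝ (fun x => c • U x)) z = c • fderiv ℝ (fderiv ℝ U) z := by
  have h1 : fderiv ℝ (fun x => c • U x) =ᶠ[𝓝 z] fun x => c • fderiv ℝ U x := by
    filter_upwards [hU.eventually (by simp)] with x h1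
    exact fderiv_fun_const_smul (h1.differentiableAt (by simp)) c
  rw [h1.fderiv_eq]
  exact fderiv_fun_const_smul ((fderiv_contDiffAt hU).differentiableAt (by simp)) c

/-- bridge: second directional derivative through explicit one-variable derivatives -/
lemma fderiv2_eq {F : Type*} [NormedAddCommGroup F] [NormedSpace ℝ F] {U : E → F} {z e : E} (hU : ContDiffAt ℝ 2 U z) :
    HasDerivAt (fun t : ℝ => fderiv ℝ U (z + t • e) e) (fderiv ℝ (fderiv ℝ U) z e e) 0 := by
  have h1 : HasFDerivAt (fderiv ℝ U) (fderiv ℝ (fderiv ℝ U) z) z :=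
    ((fderiv_contDiffAt hU).differentiableAt (by simp)).hasFDerivAt
  have hl : HasDerivAt (fun t : ℝ => z + t • e) e 0 := by
    simpa using ((hasDerivAt_id (0:ℝ)).smul_const e).const_add z
  have h2 : HasDerivAt (fun t : ℝ => fderiv ℝ U (z + t • e)) (fderiv ℝ (fderiv ℝ U) z e) 0 := by
    have : HasFDerivAt (fderiv ℝ U) (fderiv ℝ (fderiv ℝ U) z) (z + (0:ℝ) • e) := by simpa using h1
    exact this.comp_hasDerivAt 0 hl
  simpa using h2.clm_apply (hasDerivAt_const (0:ℝ) e)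

lemma line_hasDerivAt {F : Type*} [NormedAddCommGroup F] [NormedSpace ℝ F] {U : E → F} {z e : E} (hU : ContDiffAt ℝ 2 U z) :
    ∀ᶠ t : ℝ in 𝓝 0, HasDerivAt (fun t : ℝ => U (z + t • e)) (fderiv ℝ U (z + t • e) e) t := by
  have hc : Tendsto (fun t : ℝ => z + t • e) (𝓝 0) (𝓝 z) := by
    have : Continuous (fun t : ℝ => z + t • e) := by fun_prop
    simpa using this.tendsto 0
  filter_upwards [hc.eventually (hU.eventually (by simp))] with t ht
  have hl : HasDerivAt (fun t : ℝ => z + t • e) e t := by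
    simpa using ((hasDerivAt_id t).smul_const e).const_add z
  exact (ht.differentiableAt (by simp)).hasFDerivAt.comp_hasDerivAt t hl

/-- If along the line the function has derivative `d t` and `d` has derivative `s` at `0`. -/
lemma fderiv2_of_line {F : Type*} [NormedAddCommGroup F] [NormedSpace ℝ F] {U : E → F} {z e : E} (hU : ContDiffAt ℝ 2 U z) {d : ℝ → F} {s : F}
    (h1 : ∀ᶠ t : ℝ in 𝓝 0, HasDerivAt (fun t : ℝ => U (z + t • e)) (d t) t)
    (h2 : HasDerivAt d s 0) : fderiv ℝ (fderiv ℝ U) z e e = s := by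
  have h3 : (fun t : ℝ => fderiv ℝ U (z + t • e) e) =ᶠ[𝓝 0] d := by
    filter_upwards [h1, line_hasDerivAt (e := e) hU] with t h h'
    exact h'.unique h
  exact (fderiv2_eq (e := e) hU).unique (h2.congr_of_eventuallyEq h3)

lemma fderiv2_nonpos_of_isLocalMax {U : E → ℝ} {z : E} (hU : ContDiffAt ℝ 2 U z)
    (hm : IsLocalMax U z) (e : E) : fderiv ℝ (fderiv ℝ U) z e e ≤ 0 := by
  by_contra! hpos
  set k : ℝ → ℝ := fun t => U (z + t • e) with hk
  have hkd : deriv k =ᶠ[𝓝 0] fun t => fderiv ℝ U (z + t • e) e := by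
    filter_upwards [line_hasDerivAt (e := e) hU] with t h using h.deriv
  have hdd : deriv (deriv k) 0 = fderiv ℝ (fderiv ℝ U) z e e := by
    rw [hkd.deriv_eq]; exact (fderiv2_eq hU).deriv
  have hc : Tendsto (fun t : ℝ => z + t • e) (𝓝 0) (𝓝 z) := by
    have : Continuous (fun t : ℝ => z + t • e) := by fun_prop
    simpa using this.tendsto 0
  have hkm : IsLocalMax k 0 := by
    have := hc.eventually hm
    filter_upwards [this] with t ht
    simpa [hk] using ht
  have hcont : ContinuousAt k 0 := (line_hasDerivAt (e := e) hU).self_of_nhds.continuousAt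
  have hmin : IsLocalMin k 0 := isLocalMin_of_deriv_deriv_pos (by rw [hdd]; exact hpos) hkm.deriv_eq_zero hcont
  have hconst : k =ᶠ[𝓝 0] fun _ => k 0 := by
    filter_upwards [hkm, hmin] with t h1 h2 using le_antisymm h1 h2
  have h0 : deriv (deriv k) 0 = 0 := by
    rw [hconst.deriv.deriv_eq]; simp
  linarith

variable (b : OrthonormalBasis ι ℝ E)

lemma lapB_nonpos_of_isLocalMax {U : E → ℝ} {z : E} (hU : ContDiffAt ℝ 2 U z)
    (hm : IsLocalMax U z) : lapB b U z ≤ 0 :=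
  Finset.sum_nonpos fun _ _ => fderiv2_nonpos_of_isLocalMax hU hm _

lemma lapB_add {U V : E → ℝ} {z : E} (hU : ContDiffAt ℝ 2 U z) (hV : ContDiffAt ℝ 2 V z) :
    lapB b (fun x => U x + V x) z = lapB b U z + lapB b V z := by
  simp only [lapB, fderiv2_add hU hV, ← Finset.sum_add_distrib]; rfl

lemma lapB_const_mul {U : E → ℝ} {z : E} (c : ℝ) (hU : ContDiffAt ℝ 2 U z) :
    lapB b (fun x => c * U x) z = c * lapB b U z := by
  have := fderiv2_const_smul c hU
  simp only [smul_eq_mul] at this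
  simp only [lapB, this, Finset.mul_sum]; rfl

lemma lapB_sub {U V : E → ℝ} {z : E} (hU : ContDiffAt ℝ 2 U z) (hV : ContDiffAt ℝ 2 V z) :
    lapB b (fun x => U x - V x) z = lapB b U z - lapB b V z := by
  have h : (fun x => U x - V x) = fun x => U x + (-1) * V x := by ext; ring
  rw [h, lapB_add b hU (contDiffAt_const.mul hV), lapB_const_mul b _ hV]; ring

lemma lapB_const (c : ℝ) (z : E) : lapB b (fun _ => c) z = 0 := by
  simp [lapB]

lemma lapB_normsq (a z : E) : lapB b (fun x => ‖x - a‖ ^ 2) z = 2 * Fintype.card ι := by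
  have hc : ContDiffAt ℝ 2 (fun x => ‖x - a‖ ^ 2) z :=
    ((contDiffAt_id.sub contDiffAt_const).norm_sq ℝ)
  have : ∀ i, fderiv ℝ (fderiv ℝ (fun x => ‖x - a‖ ^ 2)) z (b i) (b i) = 2 := by
    intro i
    have key : (fun t : ℝ => ‖z + t • b i - a‖ ^ 2)
        = fun t : ℝ => ‖z - a‖ ^ 2 + 2 * t * ⟪z - a, b i⟫ + t ^ 2 := by
      ext t
      have : z + t • b i - a = (z - a) + t • b i := by abel
      rw [this, norm_add_sq_real, norm_smul, inner_smul_right]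
      simp
      ring
    apply fderiv2_of_line hc (d := fun t => 2 * ⟪z - a, b i⟫ + 2 * t)
    · refine Eventually.of_forall fun t => ?_
      rw [key]
      have := (((((hasDerivAt_id t).const_mul 2).mul_const ⟪z - a, b i⟫).const_add (‖z - a‖ ^ 2)).add ((hasDerivAt_id t).pow 2))
      exact this.congr_deriv (by simp)
    · simpa using ((hasDerivAt_id (0:ℝ)).const_mul 2).const_add (2 * ⟪z - a, b i⟫)
  simp [lapB, this, mul_comm]

variable {b}

lemma HarmB.contDiffAt {U : E → ℝ} {Ω : Set E} (h : HarmB b U Ω) (hΩ : IsOpen Ω) {z : E}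
    (hz : z ∈ Ω) : ContDiffAt ℝ 2 U z := h.1.contDiffAt (hΩ.mem_nhds hz)

lemma HarmB.mono {U : E → ℝ} {Ω Ω' : Set E} (h : HarmB b U Ω) (hs : Ω' ⊆ Ω) : HarmB b U Ω' :=
  ⟨h.1.mono hs, fun z hz => h.2 z (hs hz)⟩

lemma HarmB.sub {U V : E → ℝ} {Ω : Set E} (hΩ : IsOpen Ω) (h : HarmB b U Ω) (h' : HarmB b V Ω) :
    HarmB b (fun x => U x - V x) Ω :=
  ⟨h.1.sub h'.1, fun z hz => by
    rw [lapB_sub b (h.contDiffAt hΩ hz) (h'.contDiffAt hΩ hz), h.2 z hz, h'.2 z hz, sub_zero]⟩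

lemma HarmB.add_const {U : E → ℝ} {Ω : Set E} (hΩ : IsOpen Ω) (h : HarmB b U Ω) (c : ℝ) :
    HarmB b (fun x => U x + c) Ω :=
  ⟨h.1.add contDiffOn_const, fun z hz => by
    rw [lapB_add b (h.contDiffAt hΩ hz) contDiffAt_const, h.2 z hz, lapB_const, zero_add]⟩

lemma HarmB.const_mul {U : E → ℝ} {Ω : Set E} (hΩ : IsOpen Ω) (h : HarmB b U Ω) (c : ℝ) :
    HarmB b (fun x => c * U x) Ω :=
  ⟨contDiffOn_const.mul h.1, fun z hz => by
    rw [lapB_const_mul b c (h.contDiffAt hΩ hz), h.2 z hz, mul_zero]⟩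

lemma lapB_congr {U V : E → ℝ} {z : E} (h : U =ᶠ[𝓝 z] V) : lapB b U z = lapB b V z := by
  simp only [lapB, h.fderiv.fderiv_eq]

lemma HarmB.congr {U V : E → ℝ} {Ω : Set E} (hΩ : IsOpen Ω) (h : HarmB b U Ω)
    (hUV : ∀ z ∈ Ω, V z = U z) : HarmB b V Ω :=
  ⟨h.1.congr hUV, fun z hz => by
    rw [← h.2 z hz]; exact lapB_congr (by filter_upwards [hΩ.mem_nhds hz] with x hx using hUV x hx)⟩

lemma visSub_of_C2 {g : E → ℝ} {Ω : Set E} (h : ∀ x ∈ Ω, ContDiffAt ℝ 2 g x)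
    (hl : ∀ x ∈ Ω, 0 ≤ lapB b g x) : VisSub b g Ω := by
  intro x hx φ hφ hm
  have := lapB_nonpos_of_isLocalMax b ((h x hx).sub hφ) hm
  have h2 := lapB_sub b (h x hx) hφ
  have h3 := hl x hx
  have : lapB b (fun x => g x - φ x) x ≤ 0 := this
  linarith

lemma HarmB.visSub {g : E → ℝ} {Ω : Set E} (hΩ : IsOpen Ω) (h : HarmB b g Ω) : VisSub b g Ω :=
  visSub_of_C2 (fun _ hx => h.contDiffAt hΩ hx) (fun x hx => (h.2 x hx).ge)

lemma VisSub.max {g₁ g₂ : E → ℝ} {Ω : Set E} (h₁ : VisSub b g₁ Ω) (h₂ : VisSub b g₂ Ω) :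
    VisSub b (fun x => max (g₁ x) (g₂ x)) Ω := by
  intro x hx φ hφ hm
  rcases le_total (g₁ x) (g₂ x) with h | h
  · refine h₂ x hx φ hφ ?_
    filter_upwards [hm] with y hy
    simp only [max_eq_right h] at hy
    linarith [le_max_right (g₁ y) (g₂ y)]
  · refine h₁ x hx φ hφ ?_
    filter_upwards [hm] with y hy
    simp only [max_eq_left h] at hy
    linarith [le_max_left (g₁ y) (g₂ y)]

lemma comparison [Nonempty ι] {g H : E → ℝ} {a : E} {R : ℝ}
    (hg : ContinuousOn g (Metric.closedBall a R)) (hgs : VisSub b g (Metric.ball a R))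
    (hH : ContinuousOn H (Metric.closedBall a R)) (hHs : HarmB b H (Metric.ball a R))
    (hle : ∀ x ∈ Metric.sphere a R, g x ≤ H x) :
    ∀ x ∈ Metric.closedBall a R, g x ≤ H x := by
  intro x hx
  by_contra! hlt
  have : ∃ ε > 0, ε * R ^ 2 < g x - H x := by
    refine ⟨(g x - H x) / (R ^ 2 + 1), div_pos (by linarith) (by positivity), ?_⟩
    rw [div_mul_eq_mul_div, div_lt_iff₀ (by positivity)]
    nlinarith
  obtain ⟨ε, hε, hεR⟩ := this
  set ψ : E → ℝ := fun y => g y - (H y - ε * ‖y - a‖ ^ 2) with hψ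
  have hψc : ContinuousOn ψ (Metric.closedBall a R) :=
    hg.sub (hH.sub (Continuous.continuousOn (by fun_prop)))
  obtain ⟨y, hy, hmax⟩ := (isCompact_closedBall a R).exists_isMaxOn ⟨x, hx⟩ hψc
  have hyx : ψ x ≤ ψ y := hmax hx
  have hψx : g x - H x ≤ ψ x := by
    have : 0 ≤ ε * ‖x - a‖ ^ 2 := by positivity
    simp only [hψ]; linarith
  have hyb : y ∈ Metric.ball a R := by
    by_contra hyb
    have hys : y ∈ Metric.sphere a R := by
      simp only [Metric.mem_ball, Metric.mem_closedBall, Metric.mem_sphere] at *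
      linarith
    have h1 := hle y hys
    have h2 : ψ y ≤ ε * R ^ 2 := by
      have : ‖y - a‖ = R := by simpa [dist_eq_norm] using hys
      simp only [hψ, this]; linarith
    linarith
  have hn : ContDiffAt ℝ 2 (fun x => ε * ‖x - a‖ ^ 2) y :=
    contDiffAt_const.mul ((contDiffAt_id.sub contDiffAt_const).norm_sq ℝ)
  have hHy := hHs.contDiffAt Metric.isOpen_ball hyb
  have := hgs y hyb (fun y => H y - ε * ‖y - a‖ ^ 2) (hHy.sub hn) (by
    filter_upwards [Metric.isOpen_ball.mem_nhds hyb] with z hz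
    exact hmax (Metric.ball_subset_closedBall hz))
  have hn0 : ContDiffAt ℝ 2 (fun x => ‖x - a‖ ^ 2) y :=
    (contDiffAt_id.sub contDiffAt_const).norm_sq ℝ
  rw [lapB_sub b hHy hn, hHs.2 y hyb, lapB_const_mul b _ hn0, lapB_normsq] at this
  have hcard : (0:ℝ) < Fintype.card ι := by exact_mod_cast Fintype.card_pos
  have : 0 < ε * (2 * Fintype.card ι) := by positivity
  linarith

end abstractPart
end part1

section part2
open Real MeasureTheory Set Filter Topology
open scoped RealInnerProductSpace
set_option linter.unusedSectionVars false

section perronPart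
variable {E : Type*} [NormedAddCommGroup E] [InnerProductSpace ℝ E] [FiniteDimensional ℝ E]
variable {ι : Type*} [Fintype ι]

def DirichletProp (b : OrthonormalBasis ι ℝ E) (C : ℝ) : Prop :=
  ∀ (a : E) (R : ℝ), 0 < R → ∀ g : E → ℝ, ContinuousOn g (Metric.sphere a R) →
    ∃ H : E → ℝ, ContinuousOn H (Metric.closedBall a R) ∧ (∀ x ∈ Metric.sphere a R, H x = g x) ∧
      HarmB b H (Metric.ball a R) ∧
      ((∀ x ∈ Metric.sphere a R, 0 ≤ g x) → ∀ x ∈ Metric.ball a (R / 2), H x ≤ C * H a)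

variable {b : OrthonormalBasis ι ℝ E} {C : ℝ}

lemma harnack [Nonempty ι] (hD : DirichletProp b C) {a : E} {R : ℝ} (hR : 0 < R) {H : E → ℝ}
    (hc : ContinuousOn H (Metric.closedBall a R)) (hH : HarmB b H (Metric.ball a R))
    (h0 : ∀ x ∈ Metric.sphere a R, 0 ≤ H x) : ∀ x ∈ Metric.ball a (R / 2), H x ≤ C * H a := by
  obtain ⟨K, hKc, hKe, hKh, hK⟩ := hD a R hR H (hc.mono Metric.sphere_subset_closedBall)
  have e : ∀ x ∈ Metric.closedBall a R, H x = K x := fun x hx => le_antisymm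
    (comparison hc (hH.visSub Metric.isOpen_ball) hKc hKh (fun y hy => (hKe y hy).ge) x hx)
    (comparison hKc (hKh.visSub Metric.isOpen_ball) hc hH (fun y hy => (hKe y hy).le) x hx)
  intro x hx
  rw [e x (Metric.ball_subset_closedBall (Metric.ball_subset_ball (by linarith) hx)),
    e a (Metric.mem_closedBall_self hR.le)]
  exact hK h0 x hx

lemma harm_of_approx [Nonempty ι] (hD : DirichletProp b C) {a : E} {r : ℝ} (hr : 0 < r)
    {h : E → ℝ} (happ : ∀ ε > 0, ∃ H, HarmB b H (Metric.ball a r) ∧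
      ∀ x ∈ Metric.ball a r, |h x - H x| ≤ ε) : HarmB b h (Metric.ball a (r / 2)) := by
  have hsub : Metric.closedBall a (r / 2) ⊆ Metric.ball a r :=
    Metric.closedBall_subset_ball (by linarith)
  have hc : ContinuousOn h (Metric.ball a r) := by
    apply continuousOn_of_uniform_approx_of_continuousOn
    intro u hu
    obtain ⟨ε, hε, hεu⟩ := Metric.mem_uniformity_dist.1 hu
    obtain ⟨H, hH, hHe⟩ := happ (ε / 2) (by linarith)
    refine ⟨H, hH.1.continuousOn, fun y hy => hεu ?_⟩
    rw [Real.dist_eq]; linarith [hHe y hy]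
  obtain ⟨K, hKc, hKe, hKh, -⟩ := hD a (r / 2) (by linarith) h
    (hc.mono (Metric.sphere_subset_closedBall.trans hsub))
  refine hKh.congr Metric.isOpen_ball fun x hx => ?_
  have hx' := Metric.ball_subset_closedBall hx
  have key : ∀ ε > 0, |h x - K x| ≤ ε := by
    intro ε hε
    obtain ⟨H, hH, hHe⟩ := happ (ε / 2) (by linarith)
    have hHc : ContinuousOn H (Metric.closedBall a (r / 2)) := hH.1.continuousOn.mono hsub
    have hHh : HarmB b H (Metric.ball a (r / 2)) := hH.mono (Metric.ball_subset_closedBall.trans hsub)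
    have h1 := comparison (H := fun y => K y + ε / 2) hHc (hHh.visSub Metric.isOpen_ball) (hKc.add continuousOn_const)
      (hKh.add_const Metric.isOpen_ball (ε / 2)) (fun y hy => by
        have := hHe y (hsub (Metric.sphere_subset_closedBall hy))
        rw [abs_le] at this
        have := hKe y hy; linarith) x hx'
    have h2 := comparison (H := fun y => H y + ε / 2) hKc (hKh.visSub Metric.isOpen_ball) (hHc.add continuousOn_const)
      (hHh.add_const Metric.isOpen_ball (ε / 2)) (fun y hy => by
        have := hHe y (hsub (Metric.sphere_subset_closedBall hy))
        rw [abs_le] at this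
        have := hKe y hy; linarith) x hx'
    have h3 := hHe x (hsub hx')
    rw [abs_le] at h3 ⊢
    constructor <;> linarith
  have : |h x - K x| ≤ 0 := le_of_forall_pos_le_add fun ε hε => by simpa using key ε hε
  have := abs_nonpos_iff.1 this
  linarith

open Classical in
lemma exists_mod [Nonempty ι] (hD : DirichletProp b C) {Ω : Set E} {g : E → ℝ}
    (hg : ContinuousOn g Ω) (hgs : VisSub b g Ω) {a : E} {R : ℝ} (hR : 0 < R)
    (hsub : Metric.closedBall a R ⊆ Ω) :
    ∃ M : E → ℝ, ContinuousOn M Ω ∧ VisSub b M Ω ∧ HarmB b M (Metric.ball a R) ∧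
      (∀ x ∈ Ω, g x ≤ M x) ∧ (∀ x ∉ Metric.ball a R, M x = g x) := by
  obtain ⟨H, hHc, hHe, hHh, -⟩ := hD a R hR g (hg.mono (Metric.sphere_subset_closedBall.trans hsub))
  have hle := comparison (hg.mono hsub) (fun x hx => hgs x (hsub (Metric.ball_subset_closedBall hx)))
    hHc hHh (fun y hy => (hHe y hy).ge)
  have hMg : ∀ x, g x ≤ (Metric.ball a R).piecewise H g x := by
    intro x
    by_cases hx : x ∈ Metric.ball a R
    · rw [piecewise_eq_of_mem _ _ _ hx]; exact hle x (Metric.ball_subset_closedBall hx)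
    · rw [piecewise_eq_of_notMem _ _ _ hx]
  have hMh : HarmB b ((Metric.ball a R).piecewise H g) (Metric.ball a R) :=
    hHh.congr Metric.isOpen_ball fun x hx => piecewise_eq_of_mem _ _ _ hx
  refine ⟨(Metric.ball a R).piecewise H g, ?_, ?_, hMh, fun x _ => hMg x,
    fun x hx => piecewise_eq_of_notMem _ _ _ hx⟩
  · refine ContinuousOn.piecewise ?_ ?_ ?_
    · intro x hx
      rw [frontier_ball a hR.ne'] at hx
      exact hHe x hx.2
    · rw [closure_ball a hR.ne']
      exact hHc.mono inter_subset_right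
    · exact hg.mono inter_subset_left
  · intro x hx φ hφ hm
    by_cases hxb : x ∈ Metric.ball a R
    · exact hMh.visSub Metric.isOpen_ball x hxb φ hφ hm
    · refine hgs x hx φ hφ ?_
      filter_upwards [hm] with y hy
      rw [piecewise_eq_of_notMem _ _ _ hxb] at hy
      linarith [hMg y]

lemma perron [Nonempty ι] (hC : 0 ≤ C) (hD : DirichletProp b C) {Ω : Set E} (hΩ : IsOpen Ω)
    {s S : E → ℝ} (hs : ContinuousOn s Ω) (hss : VisSub b s Ω) (hsS : ∀ x ∈ Ω, s x ≤ S x)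
    (hS : ∀ (a : E) (R : ℝ), 0 < R → Metric.closedBall a R ⊆ Ω → ∀ H : E → ℝ,
      ContinuousOn H (Metric.closedBall a R) → HarmB b H (Metric.ball a R) →
      (∀ x ∈ Metric.sphere a R, H x ≤ S x) → ∀ x ∈ Metric.ball a R, H x ≤ S x) :
    ∃ h : E → ℝ, HarmB b h Ω ∧ (∀ x ∈ Ω, s x ≤ h x) ∧ ∀ x ∈ Ω, h x ≤ S x := by
  set 𝒞 : Set (E → ℝ) := {g | ContinuousOn g Ω ∧ VisSub b g Ω ∧ ∀ x ∈ Ω, g x ≤ S x} with h𝒞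
  have hsC : s ∈ 𝒞 := ⟨hs, hss, hsS⟩
  set h : E → ℝ := fun x => sSup ((fun g : E → ℝ => g x) '' 𝒞) with hh
  have hne : ∀ x, ((fun g : E → ℝ => g x) '' 𝒞).Nonempty := fun x => ⟨s x, s, hsC, rfl⟩
  have hbdd : ∀ x ∈ Ω, BddAbove ((fun g : E → ℝ => g x) '' 𝒞) := by
    rintro x hx
    refine ⟨S x, ?_⟩
    rintro _ ⟨g, hg, rfl⟩
    exact hg.2.2 x hx
  have hle : ∀ g ∈ 𝒞, ∀ x ∈ Ω, g x ≤ h x := fun g hg x hx => le_csSup (hbdd x hx) ⟨g, hg, rfl⟩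
  have hmod : ∀ g ∈ 𝒞, ∀ a R, 0 < R → Metric.closedBall a R ⊆ Ω → ∃ M ∈ 𝒞,
      HarmB b M (Metric.ball a R) ∧ (∀ x ∈ Ω, g x ≤ M x) ∧ (∀ x ∉ Metric.ball a R, M x = g x) := by
    intro g hg a R hR hsub
    obtain ⟨M, hMc, hMs, hMh, hMg, hMe⟩ := exists_mod hD hg.1 hg.2.1 hR hsub
    refine ⟨M, ⟨hMc, hMs, fun x hx => ?_⟩, hMh, hMg, hMe⟩
    by_cases hxb : x ∈ Metric.ball a R
    · refine hS a R hR hsub M (hMc.mono hsub) hMh (fun y hy => ?_) x hxb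
      have hyb : y ∉ Metric.ball a R := by
        simp only [Metric.mem_ball, Metric.mem_sphere] at *; linarith
      rw [hMe y hyb]
      exact hg.2.2 y (hsub (Metric.sphere_subset_closedBall hy))
    · rw [hMe x hxb]; exact hg.2.2 x hx
  have hloc : ∀ a ∈ Ω, ∃ r > 0, HarmB b h (Metric.ball a r) := by
    intro a ha
    obtain ⟨R, hR, hsub⟩ := Metric.nhds_basis_closedBall.mem_iff.1 (hΩ.mem_nhds ha)
    refine ⟨R / 2 / 2, by linarith, harm_of_approx hD (by linarith) fun ε hε => ?_⟩
    have hδ : 0 < ε / (C + 1) := div_pos hε (by linarith)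
    obtain ⟨_, ⟨g, hg, rfl⟩, hga⟩ := exists_lt_of_lt_csSup (hne a) (sub_lt_self (h a) hδ)
    simp only at hga
    obtain ⟨M, hM, hMh, hMg, hMe⟩ := hmod g hg a R hR hsub
    have hbs : Metric.ball a (R / 2) ⊆ Metric.ball a R := Metric.ball_subset_ball (by linarith)
    refine ⟨M, hMh.mono hbs, fun x hx => ?_⟩
    have hxΩ : x ∈ Ω := hsub (Metric.ball_subset_closedBall (hbs hx))
    have h1 := hle M hM x hxΩ
    have h2 : h x ≤ M x + ε := by
      refine csSup_le (hne x) ?_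
      rintro _ ⟨g', hg', rfl⟩
      have hgm : (fun y => max (g y) (g' y)) ∈ 𝒞 :=
        ⟨hg.1.sup hg'.1, hg.2.1.max hg'.2.1, fun y hy => max_le (hg.2.2 y hy) (hg'.2.2 y hy)⟩
      obtain ⟨N, hN, hNh, hNg, hNe⟩ := hmod _ hgm a R hR hsub
      have := harnack hD hR (H := fun y => N y - M y) ((hN.1.sub hM.1).mono hsub)
        (hNh.sub Metric.isOpen_ball hMh) (fun y hy => by
          have hyb : y ∉ Metric.ball a R := by
            simp only [Metric.mem_ball, Metric.mem_sphere] at *; linarith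
          rw [hNe y hyb, hMe y hyb]
          linarith [le_max_left (g y) (g' y)]) x hx
      have h3 := hle N hN a ha
      have h4 := hMg a ha
      have h5 : g' x ≤ N x := (le_max_right _ _).trans (hNg x hxΩ)
      have h6 : C * (N a - M a) ≤ C * (ε / (C + 1)) := by
        apply mul_le_mul_of_nonneg_left _ hC
        linarith
      have h7 : C * (ε / (C + 1)) ≤ ε := by
        rw [mul_div_assoc', div_le_iff₀ (by linarith)]
        nlinarith
      show g' x ≤ M x + ε
      have : N x - M x ≤ C * (N a - M a) := this
      linarith
    rw [abs_le]; constructor <;> linarith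
  refine ⟨h, ⟨fun x hx => ?_, fun x hx => ?_⟩, hle s hsC, fun x hx => ?_⟩
  · obtain ⟨r, hr, hh⟩ := hloc x hx
    exact (hh.contDiffAt Metric.isOpen_ball (Metric.mem_ball_self hr)).contDiffWithinAt
  · obtain ⟨r, hr, hh⟩ := hloc x hx
    exact hh.2 x (Metric.mem_ball_self hr)
  · refine csSup_le (hne x) ?_
    rintro _ ⟨g, hg, rfl⟩
    exact hg.2.2 x hx

end perronPart
end part2

section part3
open Real MeasureTheory Set Filter Topology
open scoped RealInnerProductSpace
set_option linter.unusedSectionVars false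

section paramPart
variable {E : Type*} [NormedAddCommGroup E] [InnerProductSpace ℝ E] [FiniteDimensional ℝ E]
  [MeasurableSpace E] [BorelSpace E]
variable {F : Type*} [NormedAddCommGroup F] [NormedSpace ℝ F] [CompleteSpace F]

lemma contDiffAt_partial {k : E → E → F} {x w : E} {n m : WithTop ℕ∞}
    (h : ContDiffAt ℝ n (Function.uncurry k) (x, w)) (hmn : m + 1 ≤ n) :
    ContDiffAt ℝ m (Function.uncurry fun x w => fderiv ℝ (fun y => k y w) x) (x, w) := by
  have := ContDiffAt.fderiv (𝕜 := ℝ) (f := fun (q : E × E) (y : E) => k y q.2) (g := fun q : E × E => q.1)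
    (x₀ := (x, w)) (m := m) (n := n) ?_ contDiffAt_fst hmn
  · exact this
  · have h2 : ContDiffAt ℝ n (fun q : (E × E) × E => (q.2, q.1.2)) ((x, w), x) := by fun_prop
    exact ContDiffAt.comp (g := Function.uncurry k) ((x, w), x) h h2

lemma integrable_of_contOn {ν : Measure E} [IsFiniteMeasure ν] {T : Set E} (hT : IsCompact T)
    (hν : ∀ᵐ w ∂ν, w ∈ T) {q : E → F} (hq : ContinuousOn q T) : Integrable q ν := by
  have h : ν.restrict T = ν := Measure.restrict_eq_self_of_ae_mem hν
  rw [← h]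
  exact hq.integrableOn_compact hT

lemma integral_smul_apply {ν : Measure E} [IsFiniteMeasure ν] {T : Set E} (hT : IsCompact T)
    (hν : ∀ᵐ w ∂ν, w ∈ T) {q : E → E →L[ℝ] F} (hq : ContinuousOn q T) {g : E → ℝ}
    (hg : ContinuousOn g T) (e : E) :
    (∫ w, g w • q w ∂ν) e = ∫ w, g w • (q w e) ∂ν := by
  exact ContinuousLinearMap.integral_apply (integrable_of_contOn hT hν (hg.smul hq)) e

lemma hasFDerivAt_param {ν : Measure E} [IsFiniteMeasure ν] {T V : Set E} (hT : IsCompact T)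
    (hV : IsOpen V) (hν : ∀ᵐ w ∂ν, w ∈ T) {k : E → E → F}
    (hk : ∀ x ∈ V, ∀ w ∈ T, ContDiffAt ℝ 1 (Function.uncurry k) (x, w))
    {g : E → ℝ} (hg : ContinuousOn g T) {x : E} (hx : x ∈ V) :
    HasFDerivAt (fun x => ∫ w, g w • k x w ∂ν) (∫ w, g w • fderiv ℝ (fun y => k y w) x ∂ν) x := by
  obtain ⟨r, hr, hrV⟩ := Metric.nhds_basis_closedBall.mem_iff.1 (hV.mem_nhds hx)
  have hcont : ∀ y ∈ V, ContinuousOn (k y) T := fun y hy w hw =>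
    ((hk y hy w hw).continuousAt.comp (f := fun w => (y, w)) (by fun_prop)).continuousWithinAt
  have hc1 : ∀ y ∈ V, ∀ w ∈ T, ContinuousAt
      (Function.uncurry fun x w => fderiv ℝ (fun y => k y w) x) (y, w) := fun y hy w hw =>
    (contDiffAt_partial (m := 0) (hk y hy w hw) (by simp)).continuousAt
  have hcont1 : ∀ y ∈ V, ContinuousOn (fun w => fderiv ℝ (fun y => k y w) y) T := fun y hy w hw =>
    ((hc1 y hy w hw).comp (f := fun w => (y, w)) (by fun_prop)).continuousWithinAt
  have hb : ∃ M, ∀ q ∈ Metric.closedBall x r ×ˢ T,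
      ‖g q.2 • fderiv ℝ (fun y => k y q.2) q.1‖ ≤ M := by
    apply ((isCompact_closedBall x r).prod hT).exists_bound_of_continuousOn
    refine ContinuousOn.smul (hg.comp continuousOn_snd fun q hq => hq.2) ?_
    intro q hq
    exact (hc1 q.1 (hrV hq.1) q.2 hq.2).continuousWithinAt
  obtain ⟨M, hM⟩ := hb
  apply hasFDerivAt_integral_of_dominated_of_fderiv_le (s := Metric.closedBall x r)
    (bound := fun _ => M) (Metric.closedBall_mem_nhds x hr)
  · filter_upwards [hV.mem_nhds hx] with y hy
    exact (integrable_of_contOn hT hν (hg.smul (hcont y hy))).aestronglyMeasurable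
  · exact integrable_of_contOn hT hν (hg.smul (hcont x hx))
  · exact (integrable_of_contOn hT hν (hg.smul (hcont1 x hx))).aestronglyMeasurable
  · filter_upwards [hν] with w hw y hy
    exact hM (y, w) ⟨hy, hw⟩
  · exact integrable_const M
  · filter_upwards [hν] with w hw y hy
    have h1 : ContDiffAt ℝ 1 (fun y => k y w) y :=
      (hk y (hrV hy) w hw).comp (f := fun y => (y, w)) y (by fun_prop)
    exact (h1.differentiableAt (by simp)).hasFDerivAt.const_smul (g w)

lemma param_C2 {ν : Measure E} [IsFiniteMeasure ν] {T V : Set E} (hT : IsCompact T)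
    (hV : IsOpen V) (hν : ∀ᵐ w ∂ν, w ∈ T) {k : E → E → ℝ}
    (hk : ∀ x ∈ V, ∀ w ∈ T, ContDiffAt ℝ 3 (Function.uncurry k) (x, w))
    {g : E → ℝ} (hg : ContinuousOn g T) :
    ContDiffOn ℝ 2 (fun x => ∫ w, g w • k x w ∂ν) V ∧ ∀ x ∈ V, ∀ e : E,
      Integrable (fun w => g w * fderiv ℝ (fderiv ℝ (fun y => k y w)) x e e) ν ∧
      fderiv ℝ (fderiv ℝ (fun x => ∫ w, g w • k x w ∂ν)) x e e
        = ∫ w, g w * fderiv ℝ (fderiv ℝ (fun y => k y w)) x e e ∂ν := by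
  set k1 : E → E → (E →L[ℝ] ℝ) := fun x w => fderiv ℝ (fun y => k y w) x with hk1
  set k2 : E → E → (E →L[ℝ] E →L[ℝ] ℝ) := fun x w => fderiv ℝ (fun y => k1 y w) x with hk2
  have hk1s : ∀ x ∈ V, ∀ w ∈ T, ContDiffAt ℝ 2 (Function.uncurry k1) (x, w) := fun x hx w hw =>
    contDiffAt_partial (hk x hx w hw) (by norm_num)
  have hk2s : ∀ x ∈ V, ∀ w ∈ T, ContDiffAt ℝ 1 (Function.uncurry k2) (x, w) := fun x hx w hw =>
    contDiffAt_partial (hk1s x hx w hw) (by norm_num)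
  have d0 : ∀ x ∈ V, HasFDerivAt (fun x => ∫ w, g w • k x w ∂ν) (∫ w, g w • k1 x w ∂ν) x :=
    fun x hx => hasFDerivAt_param hT hV hν (fun x hx w hw => (hk x hx w hw).of_le (by norm_num)) hg hx
  have d1 : ∀ x ∈ V, HasFDerivAt (fun x => ∫ w, g w • k1 x w ∂ν) (∫ w, g w • k2 x w ∂ν) x :=
    fun x hx => hasFDerivAt_param hT hV hν (fun x hx w hw => (hk1s x hx w hw).of_le (by norm_num)) hg hx
  have d2 : ∀ x ∈ V, ContinuousAt (fun x => ∫ w, g w • k2 x w ∂ν) x :=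
    fun x hx => (hasFDerivAt_param hT hV hν hk2s hg hx).continuousAt
  have e2 : ∀ x ∈ V, fderiv ℝ (fderiv ℝ (fun x => ∫ w, g w • k x w ∂ν)) x
      = ∫ w, g w • k2 x w ∂ν := by
    intro x hx
    have : fderiv ℝ (fun x => ∫ w, g w • k x w ∂ν) =ᶠ[𝓝 x] fun x => ∫ w, g w • k1 x w ∂ν := by
      filter_upwards [hV.mem_nhds hx] with y hy using (d0 y hy).fderiv
    rw [this.fderiv_eq, (d1 x hx).fderiv]
  refine ⟨?_, fun x hx e => ?_⟩
  · have h1 : ContDiffOn ℝ 1 (fun x => ∫ w, g w • k1 x w ∂ν) V := by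
      rw [show (1 : WithTop ℕ∞) = 0 + 1 by norm_num, contDiffOn_succ_iff_fderiv_of_isOpen hV]
      refine ⟨fun x hx => (d1 x hx).differentiableAt.differentiableWithinAt, by simp, ?_⟩
      refine contDiffOn_zero.2 (ContinuousOn.congr (f := fun x => ∫ w, g w • k2 x w ∂ν)
        (fun x hx => (d2 x hx).continuousWithinAt) fun x hx => (d1 x hx).fderiv)
    rw [show (2 : WithTop ℕ∞) = 1 + 1 by norm_num, contDiffOn_succ_iff_fderiv_of_isOpen hV]
    refine ⟨fun x hx => (d0 x hx).differentiableAt.differentiableWithinAt, by simp, ?_⟩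
    exact h1.congr fun x hx => (d0 x hx).fderiv
  · have hkc : ContinuousOn (k2 x) T := fun w hw =>
      ((hk2s x hx w hw).continuousAt.comp (f := fun w => (x, w)) (by fun_prop)).continuousWithinAt
    have hkc1 : ContinuousOn (fun w => k2 x w e) T := hkc.clm_apply continuousOn_const
    have hkc2 : ContinuousOn (fun w => k2 x w e e) T := hkc1.clm_apply continuousOn_const
    refine ⟨integrable_of_contOn hT hν (hg.mul hkc2), ?_⟩
    rw [e2 x hx, integral_smul_apply (F := E →L[ℝ] ℝ) hT hν hkc hg, integral_smul_apply hT hν hkc1 hg]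
    rfl

end paramPart

section kernelPart
variable {E : Type*} [NormedAddCommGroup E] [InnerProductSpace ℝ E] [FiniteDimensional ℝ E]
variable {ι : Type*} [Fintype ι]

noncomputable def pk (a : E) (R : ℝ) (m : ℕ) (x w : E) : ℝ :=
  (R ^ 2 - ‖x - a‖ ^ 2) * ((‖x - w‖ ^ 2)⁻¹) ^ m

lemma pk_contDiffAt (a : E) (R : ℝ) (m : ℕ) {x w : E} (h : x ≠ w) {n : WithTop ℕ∞} :
    ContDiffAt ℝ n (Function.uncurry (pk a R m)) (x, w) := by
  have h1 : ContDiffAt ℝ n (fun q : E × E => ‖q.1 - q.2‖ ^ 2) (x, w) :=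
    (contDiffAt_fst.sub contDiffAt_snd).norm_sq ℝ
  have h2 : ContDiffAt ℝ n (fun q : E × E => ‖q.1 - a‖ ^ 2) (x, w) :=
    (contDiffAt_fst.sub contDiffAt_const).norm_sq ℝ
  have h3 : ‖x - w‖ ^ 2 ≠ 0 := by
    have := norm_pos_iff.2 (sub_ne_zero.2 h); positivity
  exact (contDiffAt_const.sub h2).mul ((h1.inv h3).pow m)

lemma hasDerivAt_inv_pow {D : ℝ → ℝ} {D' t : ℝ} (hD : HasDerivAt D D' t) (h0 : D t ≠ 0) (m : ℕ) :
    HasDerivAt (fun t => ((D t)⁻¹) ^ m) (-(m : ℝ) * D' * ((D t)⁻¹) ^ (m + 1)) t := by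
  refine ((hD.fun_inv h0).fun_pow m).congr_deriv ?_
  rcases m with _ | m
  · simp
  · have : -D' / D t ^ 2 = -D' * ((D t)⁻¹) ^ 2 := by field_simp
    simp only [Nat.add_sub_cancel, this]
    push_cast
    ring

lemma normsq_line (x a e : E) (he : ‖e‖ = 1) (t : ℝ) :
    ‖x + t • e - a‖ ^ 2 = ‖x - a‖ ^ 2 + 2 * t * ⟪x - a, e⟫ + t ^ 2 := by
  have : x + t • e - a = (x - a) + t • e := by abel
  rw [this, norm_add_sq_real, norm_smul, inner_smul_right, he]
  simp
  ring

lemma hasDerivAt_normsq_line (x a e : E) (he : ‖e‖ = 1) (t : ℝ) :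
    HasDerivAt (fun t : ℝ => ‖x + t • e - a‖ ^ 2) (2 * ⟪x - a, e⟫ + 2 * t) t := by
  simp only [normsq_line x a e he]
  have := (((((hasDerivAt_id t).const_mul 2).mul_const ⟪x - a, e⟫).const_add (‖x - a‖ ^ 2)).add ((hasDerivAt_id t).pow 2))
  exact this.congr_deriv (by simp)

lemma pk_second (a : E) (R : ℝ) (m : ℕ) {x w e : E} (h : x ≠ w) (he : ‖e‖ = 1) :
    fderiv ℝ (fderiv ℝ (fun y => pk a R m y w)) x e e =
      -2 * ((‖x - w‖ ^ 2)⁻¹) ^ m + 8 * m * (⟪x - a, e⟫ * ⟪x - w, e⟫) * ((‖x - w‖ ^ 2)⁻¹) ^ (m + 1)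
      - 2 * m * (R ^ 2 - ‖x - a‖ ^ 2) * ((‖x - w‖ ^ 2)⁻¹) ^ (m + 1)
      + 4 * m * (m + 1) * (R ^ 2 - ‖x - a‖ ^ 2) * ⟪x - w, e⟫ ^ 2 * ((‖x - w‖ ^ 2)⁻¹) ^ (m + 2) := by
  have hc : ContDiffAt ℝ 2 (fun y => pk a R m y w) x :=
    (pk_contDiffAt a R m h).comp (f := fun y => (y, w)) x (by fun_prop)
  have hA : ∀ t : ℝ, HasDerivAt (fun t : ℝ => R ^ 2 - ‖x + t • e - a‖ ^ 2)
      (-(2 * ⟪x - a, e⟫ + 2 * t)) t := fun t => (hasDerivAt_normsq_line x a e he t).const_sub _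
  have hD : ∀ t : ℝ, HasDerivAt (fun t : ℝ => ‖x + t • e - w‖ ^ 2)
      (2 * ⟪x - w, e⟫ + 2 * t) t := fun t => hasDerivAt_normsq_line x w e he t
  have hL : ∀ (c t : ℝ), HasDerivAt (fun t : ℝ => 2 * c + 2 * t) 2 t := fun c t => by
    simpa using ((hasDerivAt_id t).const_mul 2).const_add (2 * c)
  have hD0 : ‖x + (0:ℝ) • e - w‖ ^ 2 ≠ 0 := by
    have := norm_pos_iff.2 (sub_ne_zero.2 h)
    simp only [zero_smul, add_zero]; positivity
  have hne : ∀ᶠ t : ℝ in 𝓝 0, ‖x + t • e - w‖ ^ 2 ≠ 0 :=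
    (hD 0).continuousAt.eventually_ne hD0
  refine fderiv2_of_line hc (d := fun t : ℝ => -(2 * ⟪x - a, e⟫ + 2 * t) * ((‖x + t • e - w‖ ^ 2)⁻¹) ^ m
    + (R ^ 2 - ‖x + t • e - a‖ ^ 2) * (-(m : ℝ) * (2 * ⟪x - w, e⟫ + 2 * t) * ((‖x + t • e - w‖ ^ 2)⁻¹) ^ (m + 1))) ?_ ?_
  · filter_upwards [hne] with t ht
    exact (hA t).mul (hasDerivAt_inv_pow (hD t) ht m)
  · have := ((hL ⟪x - a, e⟫ 0).neg.mul (hasDerivAt_inv_pow (hD 0) hD0 m)).add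
      ((hA 0).mul (((hL ⟪x - w, e⟫ 0).const_mul (-(m : ℝ))).mul (hasDerivAt_inv_pow (hD 0) hD0 (m + 1))))
    refine HasDerivAt.congr_deriv this ?_
    simp only [zero_smul, add_zero, mul_zero, Pi.neg_apply, Pi.mul_apply]
    push_cast
    ring

lemma pk_lap (b : OrthonormalBasis ι ℝ E) (a : E) (R : ℝ) (m : ℕ) (hm : Fintype.card ι = 2 * m)
    {x w : E} (h : x ≠ w) (hw : ‖w - a‖ = R) :
    ∑ i, fderiv ℝ (fderiv ℝ (fun y => pk a R m y w)) x (b i) (b i) = 0 := by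
  have h1 : ∑ i, ⟪x - a, b i⟫ * ⟪x - w, b i⟫ = ⟪x - a, x - w⟫ := by
    rw [← b.sum_inner_mul_inner (x - a) (x - w)]
    exact Finset.sum_congr rfl fun i _ => by rw [real_inner_comm (b i) (x - w)]
  have h2 : ∑ i, ⟪x - w, b i⟫ ^ 2 = ‖x - w‖ ^ 2 := by
    rw [← b.sum_sq_inner_right (x - w)]
    exact Finset.sum_congr rfl fun i _ => by rw [real_inner_comm (b i) (x - w)]
  have h3 : ‖x - w‖ ^ 2 = ‖x - a‖ ^ 2 - 2 * ⟪x - a, w - a⟫ + R ^ 2 := by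
    rw [← hw, ← norm_sub_sq_real]; congr 2; abel
  have h4 : ⟪x - a, x - w⟫ = ‖x - a‖ ^ 2 - ⟪x - a, w - a⟫ := by
    rw [← real_inner_self_eq_norm_sq, ← inner_sub_right]; congr 1; abel
  have hd : ‖x - w‖ ^ 2 ≠ 0 := by
    have := norm_pos_iff.2 (sub_ne_zero.2 h); positivity
  simp only [pk_second a R m h (b.norm_eq_one _)]
  rw [Finset.sum_add_distrib, Finset.sum_sub_distrib, Finset.sum_add_distrib]
  simp only [← Finset.sum_mul, ← Finset.mul_sum]
  rw [h1, h2, h4]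
  simp only [Finset.sum_const, Finset.card_univ, hm]
  set c := (‖x - w‖ ^ 2)⁻¹ with hc
  have hdc : ‖x - w‖ ^ 2 * c = 1 := mul_inv_cancel₀ hd
  have e1 : c ^ m = c ^ (m + 1) * ‖x - w‖ ^ 2 := by
    rw [pow_succ, mul_assoc, mul_comm c, hdc, mul_one]
  have e2 : ‖x - w‖ ^ 2 * c ^ (m + 2) = c ^ (m + 1) := by
    rw [pow_succ c (m+1), mul_comm (c ^ (m+1)), ← mul_assoc, hdc, one_mul]
  rw [mul_assoc (4 * (m:ℝ) * (m + 1) * (R ^ 2 - ‖x - a‖ ^ 2)), e2, e1, h3]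
  simp only [nsmul_eq_mul]
  push_cast
  ring

end kernelPart
end part3

section part4
open Real MeasureTheory Set Filter Topology
open scoped RealInnerProductSpace
set_option linter.unusedSectionVars false

section poissonPart
variable {E : Type*} [NormedAddCommGroup E] [InnerProductSpace ℝ E] [FiniteDimensional ℝ E]
  [MeasurableSpace E] [BorelSpace E]
variable {ι : Type*} [Fintype ι]

noncomputable def sphMap (a : E) (R : ℝ) (y : E) : E := a + (R / ‖y‖) • y

noncomputable def sphMeas (a : E) (R : ℝ) : Measure E :=
  Measure.map (sphMap a R) ((volume : Measure E).restrict (Metric.ball 0 1 \ {0}))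

lemma measurable_sphMap (a : E) (R : ℝ) : Measurable (sphMap a R) := by
  unfold sphMap
  fun_prop

instance sphMeas_finite (a : E) (R : ℝ) : IsFiniteMeasure (sphMeas a R) := by
  have : IsFiniteMeasure ((volume : Measure E).restrict (Metric.ball 0 1 \ {0})) := by
    refine ⟨?_⟩
    rw [Measure.restrict_apply_univ]
    exact (measure_mono Set.sdiff_subset).trans_lt measure_ball_lt_top
  unfold sphMeas
  infer_instance

lemma sphMeas_ae (a : E) {R : ℝ} (hR : 0 < R) : ∀ᵐ w ∂(sphMeas a R), w ∈ Metric.sphere a R := by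
  unfold sphMeas
  refine (ae_map_iff (p := fun w => w ∈ Metric.sphere a R) (measurable_sphMap a R).aemeasurable
    (Metric.isClosed_sphere.measurableSet)).2 ?_
  have hm : MeasurableSet (Metric.ball (0:E) 1 \ {0}) :=
    measurableSet_ball.diff (measurableSet_singleton 0)
  rw [ae_restrict_iff' hm]
  refine Eventually.of_forall fun y hy => ?_
  have hy0 : ‖y‖ ≠ 0 := norm_ne_zero_iff.2 hy.2
  simp only [sphMap, Metric.mem_sphere, dist_eq_norm, add_sub_cancel_left, norm_smul, norm_div,
    abs_norm, Real.norm_eq_abs, abs_of_pos hR]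
  field_simp

lemma sphMeas_pos [Nontrivial E] (a : E) (R : ℝ) : 0 < (sphMeas a R).real univ := by
  rw [Measure.real, ENNReal.toReal_pos_iff]
  refine ⟨?_, measure_lt_top _ _⟩
  unfold sphMeas
  rw [Measure.map_apply (measurable_sphMap a R) MeasurableSet.univ, preimage_univ,
    Measure.restrict_apply_univ]
  refine IsOpen.measure_pos _ (Metric.isOpen_ball.sdiff isClosed_singleton) ?_
  obtain ⟨v, hv⟩ := exists_ne (0 : E)
  have hv' : 0 < ‖v‖ := norm_pos_iff.2 hv
  refine ⟨(1 / (2 * ‖v‖)) • v, ?_, ?_⟩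
  · rw [mem_ball_zero_iff, norm_smul, norm_div, norm_one, norm_mul, norm_norm, Real.norm_ofNat]
    field_simp
    norm_num
  · simp only [mem_singleton_iff, smul_eq_zero, not_or]
    exact ⟨by positivity, hv⟩

lemma sphMeas_invariant (a : E) (R : ℝ) (L : E ≃ₗᵢ[ℝ] E) :
    Measure.map (fun w => a + L (w - a)) (sphMeas a R) = sphMeas a R := by
  have hL : Measurable (fun w => a + L (w - a)) := by
    have : Continuous (fun w => a + L (w - a)) := by fun_prop
    exact this.measurable
  have hLm : Measurable L := L.continuous.measurable
  unfold sphMeas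
  rw [Measure.map_map hL (measurable_sphMap a R)]
  have h1 : (fun w => a + L (w - a)) ∘ sphMap a R = sphMap a R ∘ L := by
    ext y
    simp [sphMap]
  have hm : MeasurableSet (Metric.ball (0:E) 1 \ {0}) :=
    measurableSet_ball.diff (measurableSet_singleton 0)
  have h2 := (L.measurePreserving.restrict_preimage hm).map_eq
  have h3 : L ⁻¹' (Metric.ball (0:E) 1 \ {0}) = Metric.ball (0:E) 1 \ {0} := by
    ext y; simp
  rw [h3] at h2
  rw [h1, ← Measure.map_map (measurable_sphMap a R) hLm, h2]

variable {b : OrthonormalBasis ι ℝ E} {m : ℕ}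

lemma ne_of_ball_sphere {a x w : E} {R : ℝ} (hx : x ∈ Metric.ball a R) (hw : w ∈ Metric.sphere a R) :
    x ≠ w := by
  rintro rfl
  simp only [Metric.mem_ball, Metric.mem_sphere] at *
  linarith

lemma pk_contOn (a : E) (R : ℝ) (m : ℕ) {x : E} (hx : x ∈ Metric.ball a R) :
    ContinuousOn (pk a R m x) (Metric.sphere a R) := fun w hw =>
  ((pk_contDiffAt a R m (ne_of_ball_sphere hx hw) (n := 0)).continuousAt.comp
    (f := fun w => (x, w)) (by fun_prop)).continuousWithinAt

lemma pk_nonneg (a : E) (R : ℝ) (m : ℕ) {x w : E} (hx : x ∈ Metric.ball a R) :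
    0 ≤ pk a R m x w := by
  rw [Metric.mem_ball, dist_eq_norm] at hx
  have : 0 ≤ R ^ 2 - ‖x - a‖ ^ 2 := by nlinarith [norm_nonneg (x - a)]
  unfold pk; positivity

lemma poisson_harm (hm : Fintype.card ι = 2 * m) (a : E) {R : ℝ} (hR : 0 < R) {g : E → ℝ}
    (hg : ContinuousOn g (Metric.sphere a R)) :
    HarmB b (fun x => ∫ w, g w • pk a R m x w ∂(sphMeas a R)) (Metric.ball a R) := by
  obtain ⟨h1, h2⟩ := param_C2 (isCompact_sphere a R) Metric.isOpen_ball (sphMeas_ae a hR)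
    (k := pk a R m) (fun x hx w hw => pk_contDiffAt a R m (ne_of_ball_sphere hx hw)) hg
  refine ⟨h1, fun x hx => ?_⟩
  unfold lapB
  simp only [fun e => (h2 x hx e).2]
  rw [← integral_finsetSum _ fun i _ => (h2 x hx (b i)).1]
  rw [← integral_zero E ℝ (μ := sphMeas a R)]
  apply integral_congr_ae
  filter_upwards [sphMeas_ae a hR] with w hw
  rw [← Finset.mul_sum, pk_lap b a R m hm (ne_of_ball_sphere hx hw) (by simpa [dist_eq_norm] using hw),
    mul_zero]

lemma poisson_const [Nonempty ι] (b : OrthonormalBasis ι ℝ E) (hm : Fintype.card ι = 2 * m) (a : E) {R : ℝ}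
    (hR : 0 < R) {x : E} (hx : x ∈ Metric.ball a R) :
    ∫ w, pk a R m x w ∂(sphMeas a R) = ∫ w, pk a R m a w ∂(sphMeas a R) := by
  have hJ := poisson_harm (b := b) hm a hR (g := fun _ => 1) continuousOn_const
  simp only [one_smul] at hJ
  have hs : Metric.closedBall a ‖x - a‖ ⊆ Metric.ball a R :=
    Metric.closedBall_subset_ball (by simpa [dist_eq_norm] using hx)
  have hJs : HarmB b _ (Metric.ball a ‖x - a‖) := hJ.mono (Metric.ball_subset_closedBall.trans hs)
  have hJc := hJ.1.continuousOn.mono hs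
  have hrot : ∀ y ∈ Metric.sphere a ‖x - a‖,
      ∫ w, pk a R m y w ∂(sphMeas a R) = ∫ w, pk a R m x w ∂(sphMeas a R) := by
    intro y hy
    have hy' : ‖x - a‖ = ‖y - a‖ := by simpa [dist_eq_norm, eq_comm] using hy
    obtain ⟨L, hL⟩ : ∃ L : E ≃ₗᵢ[ℝ] E, L (x - a) = y - a := ⟨_, Submodule.reflection_sub hy'⟩
    have hLm : Continuous (fun w => a + L (w - a)) := by fun_prop
    have hyb : y ∈ Metric.ball a R := hs (Metric.sphere_subset_closedBall hy)
    conv_lhs => rw [← sphMeas_invariant a R L]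
    rw [integral_map hLm.measurable.aemeasurable]
    · congr 1
      ext w
      have : y - (a + L (w - a)) = L (x - w) := by
        have h2 : L (x - w) = (y - a) - L (w - a) := by
          rw [← hL, ← map_sub]; congr 1; abel
        rw [h2]; abel
      unfold pk
      rw [this, L.norm_map, hy']
    · rw [sphMeas_invariant]
      exact (integrable_of_contOn (isCompact_sphere a R) (sphMeas_ae a hR)
        (pk_contOn a R m hyb)).aestronglyMeasurable
  have hcc : HarmB b (fun _ => ∫ w, pk a R m x w ∂(sphMeas a R)) (Metric.ball a ‖x - a‖) :=
    ⟨contDiffOn_const, fun z _ => lapB_const b _ z⟩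
  have ha : a ∈ Metric.closedBall a ‖x - a‖ := Metric.mem_closedBall_self (norm_nonneg _)
  apply le_antisymm
  · exact comparison continuousOn_const (hcc.visSub Metric.isOpen_ball) hJc hJs
      (fun y hy => (hrot y hy).ge) a ha
  · exact comparison hJc (hJs.visSub Metric.isOpen_ball) continuousOn_const hcc
      (fun y hy => (hrot y hy).le) a ha

lemma pk_center (a : E) {R : ℝ} (m : ℕ) {w : E} (hw : w ∈ Metric.sphere a R) :
    pk a R m a w = R ^ 2 * ((R ^ 2)⁻¹) ^ m := by
  have : ‖a - w‖ = R := by rw [← dist_eq_norm, dist_comm]; exact hw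
  simp [pk, this]

lemma poisson_mass [Nontrivial E] (a : E) {R : ℝ} (hR : 0 < R) (m : ℕ) :
    0 < ∫ w, pk a R m a w ∂(sphMeas a R) := by
  have : ∫ w, pk a R m a w ∂(sphMeas a R) = ∫ w, R ^ 2 * ((R ^ 2)⁻¹) ^ m ∂(sphMeas a R) := by
    apply integral_congr_ae
    filter_upwards [sphMeas_ae a hR] with w hw using pk_center a m hw
  rw [this, integral_const, smul_eq_mul]
  have := sphMeas_pos a R
  positivity

lemma poisson_boundary [Nonempty ι] [Nontrivial E] (b : OrthonormalBasis ι ℝ E)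
    (hm : Fintype.card ι = 2 * m) (a : E) {R : ℝ} (hR : 0 < R) {g : E → ℝ}
    (hg : ContinuousOn g (Metric.sphere a R)) {z : E} (hz : z ∈ Metric.sphere a R) {ε : ℝ}
    (hε : 0 < ε) : ∃ δ > 0, ∀ x ∈ Metric.ball a R, dist x z < δ →
      |(∫ w, g w • pk a R m x w ∂(sphMeas a R)) / (∫ w, pk a R m a w ∂(sphMeas a R)) - g z| < ε := by
  set J := ∫ w, pk a R m a w ∂(sphMeas a R) with hJ
  have hJpos : 0 < J := poisson_mass a hR m
  obtain ⟨M, hM⟩ := (isCompact_sphere a R).exists_bound_of_continuousOn hg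
  have hM0 : 0 ≤ M := (norm_nonneg _).trans (hM z hz)
  obtain ⟨η, hη, hgη⟩ := Metric.continuousOn_iff.1 hg z hz (ε / 2) (by linarith)
  set c := (((η / 2) ^ 2)⁻¹) ^ m with hc
  have hcpos : 0 < c := by positivity
  set N := (sphMeas a R).real univ with hN
  -- auxiliary limit
  have hlim : Tendsto (fun x : E => ε / 2 * J + 2 * M * ((R ^ 2 - ‖x - a‖ ^ 2) * c) * N) (𝓝 z) (𝓝 (ε / 2 * J)) := by
    have hcont : Continuous (fun x : E => ε / 2 * J + 2 * M * ((R ^ 2 - ‖x - a‖ ^ 2) * c) * N) := by fun_prop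
    have hz' : ‖z - a‖ = R := by simpa [dist_eq_norm] using hz
    have := hcont.tendsto z
    simpa [hz'] using this
  have hev := hlim.eventually (gt_mem_nhds (show ε / 2 * J < ε * J by nlinarith))
  obtain ⟨δ, hδ, hδb⟩ := Metric.eventually_nhds_iff.1 hev
  refine ⟨min δ (η / 2), lt_min hδ (by linarith), fun x hx hxz => ?_⟩
  have hx1 := hδb (hxz.trans_le (min_le_left _ _))
  have hx2 := hxz.trans_le (min_le_right _ _)
  have hA : 0 ≤ R ^ 2 - ‖x - a‖ ^ 2 := by
    rw [Metric.mem_ball, dist_eq_norm] at hx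
    nlinarith [norm_nonneg (x - a)]
  have hkc := pk_contOn a R m hx
  have hki : Integrable (pk a R m x) (sphMeas a R) :=
    integrable_of_contOn (isCompact_sphere a R) (sphMeas_ae a hR) hkc
  have hgi : Integrable (fun w => g w • pk a R m x w) (sphMeas a R) :=
    integrable_of_contOn (isCompact_sphere a R) (sphMeas_ae a hR) (hg.smul hkc)
  have hJx : ∫ w, pk a R m x w ∂(sphMeas a R) = J := poisson_const b hm a hR hx
  have hdiff : (∫ w, g w • pk a R m x w ∂(sphMeas a R)) - g z * J
      = ∫ w, (g w • pk a R m x w - g z * pk a R m x w) ∂(sphMeas a R) := by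
    rw [integral_sub hgi (hki.const_mul _), integral_const_mul, hJx]
  have hbound : |(∫ w, g w • pk a R m x w ∂(sphMeas a R)) - g z * J|
      ≤ ∫ w, (ε / 2 * pk a R m x w + 2 * M * ((R ^ 2 - ‖x - a‖ ^ 2) * c)) ∂(sphMeas a R) := by
    rw [hdiff, ← Real.norm_eq_abs]
    apply norm_integral_le_of_norm_le ((hki.const_mul _).add (integrable_const _))
    filter_upwards [sphMeas_ae a hR] with w hw
    have hk0 : 0 ≤ pk a R m x w := pk_nonneg a R m hx
    rw [smul_eq_mul, ← sub_mul, norm_mul, Real.norm_eq_abs, Real.norm_eq_abs, abs_of_nonneg hk0]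
    by_cases hwz : dist w z < η
    · have := hgη w hw hwz
      rw [Real.dist_eq] at this
      have h1 : |g w - g z| * pk a R m x w ≤ ε / 2 * pk a R m x w :=
        mul_le_mul_of_nonneg_right this.le hk0
      have h2 : 0 ≤ 2 * M * ((R ^ 2 - ‖x - a‖ ^ 2) * c) := by positivity
      show _ ≤ ε / 2 * pk a R m x w + 2 * M * ((R ^ 2 - ‖x - a‖ ^ 2) * c)
      linarith
    · have h1 : |g w - g z| ≤ 2 * M := by
        have h1 := hM w hw
        have h2 := hM z hz
        rw [Real.norm_eq_abs] at h1 h2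
        linarith [abs_sub (g w) (g z)]
      have h3 : η / 2 ≤ ‖x - w‖ := by
        have := dist_triangle w x z
        rw [← dist_eq_norm, dist_comm]; linarith
      have h2 : pk a R m x w ≤ (R ^ 2 - ‖x - a‖ ^ 2) * c := by
        unfold pk
        rw [hc]
        gcongr
      have h4 : |g w - g z| * pk a R m x w ≤ 2 * M * ((R ^ 2 - ‖x - a‖ ^ 2) * c) :=
        mul_le_mul h1 h2 hk0 (by positivity)
      have h5 : 0 ≤ ε / 2 * pk a R m x w := by positivity
      show _ ≤ ε / 2 * pk a R m x w + 2 * M * ((R ^ 2 - ‖x - a‖ ^ 2) * c)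
      linarith
  rw [integral_add (hki.const_mul _) (integrable_const _), integral_const_mul, hJx, integral_const,
    smul_eq_mul] at hbound
  have hfin : |(∫ w, g w • pk a R m x w ∂(sphMeas a R)) - g z * J| < ε * J := by
    refine hbound.trans_lt ?_
    rw [← hN]
    linarith
  rw [show (∫ w, g w • pk a R m x w ∂(sphMeas a R)) / J - g z
    = ((∫ w, g w • pk a R m x w ∂(sphMeas a R)) - g z * J) / J by field_simp, abs_div,
    abs_of_pos hJpos, div_lt_iff₀ hJpos]
  exact hfin

open Classical in
theorem dirichlet [Nonempty ι] [Nontrivial E] (b : OrthonormalBasis ι ℝ E)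
    (hm : Fintype.card ι = 2 * m) : DirichletProp b ((4:ℝ) ^ m) := by
  intro a R hR g hg
  set J := ∫ w, pk a R m a w ∂(sphMeas a R) with hJ
  have hJpos : 0 < J := poisson_mass a hR m
  set H0 : E → ℝ := fun x => (∫ w, g w • pk a R m x w ∂(sphMeas a R)) / J with hH0
  have hH0h : HarmB b H0 (Metric.ball a R) := by
    refine ((poisson_harm hm a hR hg).const_mul Metric.isOpen_ball J⁻¹).congr Metric.isOpen_ball ?_
    intro z _
    rw [hH0]; simp only; rw [div_eq_inv_mul]
  have hH : ∀ x ∈ Metric.ball a R, (Metric.ball a R).piecewise H0 g x = H0 x := fun x hx =>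
    piecewise_eq_of_mem _ _ _ hx
  have hHs : ∀ x ∈ Metric.sphere a R, (Metric.ball a R).piecewise H0 g x = g x := fun x hx =>
    piecewise_eq_of_notMem _ _ _ (fun h => ne_of_ball_sphere h hx rfl)
  refine ⟨(Metric.ball a R).piecewise H0 g, ?_, hHs, hH0h.congr Metric.isOpen_ball hH, ?_⟩
  · intro z hz
    by_cases hzb : z ∈ Metric.ball a R
    · have : ContinuousAt H0 z := (hH0h.contDiffAt Metric.isOpen_ball hzb).continuousAt
      refine (this.congr ?_).continuousWithinAt
      filter_upwards [Metric.isOpen_ball.mem_nhds hzb] with x hx using (hH x hx).symm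
    · have hzs : z ∈ Metric.sphere a R := by
        simp only [Metric.mem_ball, Metric.mem_closedBall, Metric.mem_sphere] at *
        linarith
      rw [Metric.continuousWithinAt_iff]
      intro ε hε
      obtain ⟨δ1, hδ1, h1⟩ := poisson_boundary b hm a hR hg hzs hε
      obtain ⟨δ2, hδ2, h2⟩ := Metric.continuousOn_iff.1 hg z hzs ε hε
      refine ⟨min δ1 δ2, lt_min hδ1 hδ2, fun x hx hxz => ?_⟩
      rw [hHs z hzs]
      by_cases hxb : x ∈ Metric.ball a R
      · rw [hH x hxb, Real.dist_eq]
        exact h1 x hxb (hxz.trans_le (min_le_left _ _))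
      · have hxs : x ∈ Metric.sphere a R := by
          simp only [Metric.mem_ball, Metric.mem_closedBall, Metric.mem_sphere] at *
          linarith
        rw [hHs x hxs]
        exact h2 x hxs (hxz.trans_le (min_le_right _ _))
  · intro hg0 x hx
    have hxb : x ∈ Metric.ball a R := Metric.ball_subset_ball (by linarith) hx
    have hab : a ∈ Metric.ball a R := Metric.mem_ball_self hR
    rw [hH x hxb, hH a hab, hH0]
    simp only
    rw [mul_div_assoc']
    gcongr
    rw [← integral_const_mul]
    apply integral_mono_ae
    · exact integrable_of_contOn (isCompact_sphere a R) (sphMeas_ae a hR) (hg.smul (pk_contOn a R m hxb))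
    · exact (integrable_of_contOn (isCompact_sphere a R) (sphMeas_ae a hR) (hg.smul (pk_contOn a R m hab))).const_mul _
    filter_upwards [sphMeas_ae a hR] with w hw
    have h1 : pk a R m x w ≤ 4 ^ m * pk a R m a w := by
      rw [pk_center a m hw]
      have h3 : R / 2 ≤ ‖x - w‖ := by
        have := dist_triangle w x a
        rw [Metric.mem_sphere] at hw
        rw [Metric.mem_ball] at hx
        rw [← dist_eq_norm, dist_comm]; linarith
      calc pk a R m x w ≤ R ^ 2 * (((R / 2) ^ 2)⁻¹) ^ m := by
            unfold pk
            gcongr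
            nlinarith [sq_nonneg ‖x - a‖]
        _ = 4 ^ m * (R ^ 2 * ((R ^ 2)⁻¹) ^ m) := by
            rw [show ((R / 2) ^ 2)⁻¹ = 4 * (R ^ 2)⁻¹ by field_simp; norm_num, mul_pow]; ring
    simp only [smul_eq_mul]
    have := mul_le_mul_of_nonneg_left h1 (hg0 w hw)
    linarith

end poissonPart
end part4

section part5
open Real MeasureTheory Set Filter Topology

section holPart
variable {E : Type*} [NormedAddCommGroup E] [NormedSpace ℂ E] [FiniteDimensional ℂ E]
variable {G : Type*} [NormedAddCommGroup G] [NormedSpace ℂ G] [FiniteDimensional ℂ G]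

lemma differentiableAt_clm_of_apply {φ : E → E →L[ℂ] G} {x : E}
    (h : ∀ e, DifferentiableAt ℂ (fun z => φ z e) x) : DifferentiableAt ℂ φ x := by
  let d := Module.finrank ℂ E
  have hd : d = Module.finrank ℂ (Fin d → ℂ) := (Module.finrank_fin_fun ℂ).symm
  let e₁ := ContinuousLinearEquiv.ofFinrankEq hd
  let e₂ := (e₁.arrowCongr (1 : G ≃L[ℂ] G)).trans (ContinuousLinearEquiv.piRing (Fin d))
  rw [← Function.id_comp φ, ← e₂.symm_comp_self]
  exact e₂.symm.differentiableAt.comp x (differentiableAt_pi.mpr fun i => h _)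

lemma slice_hasDerivAt {f : E → G} {z e : E} {ζ : ℂ} (h : DifferentiableAt ℂ f (z + ζ • e)) :
    HasDerivAt (fun ζ : ℂ => f (z + ζ • e)) (fderiv ℂ f (z + ζ • e) e) ζ := by
  have h1 : HasDerivAt (fun ζ : ℂ => z + ζ • e) e ζ := by
    simpa using ((hasDerivAt_id ζ).smul_const e).const_add z
  exact h.hasFDerivAt.comp_hasDerivAt ζ h1

lemma slice_diffContOnCl {f : E → G} {z e : E} {ρ : ℝ}
    (h : ∀ ζ : ℂ, ‖ζ‖ ≤ ρ → DifferentiableAt ℂ f (z + ζ • e)) :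
    DiffContOnCl ℂ (fun ζ : ℂ => f (z + ζ • e)) (Metric.ball 0 ρ) := by
  refine DifferentiableOn.diffContOnCl fun ζ hζ => ?_
  have : ζ ∈ Metric.closedBall (0:ℂ) ρ := Metric.closure_ball_subset_closedBall hζ
  exact (slice_hasDerivAt (h ζ (by simpa using this))).differentiableAt.differentiableWithinAt

lemma fderiv_bound {f : E → G} {w : E} {r M : ℝ} (hr : 0 < r) (hM : 0 ≤ M)
    (hd : ∀ y ∈ Metric.closedBall w r, DifferentiableAt ℂ f y)
    (hb : ∀ y ∈ Metric.closedBall w r, ‖f y‖ ≤ M) : ‖fderiv ℂ f w‖ ≤ M / r := by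
  refine ContinuousLinearMap.opNorm_le_bound _ (by positivity) fun e => ?_
  rcases eq_or_ne e 0 with rfl | he
  · simp
  have he' : 0 < ‖e‖ := norm_pos_iff.2 he
  have hmem : ∀ ζ : ℂ, ‖ζ‖ ≤ r / ‖e‖ → w + ζ • e ∈ Metric.closedBall w r := fun ζ hζ => by
    rw [Metric.mem_closedBall, dist_eq_norm, add_sub_cancel_left, norm_smul]
    exact (le_div_iff₀ he').1 hζ
  have h0 := slice_hasDerivAt (f := f) (z := w) (e := e) (ζ := 0)
    (hd _ (hmem 0 (by simp; positivity)))
  have := Complex.norm_deriv_le_of_forall_mem_sphere_norm_le (c := 0) (R := r / ‖e‖) (C := M)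
    (f := fun ζ : ℂ => f (w + ζ • e)) (by positivity)
    (slice_diffContOnCl fun ζ hζ => hd _ (hmem ζ hζ))
    (fun ζ hζ => hb _ (hmem ζ (by simpa using (mem_sphere_zero_iff_norm.1 hζ).le)))
  rw [h0.deriv] at this
  simp only [zero_smul, add_zero] at this
  refine this.trans (le_of_eq ?_)
  field_simp

lemma hol_fderiv_apply {f : E → G} {Ω : Set E} (hΩ : IsOpen Ω) (hf : DifferentiableOn ℂ f Ω)
    {z₀ : E} (hz : z₀ ∈ Ω) (e : E) : DifferentiableAt ℂ (fun z => fderiv ℂ f z e) z₀ := by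
  haveI : CompleteSpace G := FiniteDimensional.complete ℂ G
  haveI : ProperSpace (E →L[ℂ] G) := FiniteDimensional.proper ℂ _
  have hdiff : ∀ y ∈ Ω, DifferentiableAt ℂ f y := fun y hy => hf.differentiableAt (hΩ.mem_nhds hy)
  -- local radius and bound
  obtain ⟨R, hR, M, hM, hball, hbd⟩ : ∃ R > 0, ∃ M ≥ (0:ℝ), Metric.ball z₀ R ⊆ Ω ∧
      ∀ y ∈ Metric.ball z₀ R, ‖f y‖ ≤ M := by
    have h1 : ∀ᶠ y in 𝓝 z₀, ‖f y‖ < ‖f z₀‖ + 1 :=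
      (hdiff z₀ hz).continuousAt.norm.eventually_lt_const (by linarith)
    obtain ⟨R, hR, h⟩ := Metric.eventually_nhds_iff_ball.1 (h1.and (hΩ.mem_nhds hz))
    exact ⟨R, hR, ‖f z₀‖ + 1, by positivity, fun y hy => (h y hy).2, fun y hy => (h y hy).1.le⟩
  set r := R / 4 with hr
  have hr0 : 0 < r := by positivity
  set ρ := r / (‖e‖ + 1) with hρ
  have hρ0 : 0 < ρ := by positivity
  have hρe : ρ * ‖e‖ ≤ r := by
    rw [hρ, div_mul_eq_mul_div, div_le_iff₀ (by positivity)]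
    nlinarith [norm_nonneg e]
  have hmem : ∀ z ∈ Metric.ball z₀ r, ∀ ζ : ℂ, ‖ζ‖ ≤ ρ → dist (z + ζ • e) z₀ < 2 * r := by
    intro z hz ζ hζ
    have h1 : ‖ζ • e‖ ≤ r := by
      rw [norm_smul]
      exact (mul_le_mul_of_nonneg_right hζ (norm_nonneg _)).trans hρe
    have h2 : ‖z - z₀‖ < r := by simpa [dist_eq_norm] using hz
    rw [dist_eq_norm, show z + ζ • e - z₀ = (z - z₀) + ζ • e by abel]
    linarith [norm_add_le (z - z₀) (ζ • e)]
  have hmemΩ : ∀ z ∈ Metric.ball z₀ r, ∀ ζ : ℂ, ‖ζ‖ ≤ ρ → z + ζ • e ∈ Ω := fun z hz ζ hζ =>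
    hball (by rw [Metric.mem_ball]; linarith [hmem z hz ζ hζ])
  set k : ℝ → ℂ := fun θ => deriv (circleMap 0 ρ) θ * (1 / (circleMap 0 ρ θ - 0) ^ (1 + 1)) with hk
  have hcm : ∀ θ, circleMap (0:ℂ) ρ θ ≠ 0 := fun θ => circleMap_ne_center hρ0.ne'
  have hcn : ∀ θ, ‖circleMap (0:ℂ) ρ θ‖ ≤ ρ := fun θ => by
    simp [abs_of_pos hρ0]
  have hkc : Continuous k := by
    simp only [hk, deriv_circleMap]
    refine Continuous.mul (by fun_prop) (Continuous.div continuous_const (by fun_prop) ?_)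
    intro θ
    simpa using hcm θ
  have hform : ∀ z ∈ Metric.ball z₀ r, fderiv ℂ f z e =
      (2 * π * Complex.I)⁻¹ • ∫ θ in (0:ℝ)..2 * π, k θ • f (z + circleMap 0 ρ θ • e) := by
    intro z hz
    have := (slice_diffContOnCl (f := f) (z := z) (e := e) (ρ := ρ)
      (fun ζ hζ => hdiff _ (hmemΩ z hz ζ hζ))).circleIntegral_one_div_sub_center_pow_smul hρ0 1
    have h0 := slice_hasDerivAt (f := f) (z := z) (e := e) (ζ := 0)
      (hdiff _ (hmemΩ z hz 0 (by simp [hρ0.le])))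
    rw [iteratedDeriv_one, h0.deriv, circleIntegral] at this
    simp only [smul_smul] at this
    have h2 : (∫ θ in (0:ℝ)..2 * π, k θ • f (z + circleMap 0 ρ θ • e)) =
      (2 * π * Complex.I) • fderiv ℂ f z e := by simpa [hk] using this
    rw [h2, inv_smul_smul₀ Complex.two_pi_I_ne_zero]
  have hev : (fun z => fderiv ℂ f z e) =ᶠ[𝓝 z₀] fun z =>
      (2 * π * Complex.I)⁻¹ • ∫ θ in (0:ℝ)..2 * π, k θ • f (z + circleMap 0 ρ θ • e) := by
    filter_upwards [Metric.ball_mem_nhds z₀ hr0] with z hz using hform z hz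
  refine DifferentiableAt.congr_of_eventuallyEq ?_ hev
  refine DifferentiableAt.const_smul ?_ _
  have hcont : ∀ z ∈ Metric.ball z₀ r, Continuous fun θ => k θ • f (z + circleMap 0 ρ θ • e) := by
    intro z hz
    refine hkc.smul (continuous_iff_continuousAt.2 fun θ => ?_)
    have h1 := (hdiff _ (hmemΩ z hz _ (hcn θ))).continuousAt
    have h2 : Continuous fun θ => z + circleMap (0:ℂ) ρ θ • e := by fun_prop
    exact ContinuousAt.comp (g := f) (f := fun θ => z + circleMap (0:ℂ) ρ θ • e) h1 h2.continuousAt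
  refine (intervalIntegral.hasFDerivAt_integral_of_dominated_of_fderiv_le (𝕜 := ℂ)
    (s := Metric.ball z₀ r)
    (F' := fun z θ => k θ • fderiv ℂ f (z + circleMap 0 ρ θ • e))
    (bound := fun θ => ‖k θ‖ * (M / r)) (Metric.ball_mem_nhds z₀ hr0) ?_ ?_ ?_ ?_ ?_ ?_).differentiableAt
  · filter_upwards [Metric.ball_mem_nhds z₀ hr0] with z hz
    exact (hcont z hz).aestronglyMeasurable
  · exact (hcont z₀ (Metric.mem_ball_self hr0)).intervalIntegrable _ _
  · refine hkc.aestronglyMeasurable.smul ?_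
    borelize E
    borelize (E →L[ℂ] G)
    have h2 : Continuous fun θ => z₀ + circleMap (0:ℂ) ρ θ • e := by fun_prop
    exact ((measurable_fderiv ℂ f).comp h2.measurable).stronglyMeasurable.aestronglyMeasurable
  · refine Eventually.of_forall fun θ _ z hz => ?_
    rw [norm_smul]
    refine mul_le_mul_of_nonneg_left (fderiv_bound hr0 hM ?_ ?_) (norm_nonneg _)
    all_goals
      intro y hy
      have h1 : y ∈ Metric.ball z₀ R := by
        have h2 := hmem z hz _ (hcn θ)
        rw [Metric.mem_closedBall] at hy
        rw [Metric.mem_ball]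
        linarith [dist_triangle y (z + circleMap 0 ρ θ • e) z₀]
    · exact hdiff _ (hball h1)
    · exact hbd _ h1
  · exact (hkc.norm.mul continuous_const).intervalIntegrable _ _
  · refine Eventually.of_forall fun θ _ z hz => ?_
    have h1 := (hdiff _ (hmemΩ z hz _ (hcn θ))).hasFDerivAt
    have h2 : HasFDerivAt (fun z : E => z + circleMap 0 ρ θ • e) (ContinuousLinearMap.id ℂ E) z :=
      (hasFDerivAt_id z).add_const _
    have h3 := (h1.comp z h2).const_smul (k θ)
    simpa using! h3

lemma hol_fderiv {f : E → G} {Ω : Set E} (hΩ : IsOpen Ω) (hf : DifferentiableOn ℂ f Ω) :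
    DifferentiableOn ℂ (fderiv ℂ f) Ω := fun _ hz =>
  (differentiableAt_clm_of_apply fun e => hol_fderiv_apply hΩ hf hz e).differentiableWithinAt

lemma hol_contDiffOn {f : E → G} {Ω : Set E} (hΩ : IsOpen Ω) (hf : DifferentiableOn ℂ f Ω) :
    ContDiffOn ℂ 2 f Ω := by
  rw [show (2 : WithTop ℕ∞) = 1 + 1 by norm_num, contDiffOn_succ_iff_fderiv_of_isOpen hΩ]
  refine ⟨hf, by simp, ?_⟩
  have h1 := hol_fderiv hΩ hf
  rw [show (1 : WithTop ℕ∞) = 0 + 1 by norm_num, contDiffOn_succ_iff_fderiv_of_isOpen hΩ]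
  refine ⟨h1, by simp, ?_⟩
  rw [contDiffOn_zero]
  exact (hol_fderiv hΩ h1).continuousOn

end holPart
end part5

section part6
open Real MeasureTheory Set Filter Topology
noncomputable section
/-- The standard real orthonormal basis of complex Euclidean space. -/
def bas (n : ℕ) : OrthonormalBasis ((_ : Fin n) × Fin 2) ℝ (EuclideanSpace ℂ (Fin n)) :=
  Pi.orthonormalBasis (fun _ => Complex.orthonormalBasisOneI)

lemma lapB_bas {n : ℕ} (U : EuclideanSpace ℂ (Fin n) → ℝ) (z : EuclideanSpace ℂ (Fin n)) :
    lapB (bas n) U z = ∑ j : Fin n,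
      (fderiv ℝ (fderiv ℝ U) z (EuclideanSpace.single j (1:ℂ)) (EuclideanSpace.single j (1:ℂ)) +
        fderiv ℝ (fderiv ℝ U) z (EuclideanSpace.single j Complex.I)
          (EuclideanSpace.single j Complex.I)) := by
  unfold lapB bas
  rw [Fintype.sum_sigma]
  refine Finset.sum_congr rfl fun j _ => ?_
  rw [Fin.sum_univ_two]
  simp [Pi.orthonormalBasis_apply]

lemma harm_iff {n : ℕ} (U : EuclideanSpace ℂ (Fin n) → ℝ) (Ω : Set (EuclideanSpace ℂ (Fin n))) :
    HarmB (bas n) U Ω ↔ HarmonicOnCn U Ω := by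
  unfold HarmB HarmonicOnCn
  simp only [lapB_bas]

lemma coe_smul_cn {n : ℕ} (t : ℝ) (e : EuclideanSpace ℂ (Fin n)) : (t : ℂ) • e = t • e := by
  ext i; simp

/-- Regularised power of the (weighted) squared modulus. -/
def bq (κ ε q : ℝ) (w : ℂ) : ℝ := (w.re ^ 2 + κ * w.im ^ 2 + ε) ^ q

/-- A one dimensional second derivative computation. -/
lemma bq_line {κ ε q : ℝ} {γ γ1 : ℝ → ℂ} {γ2 : ℂ}
    (h1 : ∀ᶠ t in 𝓝 (0:ℝ), HasDerivAt γ (γ1 t) t) (h2 : HasDerivAt γ1 γ2 0)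
    (hpos : 0 < (γ 0).re ^ 2 + κ * (γ 0).im ^ 2 + ε) :
    ∃ d : ℝ → ℝ, (∀ᶠ t in 𝓝 (0:ℝ), HasDerivAt (fun t => bq κ ε q (γ t)) (d t) t) ∧
      HasDerivAt d (
        q * ((γ 0).re ^ 2 + κ * (γ 0).im ^ 2 + ε) ^ (q - 1) *
          (2 * ((γ1 0).re ^ 2 + κ * (γ1 0).im ^ 2 + (γ 0).re * γ2.re + κ * ((γ 0).im * γ2.im))) +
        q * (q - 1) * ((γ 0).re ^ 2 + κ * (γ 0).im ^ 2 + ε) ^ (q - 2) *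
          (2 * ((γ 0).re * (γ1 0).re + κ * ((γ 0).im * (γ1 0).im))) ^ 2) 0 := by
  have hre : ∀ {g : ℝ → ℂ} {g' : ℂ} {t : ℝ}, HasDerivAt g g' t →
      HasDerivAt (fun t => (g t).re) g'.re t := fun {g g' t} h =>
    Complex.reCLM.hasFDerivAt.comp_hasDerivAt t h
  have him : ∀ {g : ℝ → ℂ} {g' : ℂ} {t : ℝ}, HasDerivAt g g' t →
      HasDerivAt (fun t => (g t).im) g'.im t := fun {g g' t} h =>
    Complex.imCLM.hasFDerivAt.comp_hasDerivAt t h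
  have hB : ∀ {t : ℝ} {g' : ℂ}, HasDerivAt γ g' t →
      HasDerivAt (fun t => (γ t).re ^ 2 + κ * (γ t).im ^ 2 + ε)
        (2 * ((γ t).re * g'.re + κ * ((γ t).im * g'.im))) t := by
    intro t g' h
    have := ((((hre h).pow 2).add (((him h).pow 2).const_mul κ)).add_const ε)
    refine this.congr_deriv ?_
    simp; ring
  have h0 := h1.self_of_nhds
  have hpos' : ∀ᶠ t in 𝓝 (0:ℝ), 0 < (γ t).re ^ 2 + κ * (γ t).im ^ 2 + ε :=
    (hB h0).continuousAt.eventually_const_lt hpos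
  refine ⟨fun t => (2 * ((γ t).re * (γ1 t).re + κ * ((γ t).im * (γ1 t).im))) * q *
    ((γ t).re ^ 2 + κ * (γ t).im ^ 2 + ε) ^ (q - 1), ?_, ?_⟩
  · filter_upwards [h1, hpos'] with t ht hp
    exact (hB ht).rpow_const (Or.inl hp.ne')
  · have e1 := ((((hre h0).mul (hre h2)).add (((him h0).mul (him h2)).const_mul κ)).const_mul 2).mul_const q
    have e2 := (hB h0).rpow_const (p := q - 1) (Or.inl hpos.ne')
    refine (e1.mul e2).congr_deriv ?_
    rw [show q - 1 - 1 = q - 2 by ring]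
    simp only [Pi.mul_apply, Pi.add_apply]
    ring

section holLap
variable {n : ℕ} {f : EuclideanSpace ℂ (Fin n) → ℂ} {Ω : Set (EuclideanSpace ℂ (Fin n))}

lemma hol_real (hΩ : IsOpen Ω) (hf : DifferentiableOn ℂ f Ω) {x : EuclideanSpace ℂ (Fin n)}
    (hx : x ∈ Ω) : ContDiffAt ℝ 2 f x :=
  (((hol_contDiffOn hΩ hf).contDiffAt (hΩ.mem_nhds hx))).restrict_scalars ℝ

lemma hol_line (hΩ : IsOpen Ω) (hf : DifferentiableOn ℂ f Ω) {x : EuclideanSpace ℂ (Fin n)}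
    (hx : x ∈ Ω) (e : EuclideanSpace ℂ (Fin n)) :
    (∀ᶠ t in 𝓝 (0:ℝ), HasDerivAt (fun t : ℝ => f (x + t • e)) (fderiv ℂ f (x + t • e) e) t) ∧
    HasDerivAt (fun t : ℝ => fderiv ℂ f (x + t • e) e) (fderiv ℂ (fderiv ℂ f) x e e) 0 := by
  constructor
  · have hc : Tendsto (fun t : ℝ => x + t • e) (𝓝 0) (𝓝 x) := by
      have : Continuous (fun t : ℝ => x + t • e) := by fun_prop
      simpa using this.tendsto 0
    filter_upwards [hc.eventually (hΩ.mem_nhds hx)] with t ht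
    have h1 : DifferentiableAt ℂ f (x + (t:ℂ) • e) := by
      rw [coe_smul_cn]; exact hf.differentiableAt (hΩ.mem_nhds ht)
    have := (slice_hasDerivAt h1).comp_ofReal
    simpa only [coe_smul_cn] using this
  · have h1 : DifferentiableAt ℂ (fderiv ℂ f) (x + ((0:ℝ):ℂ) • e) := by
      simpa using (hol_fderiv hΩ hf).differentiableAt (hΩ.mem_nhds hx)
    have h2 := ((slice_hasDerivAt h1).clm_apply (hasDerivAt_const ((0:ℝ):ℂ) e)).comp_ofReal
    simpa [coe_smul_cn] using h2

lemma bq_contDiffAt (hΩ : IsOpen Ω) (hf : DifferentiableOn ℂ f Ω) {x : EuclideanSpace ℂ (Fin n)}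
    (hx : x ∈ Ω) {κ ε q : ℝ} (hpos : 0 < (f x).re ^ 2 + κ * (f x).im ^ 2 + ε) :
    ContDiffAt ℝ 2 (fun z => bq κ ε q (f z)) x := by
  have hfr := hol_real hΩ hf hx
  have hre : ContDiffAt ℝ 2 (fun z => (f z).re) x := Complex.reCLM.contDiff.contDiffAt.comp x hfr
  have him : ContDiffAt ℝ 2 (fun z => (f z).im) x := Complex.imCLM.contDiff.contDiffAt.comp x hfr
  exact (((hre.pow 2).add (contDiffAt_const.mul (him.pow 2))).add contDiffAt_const).rpow_const_of_ne
    hpos.ne'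

/-- The Laplacian of the regularised power. -/
lemma bq_lap (hΩ : IsOpen Ω) (hf : DifferentiableOn ℂ f Ω) {x : EuclideanSpace ℂ (Fin n)}
    (hx : x ∈ Ω) {κ ε q : ℝ} (hpos : 0 < (f x).re ^ 2 + κ * (f x).im ^ 2 + ε) :
    lapB (bas n) (fun z => bq κ ε q (f z)) x =
      (q * ((f x).re ^ 2 + κ * (f x).im ^ 2 + ε) ^ (q - 1) * (2 * (1 + κ)) +
        4 * q * (q - 1) * ((f x).re ^ 2 + κ * (f x).im ^ 2 + ε) ^ (q - 2) *
          ((f x).re ^ 2 + κ ^ 2 * (f x).im ^ 2)) *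
      ∑ j : Fin n, Complex.normSq (fderiv ℂ f x (EuclideanSpace.single j (1:ℂ))) := by
  rw [lapB_bas, Finset.mul_sum]
  refine Finset.sum_congr rfl fun j _ => ?_
  have hC := bq_contDiffAt hΩ hf hx (q := q) hpos
  have key : ∀ e : EuclideanSpace ℂ (Fin n), fderiv ℝ (fderiv ℝ fun z => bq κ ε q (f z)) x e e =
      q * ((f x).re ^ 2 + κ * (f x).im ^ 2 + ε) ^ (q - 1) *
          (2 * ((fderiv ℂ f x e).re ^ 2 + κ * (fderiv ℂ f x e).im ^ 2 +
            (f x).re * (fderiv ℂ (fderiv ℂ f) x e e).re +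
            κ * ((f x).im * (fderiv ℂ (fderiv ℂ f) x e e).im))) +
        q * (q - 1) * ((f x).re ^ 2 + κ * (f x).im ^ 2 + ε) ^ (q - 2) *
          (2 * ((f x).re * (fderiv ℂ f x e).re + κ * ((f x).im * (fderiv ℂ f x e).im))) ^ 2 := by
    intro e
    obtain ⟨h1, h2⟩ := hol_line hΩ hf hx e
    obtain ⟨d, hd1, hd2⟩ := bq_line (κ := κ) (ε := ε) (q := q) h1 h2 (by simpa using hpos)
    have := fderiv2_of_line hC hd1 hd2
    simpa using this
  have hI : EuclideanSpace.single j Complex.I = Complex.I • EuclideanSpace.single j (1:ℂ) := by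
    ext i; simp
  rw [key, key, hI]
  simp only [map_smul, _root_.smul_apply, smul_eq_mul, Complex.mul_re, Complex.mul_im,
    Complex.I_re, Complex.I_im, Complex.normSq_apply]
  ring

end holLap
end
end part6

section part7
open Real MeasureTheory Set Filter Topology

section finalPart
variable {n : ℕ} {f : EuclideanSpace ℂ (Fin n) → ℂ} {Ω : Set (EuclideanSpace ℂ (Fin n))}

lemma sq_rpow_half {x : ℝ} (hx : 0 ≤ x) (p : ℝ) : (x ^ 2) ^ (p / 2) = x ^ p := by
  rw [← Real.rpow_natCast x 2, ← Real.rpow_mul hx]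
  congr 1; push_cast; ring

lemma coef_B {p B ε : ℝ} (hB : 0 < B) :
    p / 2 * B ^ (p / 2 - 1) * (2 * (1 + 1)) + 4 * (p / 2) * (p / 2 - 1) * B ^ (p / 2 - 2) * (B - ε)
      = p ^ 2 * B ^ (p / 2 - 1) + p * (2 - p) * ε * B ^ (p / 2 - 2) := by
  have h : B ^ (p / 2 - 1) = B ^ (p / 2 - 2) * B := by
    rw [← Real.rpow_add_one hB.ne']; congr 1; ring
  rw [h]; ring

lemma coef_A {p A ε : ℝ} (hA : 0 < A) :
    p / 2 * A ^ (p / 2 - 1) * (2 * (1 + 0)) + 4 * (p / 2) * (p / 2 - 1) * A ^ (p / 2 - 2) * (A - ε)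
      = p * (p - 1) * A ^ (p / 2 - 1) + p * (2 - p) * ε * A ^ (p / 2 - 2) := by
  have h : A ^ (p / 2 - 1) = A ^ (p / 2 - 2) * A := by
    rw [← Real.rpow_add_one hA.ne']; congr 1; ring
  rw [h]; ring

lemma coef_le {p A B ε : ℝ} (hp : 1 < p) (hp2 : p ≤ 2) (hA : 0 < A) (hAB : A ≤ B) (hε : 0 ≤ ε) :
    p ^ 2 * B ^ (p / 2 - 1) + p * (2 - p) * ε * B ^ (p / 2 - 2) ≤
    p / (p - 1) * (p * (p - 1) * A ^ (p / 2 - 1) + p * (2 - p) * ε * A ^ (p / 2 - 2)) := by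
  have h1 : B ^ (p / 2 - 1) ≤ A ^ (p / 2 - 1) :=
    Real.rpow_le_rpow_of_nonpos hA hAB (by linarith)
  have h2 : B ^ (p / 2 - 2) ≤ A ^ (p / 2 - 2) :=
    Real.rpow_le_rpow_of_nonpos hA hAB (by linarith)
  have hp1 : 0 < p - 1 := by linarith
  have hc : 1 ≤ p / (p - 1) := by rw [le_div_iff₀ hp1]; linarith
  have h3 : 0 ≤ p * (2 - p) * ε := by
    have : 0 ≤ 2 - p := by linarith
    positivity
  have hA2 : 0 ≤ A ^ (p / 2 - 2) := by positivity
  have e : p / (p - 1) * (p * (p - 1) * A ^ (p / 2 - 1) + p * (2 - p) * ε * A ^ (p / 2 - 2)) =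
    p ^ 2 * A ^ (p / 2 - 1) + p / (p - 1) * (p * (2 - p) * ε * A ^ (p / 2 - 2)) := by
    field_simp
  rw [e]
  have h4 : p * (2 - p) * ε * B ^ (p / 2 - 2) ≤ p * (2 - p) * ε * A ^ (p / 2 - 2) :=
    mul_le_mul_of_nonneg_left h2 h3
  have h5 : p * (2 - p) * ε * A ^ (p / 2 - 2) ≤
      p / (p - 1) * (p * (2 - p) * ε * A ^ (p / 2 - 2)) :=
    le_mul_of_one_le_left (by positivity) hc
  have h6 : p ^ 2 * B ^ (p / 2 - 1) ≤ p ^ 2 * A ^ (p / 2 - 1) :=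
    mul_le_mul_of_nonneg_left h1 (by positivity)
  linarith

lemma sumw_nonneg (x : EuclideanSpace ℂ (Fin n)) :
    0 ≤ ∑ j : Fin n, Complex.normSq (fderiv ℂ f x (EuclideanSpace.single j (1:ℂ))) :=
  Finset.sum_nonneg fun _ _ => Complex.normSq_nonneg _

lemma lap_B (hΩ : IsOpen Ω) (hf : DifferentiableOn ℂ f Ω) {x : EuclideanSpace ℂ (Fin n)}
    (hx : x ∈ Ω) {p ε : ℝ} (hpos : 0 < (f x).re ^ 2 + 1 * (f x).im ^ 2 + ε) :
    lapB (bas n) (fun z => bq 1 ε (p / 2) (f z)) x =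
      (p ^ 2 * ((f x).re ^ 2 + 1 * (f x).im ^ 2 + ε) ^ (p / 2 - 1) +
        p * (2 - p) * ε * ((f x).re ^ 2 + 1 * (f x).im ^ 2 + ε) ^ (p / 2 - 2)) *
      ∑ j : Fin n, Complex.normSq (fderiv ℂ f x (EuclideanSpace.single j (1:ℂ))) := by
  rw [bq_lap hΩ hf hx hpos, ← coef_B hpos]
  congr 3; ring

lemma lap_A (hΩ : IsOpen Ω) (hf : DifferentiableOn ℂ f Ω) {x : EuclideanSpace ℂ (Fin n)}
    (hx : x ∈ Ω) {p ε : ℝ} (hpos : 0 < (f x).re ^ 2 + 0 * (f x).im ^ 2 + ε) :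
    lapB (bas n) (fun z => bq 0 ε (p / 2) (f z)) x =
      (p * (p - 1) * ((f x).re ^ 2 + 0 * (f x).im ^ 2 + ε) ^ (p / 2 - 1) +
        p * (2 - p) * ε * ((f x).re ^ 2 + 0 * (f x).im ^ 2 + ε) ^ (p / 2 - 2)) *
      ∑ j : Fin n, Complex.normSq (fderiv ℂ f x (EuclideanSpace.single j (1:ℂ))) := by
  rw [bq_lap hΩ hf hx hpos, ← coef_A hpos]
  congr 3; ring

lemma posAB (κ : ℝ) (hκ : 0 ≤ κ) {ε : ℝ} (hε : 0 < ε) (w : ℂ) : 0 < w.re ^ 2 + κ * w.im ^ 2 + ε := by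
  positivity

lemma G_contDiffAt (hΩ : IsOpen Ω) (hf : DifferentiableOn ℂ f Ω) {p ε : ℝ} (hε : 0 < ε)
    {x : EuclideanSpace ℂ (Fin n)} (hx : x ∈ Ω) (c : ℝ) :
    ContDiffAt ℝ 2 (fun z => c * bq 0 ε (p / 2) (f z) - bq 1 ε (p / 2) (f z)) x :=
  (contDiffAt_const.mul (bq_contDiffAt hΩ hf hx (posAB 0 le_rfl hε _))).sub
    (bq_contDiffAt hΩ hf hx (posAB 1 zero_le_one hε _))

lemma G_visSub (hΩ : IsOpen Ω) (hf : DifferentiableOn ℂ f Ω) {p ε : ℝ} (hp : 1 < p) (hp2 : p ≤ 2)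
    (hε : 0 < ε) :
    VisSub (bas n) (fun z => p / (p - 1) * bq 0 ε (p / 2) (f z) - bq 1 ε (p / 2) (f z)) Ω := by
  refine visSub_of_C2 (fun x hx => G_contDiffAt hΩ hf hε hx _) fun x hx => ?_
  have hA := posAB 0 le_rfl hε (f x)
  have hB := posAB 1 zero_le_one hε (f x)
  have cA := bq_contDiffAt hΩ hf hx (q := p / 2) hA
  have cB := bq_contDiffAt hΩ hf hx (q := p / 2) hB
  rw [lapB_sub _ (contDiffAt_const.mul cA) cB, lapB_const_mul _ _ cA, lap_A hΩ hf hx hA,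
    lap_B hΩ hf hx hB, ← mul_assoc, ← sub_mul]
  refine mul_nonneg (sub_nonneg.2 (coef_le hp hp2 hA ?_ hε.le)) (sumw_nonneg x)
  nlinarith [sq_nonneg (f x).im]

lemma norm_rpow_eq (w : ℂ) (p : ℝ) : ‖w‖ ^ p = (w.re ^ 2 + 1 * w.im ^ 2) ^ (p / 2) := by
  rw [← sq_rpow_half (norm_nonneg w), Complex.sq_norm, Complex.normSq_apply]
  congr 1; ring

lemma re_rpow_eq (w : ℂ) (p : ℝ) : |w.re| ^ p = (w.re ^ 2 + 0 * w.im ^ 2) ^ (p / 2) := by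
  rw [← sq_rpow_half (abs_nonneg w.re), sq_abs]
  congr 1; ring

lemma s_visSub (hΩ : IsOpen Ω) (hf : DifferentiableOn ℂ f Ω) {p : ℝ} (hp : 1 < p) :
    VisSub (bas n) (fun z => ‖f z‖ ^ p) Ω := by
  intro x hx φ hφ hm
  by_cases h0 : f x = 0
  · have h1 : IsLocalMax (fun y => (-1) * φ y) x := by
      filter_upwards [hm] with y hy
      have h2 : 0 ≤ ‖f y‖ ^ p := by positivity
      have h3 : ‖f x‖ ^ p = 0 := by
        rw [h0, norm_zero, Real.zero_rpow (by linarith)]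
      rw [h3] at hy
      linarith
    have h2 := lapB_nonpos_of_isLocalMax (bas n) (contDiffAt_const.mul hφ) h1
    rw [lapB_const_mul _ _ hφ] at h2
    linarith
  · have hpos : 0 < (f x).re ^ 2 + 1 * (f x).im ^ 2 + 0 := by
      have := Complex.normSq_pos.2 h0
      rw [Complex.normSq_apply] at this
      nlinarith
    have heq : (fun z => ‖f z‖ ^ p) = fun z => bq 1 0 (p / 2) (f z) := by
      ext z; rw [norm_rpow_eq, bq, add_zero]
    have cB := bq_contDiffAt hΩ hf hx (q := p / 2) hpos
    have hm' : IsLocalMax (fun y => bq 1 0 (p / 2) (f y) - φ y) x := by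
      have h5 : (fun y => ‖f y‖ ^ p - φ y) = fun y => bq 1 0 (p / 2) (f y) - φ y := by
        ext z; rw [norm_rpow_eq, bq, add_zero]
      rw [← h5]; exact hm
    have h2 := lapB_nonpos_of_isLocalMax (bas n) (cB.sub hφ) hm'
    rw [lapB_sub _ cB hφ, lap_B hΩ hf hx hpos] at h2
    have h3 : 0 ≤ (p ^ 2 * ((f x).re ^ 2 + 1 * (f x).im ^ 2 + 0) ^ (p / 2 - 1) +
        p * (2 - p) * 0 * ((f x).re ^ 2 + 1 * (f x).im ^ 2 + 0) ^ (p / 2 - 2)) *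
      ∑ j : Fin n, Complex.normSq (fderiv ℂ f x (EuclideanSpace.single j (1:ℂ))) := by
      refine mul_nonneg ?_ (sumw_nonneg x)
      have : 0 ≤ ((f x).re ^ 2 + 1 * (f x).im ^ 2 + 0) ^ (p / 2 - 1) := by positivity
      nlinarith [sq_nonneg p]
    linarith

lemma S_super [Nonempty ((_ : Fin n) × Fin 2)] (hΩ : IsOpen Ω) (hf : DifferentiableOn ℂ f Ω)
    {p : ℝ} (hp : 1 < p) (hp2 : p ≤ 2)
    {U : EuclideanSpace ℂ (Fin n) → ℝ} (hU : HarmB (bas n) U Ω)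
    (a : EuclideanSpace ℂ (Fin n)) (R : ℝ) (hsub : Metric.closedBall a R ⊆ Ω)
    (H : EuclideanSpace ℂ (Fin n) → ℝ) (hHc : ContinuousOn H (Metric.closedBall a R))
    (hH : HarmB (bas n) H (Metric.ball a R))
    (hle : ∀ x ∈ Metric.sphere a R, H x ≤ p / (p - 1) * (U x - |(f x).re| ^ p) + ‖f x‖ ^ p) :
    ∀ x ∈ Metric.ball a R, H x ≤ p / (p - 1) * (U x - |(f x).re| ^ p) + ‖f x‖ ^ p := by
  intro x hx
  set c := p / (p - 1) with hc
  have hp1 : 0 < p - 1 := by linarith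
  have hc0 : 0 < c := by positivity
  have hq : 0 < p / 2 := by linarith
  refine le_of_forall_pos_le_add fun δ hδ => ?_
  set ε := (δ / (c + 1)) ^ (p / 2)⁻¹ with hε
  have hε0 : 0 < ε := by positivity
  have hεq : ε ^ (p / 2) = δ / (c + 1) := Real.rpow_inv_rpow (by positivity) hq.ne'
  have up : ∀ κ : ℝ, 0 ≤ κ → ∀ w : ℂ, bq κ ε (p / 2) w ≤ (w.re ^ 2 + κ * w.im ^ 2) ^ (p / 2) + ε ^ (p / 2) :=
    fun κ hκ w => Real.rpow_add_le_add_rpow (by positivity) hε0.le hq.le (by linarith)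
  have low : ∀ κ : ℝ, 0 ≤ κ → ∀ w : ℂ, (w.re ^ 2 + κ * w.im ^ 2) ^ (p / 2) ≤ bq κ ε (p / 2) w :=
    fun κ hκ w => Real.rpow_le_rpow (by positivity) (by linarith) hq.le
  have hb : Metric.ball a R ⊆ Ω := Metric.ball_subset_closedBall.trans hsub
  have hH' : HarmB (bas n) (fun y => (c * U y - H y) + c * ε ^ (p / 2)) (Metric.ball a R) :=
    (((hU.mono (b := bas n) hb).const_mul (b := bas n) Metric.isOpen_ball c).sub (b := bas n) Metric.isOpen_ball hH).add_const (b := bas n)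
      Metric.isOpen_ball _
  have key := comparison (b := bas n) (a := a) (R := R)
    (g := fun z => c * bq 0 ε (p / 2) (f z) - bq 1 ε (p / 2) (f z))
    (H := fun y => (c * U y - H y) + c * ε ^ (p / 2))
    (fun y hy => (G_contDiffAt hΩ hf hε0 (hsub hy) c).continuousAt.continuousWithinAt)
    (fun y hy => G_visSub hΩ hf hp hp2 hε0 y (hb hy))
    (((continuousOn_const.mul (hU.1.continuousOn.mono hsub)).sub hHc).add continuousOn_const)
    hH' ?_ x (Metric.ball_subset_closedBall hx)
  · have l0 := mul_le_mul_of_nonneg_left (low 0 le_rfl (f x)) hc0.le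
    have u1 := up 1 zero_le_one (f x)
    rw [← re_rpow_eq] at l0
    rw [← norm_rpow_eq] at u1
    have : δ = (c + 1) * ε ^ (p / 2) := by rw [hεq]; field_simp
    nlinarith
  · intro y hy
    have hy' := hle y hy
    have u0 := mul_le_mul_of_nonneg_left (up 0 le_rfl (f y)) hc0.le
    have l1 := low 1 zero_le_one (f y)
    rw [← re_rpow_eq] at u0
    rw [← norm_rpow_eq] at l1
    nlinarith

lemma main_step (hΩ : IsOpen Ω) {z₀ : EuclideanSpace ℂ (Fin n)} (hz₀ : z₀ ∈ Ω)
    {p : ℝ} (hp : 1 < p) (hp2 : p ≤ 2) (hf : DifferentiableOn ℂ f Ω) (hv : (f z₀).im = 0)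
    {U : EuclideanSpace ℂ (Fin n) → ℝ} (hU : HarmonicOnCn U Ω)
    (hUm : ∀ z ∈ Ω, |(f z).re| ^ p ≤ U z) :
    ∃ F, HarmonicOnCn F Ω ∧ (∀ z ∈ Ω, ‖f z‖ ^ p ≤ F z) ∧ F z₀ ≤ p / (p - 1) * U z₀ := by
  have hp1 : 0 < p - 1 := by linarith
  have hc1 : 1 ≤ p / (p - 1) := by rw [le_div_iff₀ hp1]; linarith
  have hre : ‖f z₀‖ = |(f z₀).re| := by
    have h : f z₀ = ((f z₀).re : ℂ) := by apply Complex.ext <;> simp [hv]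
    rw [h, Complex.norm_real]; simp
  have hr0 : 0 ≤ |(f z₀).re| ^ p := by positivity
  have hU0 := hUm z₀ hz₀
  have hnn : 0 ≤ (p / (p - 1) - 1) * |(f z₀).re| ^ p := mul_nonneg (by linarith) hr0
  rcases Nat.eq_zero_or_pos n with rfl | hn
  · refine ⟨fun z => ‖f z‖ ^ p, ⟨?_, fun z _ => by simp⟩, fun z _ => le_rfl, ?_⟩
    · have : (fun z => ‖f z‖ ^ p) = fun _ => ‖f z₀‖ ^ p := by
        ext z; rw [Subsingleton.elim z z₀]
      rw [this]; exact contDiffOn_const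
    · simp only [hre]
      nlinarith
  · haveI : Nonempty (Fin n) := ⟨⟨0, hn⟩⟩
    haveI : Nonempty ((_ : Fin n) × Fin 2) := ⟨⟨⟨0, hn⟩, 0⟩⟩
    haveI : Nontrivial (EuclideanSpace ℂ (Fin n)) := inferInstance
    have hD := dirichlet (m := n) (bas n) (by simp; ring)
    rw [← harm_iff] at hU
    obtain ⟨h, h1, h2, h3⟩ := perron (b := bas n) (by positivity) hD hΩ
      (s := fun z => ‖f z‖ ^ p) (S := fun z => p / (p - 1) * (U z - |(f z).re| ^ p) + ‖f z‖ ^ p)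
      (hf.continuousOn.norm.rpow_const fun _ _ => Or.inr (by linarith))
      (s_visSub hΩ hf hp)
      (fun z hz => by
        have := mul_nonneg (zero_le_one.trans hc1) (sub_nonneg.2 (hUm z hz))
        linarith)
      (fun a R _ hs H hHc hH hle => S_super hΩ hf hp hp2 hU a R hs H hHc hH hle)
    refine ⟨h, (harm_iff _ _).1 h1, h2, (h3 z₀ hz₀).trans ?_⟩
    simp only [hre]
    nlinarith

end finalPart
end part7

/-- **M. Riesz's theorem for domains in `ℂⁿ`, case `1 < p ≤ 2`, with the sharp-type constant
`p/(p−1)`**: if `f = u + iv` is holomorphic on a domain `Ω ⊆ ℂⁿ` with `v z₀ = 0` and `|u|^p`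
admits a harmonic majorant, then `|f|^p` admits a harmonic majorant and
`inf {F z₀} ≤ (p/(p−1)) · inf {U z₀}`, i.e. `‖f‖_{p,z₀} ≤ (p/(p−1))^{1/p} ‖u‖_{p,z₀}`. -/
theorem riesz_domains_Cn_small_p (n : ℕ) (Ω : Set (EuclideanSpace ℂ (Fin n)))
    (hΩ : IsOpen Ω) (hΩc : IsConnected Ω) (z₀ : EuclideanSpace ℂ (Fin n)) (hz₀ : z₀ ∈ Ω)
    (p : ℝ) (hp : 1 < p) (hp2 : p ≤ 2) (f : EuclideanSpace ℂ (Fin n) → ℂ)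
    (hf : DifferentiableOn ℂ f Ω) (hv : (f z₀).im = 0)
    (hmaj : ∃ U, HarmonicOnCn U Ω ∧ ∀ z ∈ Ω, |(f z).re| ^ p ≤ U z) :
    (∃ F, HarmonicOnCn F Ω ∧ ∀ z ∈ Ω, ‖f z‖ ^ p ≤ F z) ∧
    sInf {y | ∃ F, HarmonicOnCn F Ω ∧ (∀ z ∈ Ω, ‖f z‖ ^ p ≤ F z) ∧ F z₀ = y}
      ≤ (p / (p - 1)) *
        sInf {y | ∃ U, HarmonicOnCn U Ω ∧ (∀ z ∈ Ω, |(f z).re| ^ p ≤ U z) ∧ U z₀ = y} := by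
  have hp1 : 0 < p - 1 := by linarith
  have hc0 : 0 < p / (p - 1) := by positivity
  obtain ⟨U₀, hU₀, hU₀m⟩ := hmaj
  constructor
  · obtain ⟨F, h1, h2, _⟩ := main_step hΩ hz₀ hp hp2 hf hv hU₀ hU₀m
    exact ⟨F, h1, h2⟩
  · rw [mul_comm, ← div_le_iff₀ hc0]
    refine le_csInf ⟨U₀ z₀, U₀, hU₀, hU₀m, rfl⟩ ?_
    rintro y ⟨U, hU, hUm, rfl⟩
    rw [div_le_iff₀ hc0, mul_comm]
    obtain ⟨F, h1, h2, h3⟩ := main_step hΩ hz₀ hp hp2 hf hv hU hUm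
    have hbd : BddBelow {y | ∃ F, HarmonicOnCn F Ω ∧ (∀ z ∈ Ω, ‖f z‖ ^ p ≤ F z) ∧ F z₀ = y} := by
      refine ⟨‖f z₀‖ ^ p, ?_⟩
      rintro y ⟨F', _, h2', rfl⟩
      exact h2' z₀ hz₀
    exact (csInf_le hbd ⟨F, h1, h2, rfl⟩).trans h3
end

section
/- Let Ω be an open subset of ℂⁿ, let f be holomorphic on Ω with real part u = Re f, and let 1 < p ≤ 2 and τ > 0. Then the (smooth) function z ↦ (p/(p−1))·(u(z)² + τ)^{p/2} − (|f(z)|² + τ)^{p/2} is plurisubharmonic on Ω. -/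
open Real Set

/-- A `C²` real-valued function on an open set `Ω ⊆ ℂⁿ` is plurisubharmonic iff its complex
Hessian is positive semidefinite at each point; equivalently, for every `z ∈ Ω` and `w ∈ ℂⁿ`
the Laplacian at `0` of `ζ ↦ g (z + ζ • w)` is nonnegative, i.e.
`D²g(z)(w,w) + D²g(z)(i•w, i•w) ≥ 0`. -/
def PshOnCn {n : ℕ} (g : EuclideanSpace ℂ (Fin n) → ℝ)
    (Ω : Set (EuclideanSpace ℂ (Fin n))) : Prop :=
  ∀ z ∈ Ω, ∀ w : EuclideanSpace ℂ (Fin n),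
    0 ≤ fderiv ℝ (fderiv ℝ g) z w w +
        fderiv ℝ (fderiv ℝ g) z (Complex.I • w) (Complex.I • w)

lemma aux_pow (S S1 : ℝ → ℝ) (S2 q : ℝ)
    (h : ∀ᶠ t in nhds (0:ℝ), HasDerivAt S (S1 t) t) (h1 : HasDerivAt S1 S2 0)
    (hS : ∀ t, 0 < S t) :
    (∀ᶠ t in nhds (0:ℝ), HasDerivAt (fun t => S t ^ q) (S1 t * q * S t ^ (q-1)) t) ∧
    HasDerivAt (fun t => S1 t * q * S t ^ (q-1))
      (q * (S2 * S 0 ^ (q-1) + (q-1) * S1 0 ^ 2 * S 0 ^ (q-2))) 0 := by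
  constructor
  · filter_upwards [h] with t ht
    exact ht.rpow_const (Or.inl (hS t).ne')
  · have h0 := h.self_of_nhds
    have := (h1.mul_const q).mul (h0.rpow_const (p := q-1) (Or.inl (hS 0).ne'))
    refine HasDerivAt.congr_deriv this ?_
    rw [show q - 1 - 1 = q - 2 by ring]
    ring

lemma aux_dir (U V U1 V1 : ℝ → ℝ) (U2 V2 q K τ : ℝ) (hτ : 0 < τ)
    (hU : ∀ᶠ t in nhds (0:ℝ), HasDerivAt U (U1 t) t) (hU1 : HasDerivAt U1 U2 0)
    (hV : ∀ᶠ t in nhds (0:ℝ), HasDerivAt V (V1 t) t) (hV1 : HasDerivAt V1 V2 0) :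
    ∃ D : ℝ → ℝ, (∀ᶠ t in nhds (0:ℝ), HasDerivAt
      (fun t => K * (U t ^ 2 + τ) ^ q - (U t ^ 2 + V t ^ 2 + τ) ^ q) (D t) t) ∧
    HasDerivAt D (K * (q * ((2 * U1 0 ^ 2 + 2 * U 0 * U2) * (U 0 ^ 2 + τ) ^ (q-1)
        + (q-1) * (2 * U 0 * U1 0) ^ 2 * (U 0 ^ 2 + τ) ^ (q-2)))
      - (q * ((2 * U1 0 ^ 2 + 2 * U 0 * U2 + (2 * V1 0 ^ 2 + 2 * V 0 * V2))
          * (U 0 ^ 2 + V 0 ^ 2 + τ) ^ (q-1)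
        + (q-1) * (2 * U 0 * U1 0 + 2 * V 0 * V1 0) ^ 2
          * (U 0 ^ 2 + V 0 ^ 2 + τ) ^ (q-2)))) 0 := by
  have sq : ∀ (A A1 : ℝ → ℝ) (t : ℝ), HasDerivAt A (A1 t) t →
      HasDerivAt (fun t => A t ^ 2) (2 * A t * A1 t) t := by
    intro A A1 t h
    have := h.pow 2
    refine HasDerivAt.congr_deriv this ?_
    simp
  have sq1 : ∀ (A A1 : ℝ → ℝ) (A2 : ℝ), HasDerivAt A (A1 0) 0 → HasDerivAt A1 A2 0 →
      HasDerivAt (fun t => 2 * A t * A1 t) (2 * A1 0 ^ 2 + 2 * A 0 * A2) 0 := by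
    intro A A1 A2 h h1
    have := (h.const_mul 2).mul h1
    refine HasDerivAt.congr_deriv this ?_
    ring
  obtain ⟨a1, a2⟩ := aux_pow (fun t => U t ^ 2 + τ) (fun t => 2 * U t * U1 t)
    _ q (by filter_upwards [hU] with t ht; exact (sq U U1 t ht).add_const τ)
    (sq1 U U1 U2 hU.self_of_nhds hU1) (fun t => by positivity)
  obtain ⟨b1, b2⟩ := aux_pow (fun t => U t ^ 2 + V t ^ 2 + τ)
    (fun t => 2 * U t * U1 t + 2 * V t * V1 t)
    _ q (by filter_upwards [hU, hV] with t ht ht'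
            exact ((sq U U1 t ht).add (sq V V1 t ht')).add_const τ)
    ((sq1 U U1 U2 hU.self_of_nhds hU1).add (sq1 V V1 V2 hV.self_of_nhds hV1))
    (fun t => by positivity)
  exact ⟨_, by filter_upwards [a1, b1] with t h h'; exact (h.const_mul K).sub h',
    (a2.const_mul K).sub b2⟩

lemma aux_ineq (u v a b c d p τ : ℝ) (hp : 1 < p) (hp2 : p ≤ 2) (hτ : 0 < τ)
    (q K : ℝ) (hq : q = p / 2) (hK : K = p / (p-1)) :
    0 ≤ (K * (q * ((2 * a ^ 2 + 2 * u * c) * (u ^ 2 + τ) ^ (q-1)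
        + (q-1) * (2 * u * a) ^ 2 * (u ^ 2 + τ) ^ (q-2)))
      - (q * ((2 * a ^ 2 + 2 * u * c + (2 * b ^ 2 + 2 * v * d))
          * (u ^ 2 + v ^ 2 + τ) ^ (q-1)
        + (q-1) * (2 * u * a + 2 * v * b) ^ 2
          * (u ^ 2 + v ^ 2 + τ) ^ (q-2)))) +
      (K * (q * ((2 * (-b) ^ 2 + 2 * u * (-c)) * (u ^ 2 + τ) ^ (q-1)
        + (q-1) * (2 * u * (-b)) ^ 2 * (u ^ 2 + τ) ^ (q-2)))
      - (q * ((2 * (-b) ^ 2 + 2 * u * (-c) + (2 * a ^ 2 + 2 * v * (-d)))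
          * (u ^ 2 + v ^ 2 + τ) ^ (q-1)
        + (q-1) * (2 * u * (-b) + 2 * v * a) ^ 2
          * (u ^ 2 + v ^ 2 + τ) ^ (q-2)))) := by
  have hX : 0 < u ^ 2 + τ := by positivity
  have hR : 0 < u ^ 2 + v ^ 2 + τ := by positivity
  have hXR : u ^ 2 + τ ≤ u ^ 2 + v ^ 2 + τ := by nlinarith [sq_nonneg v]
  have e1 : (u ^ 2 + τ) ^ (q-1) = (u ^ 2 + τ) ^ (q-2) * (u ^ 2 + τ) := by
    rw [← Real.rpow_add_one hX.ne']; congr 1; ring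
  have e2 : (u ^ 2 + v ^ 2 + τ) ^ (q-1)
      = (u ^ 2 + v ^ 2 + τ) ^ (q-2) * (u ^ 2 + v ^ 2 + τ) := by
    rw [← Real.rpow_add_one hR.ne']; congr 1; ring
  have m1 : (u ^ 2 + v ^ 2 + τ) ^ (q-1) ≤ (u ^ 2 + τ) ^ (q-1) :=
    Real.rpow_le_rpow_of_nonpos hX hXR (by linarith)
  have m2 : (u ^ 2 + v ^ 2 + τ) ^ (q-2) ≤ (u ^ 2 + τ) ^ (q-2) :=
    Real.rpow_le_rpow_of_nonpos hX hXR (by linarith)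
  have p2 : 0 < (u ^ 2 + τ) ^ (q-2) := Real.rpow_pos_of_pos hX _
  rw [e1, e2] at *
  generalize (u ^ 2 + τ) ^ (q-2) = x at *
  generalize (u ^ 2 + v ^ 2 + τ) ^ (q-2) = r at *
  have hK1 : K * (2 * q - 1) = 2 * q := by
    rw [hK, hq]; field_simp [show p - 1 ≠ 0 by linarith]
  have hK2 : 2 ≤ K := by
    rw [hK, le_div_iff₀ (by linarith)]; linarith
  have key : 0 ≤ K * (x * (u^2+τ) + 2 * (q-1) * u^2 * x)
      - (2 * (r * (u^2+v^2+τ)) + 2 * (q-1) * (u^2+v^2) * r) := by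
    have k1 : K * (x * (u^2+τ) + 2 * (q-1) * u^2 * x) = x * (2 * q * u^2 + K * τ) := by
      rw [← hK1]; ring
    have k2 : x * (2 * q * u^2 + 2 * τ) ≤ x * (2 * q * u^2 + K * τ) := by gcongr
    have k3 := mul_le_mul_of_nonneg_left m1 (show 0 ≤ 2 * q by linarith)
    have k4 := mul_le_mul_of_nonneg_left m2 (show 0 ≤ 2 * (1-q) * τ from
      mul_nonneg (by linarith) hτ.le)
    linarith
  have := mul_nonneg (mul_nonneg (show 0 ≤ 2 * q by linarith)
    (show 0 ≤ a^2 + b^2 by positivity)) key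
  refine this.trans_eq ?_
  ring

lemma aux_second {n : ℕ} (g : EuclideanSpace ℂ (Fin n) → ℝ)
    (z e : EuclideanSpace ℂ (Fin n))
    (hg : ∀ᶠ x in nhds z, DifferentiableAt ℝ g x)
    (hg2 : DifferentiableAt ℝ (fderiv ℝ g) z) (D : ℝ → ℝ) (L : ℝ)
    (hD : ∀ᶠ t in nhds (0:ℝ), HasDerivAt (fun t : ℝ => g (z + t • e)) (D t) t)
    (hL : HasDerivAt D L 0) : fderiv ℝ (fderiv ℝ g) z e e = L := by
  have hγ : ∀ t : ℝ, HasDerivAt (fun t : ℝ => z + t • e) e t := by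
    intro t
    simpa using ((hasDerivAt_id t).smul_const e).const_add z
  have hc : Filter.Tendsto (fun t : ℝ => z + t • e) (nhds 0) (nhds z) := by
    have := (hγ 0).continuousAt.tendsto
    simpa using this
  have h1 : (fun t : ℝ => fderiv ℝ g (z + t • e) e) =ᶠ[nhds 0] D := by
    filter_upwards [hD, hc.eventually hg] with t h h'
    exact (h'.hasFDerivAt.comp_hasDerivAt t (hγ t)).unique h
  have h2 : HasDerivAt (fun t : ℝ => fderiv ℝ g (z + t • e)) (fderiv ℝ (fderiv ℝ g) z e) 0 := by
    have hz : HasFDerivAt (fderiv ℝ g) (fderiv ℝ (fderiv ℝ g) z) (z + (0:ℝ) • e) := by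
      simpa using hg2.hasFDerivAt
    exact hz.comp_hasDerivAt (0:ℝ) (hγ 0)
  have h3 := h2.clm_apply (hasDerivAt_const (0:ℝ) e)
  have h4 := h3.unique (hL.congr_of_eventuallyEq h1)
  simpa using h4

theorem psh_riesz_lemma (n : ℕ) (Ω : Set (EuclideanSpace ℂ (Fin n))) (hΩ : IsOpen Ω)
    (f : EuclideanSpace ℂ (Fin n) → ℂ) (hf : DifferentiableOn ℂ f Ω)
    (p τ : ℝ) (hp : 1 < p) (hp2 : p ≤ 2) (hτ : 0 < τ) :
    PshOnCn (fun z => p / (p - 1) * (((f z).re) ^ 2 + τ) ^ (p / 2)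
      - (‖f z‖ ^ 2 + τ) ^ (p / 2)) Ω := by
  intro z hz w
  have hn : ∀ x : ℂ, ‖x‖ ^ 2 = x.re ^ 2 + x.im ^ 2 := by
    intro x; rw [Complex.sq_norm, Complex.normSq_apply]; ring
  simp only [hn]
  set g : EuclideanSpace ℂ (Fin n) → ℝ := fun z => p / (p - 1) * (((f z).re) ^ 2 + τ) ^ (p / 2)
      - ((f z).re ^ 2 + (f z).im ^ 2 + τ) ^ (p / 2) with hgdef
  by_cases hg2 : DifferentiableAt ℝ (fderiv ℝ g) z
  swap
  · rw [fderiv_zero_of_not_differentiableAt hg2]; simp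
  have hg : ∀ᶠ x in nhds z, DifferentiableAt ℝ g x := by
    filter_upwards [hΩ.mem_nhds hz] with x hx
    have hfx : DifferentiableAt ℝ f x :=
      ((hf x hx).differentiableAt (hΩ.mem_nhds hx)).restrictScalars ℝ
    have hr : DifferentiableAt ℝ (fun x => (f x).re) x :=
      Complex.reCLM.differentiableAt.comp x hfx
    have hi : DifferentiableAt ℝ (fun x => (f x).im) x :=
      Complex.imCLM.differentiableAt.comp x hfx
    refine DifferentiableAt.sub (DifferentiableAt.const_mul
      (DifferentiableAt.rpow_const ?_ (Or.inl ?_)) _)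
      (DifferentiableAt.rpow_const ?_ (Or.inl ?_))
    · fun_prop
    · positivity
    · fun_prop
    · positivity
  -- one-variable slice
  let φ : ℂ → ℂ := fun ζ => f (z + ζ • w)
  have hcl : Continuous (fun ζ : ℂ => z + ζ • w) := by fun_prop
  have hopen : IsOpen ((fun ζ : ℂ => z + ζ • w) ⁻¹' Ω) := hΩ.preimage hcl
  have hφ : DifferentiableOn ℂ φ ((fun ζ : ℂ => z + ζ • w) ⁻¹' Ω) := by
    refine hf.comp (Differentiable.differentiableOn (by fun_prop)) (fun x hx => hx)
  have h0 : (0:ℂ) ∈ ((fun ζ : ℂ => z + ζ • w) ⁻¹' Ω) := by simpa using hz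
  have hφ' := hφ.deriv hopen
  have hA : ∀ᶠ ζ in nhds (0:ℂ), HasDerivAt φ (deriv φ ζ) ζ := by
    filter_upwards [hopen.mem_nhds h0] with ζ hζ
    exact (hφ.differentiableAt (hopen.mem_nhds hζ)).hasDerivAt
  have hB : HasDerivAt (deriv φ) (deriv (deriv φ) 0) 0 :=
    (hφ'.differentiableAt (hopen.mem_nhds h0)).hasDerivAt
  have hl : ∀ (c : ℂ) (t : ℝ), HasDerivAt (fun t : ℝ => (t:ℂ) * c) c t := by
    intro c t
    simpa using (Complex.ofRealCLM.hasDerivAt (x := t)).mul_const c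
  have hl0 : ∀ c : ℂ, Filter.Tendsto (fun t : ℝ => (t:ℂ) * c) (nhds 0) (nhds 0) := by
    intro c
    simpa using (hl c 0).continuousAt.tendsto
  have hC : ∀ c : ℂ, ∀ᶠ t : ℝ in nhds 0,
      HasDerivAt (fun t : ℝ => φ (t * c)) (deriv φ (t * c) * c) t := by
    intro c
    filter_upwards [(hl0 c).eventually hA] with t ht
    exact ht.comp t (hl c t)
  have hE : ∀ c : ℂ, HasDerivAt (fun t : ℝ => deriv φ (t * c) * c)
      (deriv (deriv φ) 0 * c * c) 0 := by
    intro c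
    have hB' : HasDerivAt (deriv φ) (deriv (deriv φ) 0) (((0:ℝ):ℂ) * c) := by simpa using hB
    exact (hB'.comp (0:ℝ) (hl c 0)).mul_const c
  have line := fun c : ℂ =>
    aux_dir (fun t => (φ (t * c)).re) (fun t => (φ (t * c)).im)
      (fun t => (deriv φ (t * c) * c).re) (fun t => (deriv φ (t * c) * c).im)
      (deriv (deriv φ) 0 * c * c).re (deriv (deriv φ) 0 * c * c).im (p/2) (p/(p-1)) τ hτ
      (by filter_upwards [hC c] with t ht
          exact Complex.reCLM.hasFDerivAt.comp_hasDerivAt t ht)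
      (Complex.reCLM.hasFDerivAt.comp_hasDerivAt (0:ℝ) (hE c))
      (by filter_upwards [hC c] with t ht
          exact Complex.imCLM.hasFDerivAt.comp_hasDerivAt t ht)
      (Complex.imCLM.hasFDerivAt.comp_hasDerivAt (0:ℝ) (hE c))
  have hsm : ∀ (c : ℂ) (t : ℝ), z + ((t:ℂ) * c) • w = z + t • (c • w) := by
    intro c t
    rw [mul_smul, Complex.coe_smul]
  obtain ⟨D1, d1, l1⟩ := line 1
  obtain ⟨D2, d2, l2⟩ := line Complex.I
  have r1 := aux_second g z ((1:ℂ) • w) hg hg2 D1 _ (by simpa only [φ, hsm] using d1) l1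
  have r2 := aux_second g z (Complex.I • w) hg hg2 D2 _ (by simpa only [φ, hsm] using d2) l2
  rw [one_smul] at r1
  rw [r1, r2]
  have := aux_ineq (φ 0).re (φ 0).im (deriv φ 0).re (deriv φ 0).im
    (deriv (deriv φ) 0).re (deriv (deriv φ) 0).im p τ hp hp2 hτ _ _ rfl rfl
  simpa using this
end

section
/- Let Ω be an open subset of ℂⁿ, let z₀ ∈ Ω and r > 0 be such that the closed ball {z : |z − z₀| ≤ r} is contained in Ω, and let f = u + iv be holomorphic on Ω with v(z₀) = 0. Then for every 1 < p ≤ 2, ∫_{S(z₀,r)} |f|^p dσ_{z₀,r} ≤ (p/(p−1)) · ∫_{S(z₀,r)} |u|^p dσ_{z₀,r}. -/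
open Real MeasureTheory Set

noncomputable instance euclideanCnMeasurableSpace (n : ℕ) :
    MeasurableSpace (EuclideanSpace ℂ (Fin n)) := borel _

instance euclideanCnBorelSpace (n : ℕ) :
    BorelSpace (EuclideanSpace ℂ (Fin n)) := ⟨rfl⟩

/-- The surface measure on the sphere `S(z₀, r) ⊆ ℂⁿ` (the `(2n−1)`-dimensional Hausdorff
measure restricted to the sphere), normalized to total mass `1`; this is the harmonic measure
of the ball `B(z₀, r)` at its center `z₀`. -/
noncomputable def sphereUnifMeasure (n : ℕ) (z₀ : EuclideanSpace ℂ (Fin n)) (r : ℝ) :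
    Measure (EuclideanSpace ℂ (Fin n)) :=
  ((μH[2 * (n : ℝ) - 1] : Measure (EuclideanSpace ℂ (Fin n))) (Metric.sphere z₀ r))⁻¹ •
    (μH[2 * (n : ℝ) - 1] : Measure (EuclideanSpace ℂ (Fin n))).restrict (Metric.sphere z₀ r)


noncomputable def rzP (C q ε : ℝ) (w : ℂ) : ℝ :=
  C * (w.re^2+ε)^q - (w.re^2+w.im^2+ε)^q
noncomputable def rzP1 (C q ε : ℝ) (w a : ℂ) : ℝ :=
  C * (2*w.re*a.re*q*(w.re^2+ε)^(q-1)) - (2*w.re*a.re+2*w.im*a.im)*q*(w.re^2+w.im^2+ε)^(q-1)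
noncomputable def rzP2 (C q ε : ℝ) (w a c d : ℂ) : ℝ :=
  C * q * ((q-1)*(w.re^2+ε)^(q-1-1)*(2*w.re*c.re)*(2*w.re*a.re)
      + (w.re^2+ε)^(q-1)*(2*c.re*a.re+2*w.re*d.re))
  - q * ((q-1)*(w.re^2+w.im^2+ε)^(q-1-1)*(2*w.re*c.re+2*w.im*c.im)*(2*w.re*a.re+2*w.im*a.im)
      + (w.re^2+w.im^2+ε)^(q-1)*(2*c.re*a.re+2*w.re*d.re+2*c.im*a.im+2*w.im*d.im))

lemma rz_hre {γ : ℝ → ℂ} {c : ℂ} {t : ℝ} (h : HasDerivAt γ c t) :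
    HasDerivAt (fun s => (γ s).re) c.re t :=
  (Complex.reCLM.hasFDerivAt.comp_hasDerivAt t h)
lemma rz_him {γ : ℝ → ℂ} {c : ℂ} {t : ℝ} (h : HasDerivAt γ c t) :
    HasDerivAt (fun s => (γ s).im) c.im t :=
  (Complex.imCLM.hasFDerivAt.comp_hasDerivAt t h)

lemma rzP_deriv (C q : ℝ) {ε : ℝ} (hε : 0 < ε) {γ : ℝ → ℂ} {c : ℂ} {t : ℝ}
    (h : HasDerivAt γ c t) :
    HasDerivAt (fun s => rzP C q ε (γ s)) (rzP1 C q ε (γ t) c) t := by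
  have hr := rz_hre h
  have hi := rz_him h
  have h1 : HasDerivAt (fun s => ((γ s).re^2+ε)) (2*(γ t).re*c.re) t := by
    simpa using (hr.pow 2).add_const ε
  have h2 : HasDerivAt (fun s => ((γ s).re^2+(γ s).im^2+ε)) (2*(γ t).re*c.re+2*(γ t).im*c.im) t := by
    simpa using ((hr.pow 2).add (hi.pow 2)).add_const ε
  have p1 : (γ t).re^2+ε ≠ 0 := by positivity
  have p2 : (γ t).re^2+(γ t).im^2+ε ≠ 0 := by positivity
  exact ((h1.rpow_const (p := q) (Or.inl p1)).const_mul C).sub (h2.rpow_const (p := q) (Or.inl p2))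

lemma rzP1_deriv (C q : ℝ) {ε : ℝ} (hε : 0 < ε) {γ α : ℝ → ℂ} {c d : ℂ} {t : ℝ}
    (h : HasDerivAt γ c t) (h' : HasDerivAt α d t) :
    HasDerivAt (fun s => rzP1 C q ε (γ s) (α s)) (rzP2 C q ε (γ t) (α t) c d) t := by
  have hr := rz_hre h
  have hi := rz_him h
  have hr' := rz_hre h'
  have hi' := rz_him h'
  have h1 : HasDerivAt (fun s => ((γ s).re^2+ε)) (2*(γ t).re*c.re) t := by
    simpa using (hr.pow 2).add_const ε
  have h2 : HasDerivAt (fun s => ((γ s).re^2+(γ s).im^2+ε)) (2*(γ t).re*c.re+2*(γ t).im*c.im) t := by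
    simpa using ((hr.pow 2).add (hi.pow 2)).add_const ε
  have p1 : (γ t).re^2+ε ≠ 0 := by positivity
  have p2 : (γ t).re^2+(γ t).im^2+ε ≠ 0 := by positivity
  have A := (((((hr.const_mul 2).mul hr').mul_const q).mul
    (h1.rpow_const (p := q-1) (Or.inl p1))).const_mul C).sub
    (((((hr.const_mul 2).mul hr').add ((hi.const_mul 2).mul hi')).mul_const q).mul
    (h2.rpow_const (p := q-1) (Or.inl p2)))
  refine A.congr_deriv ?_
  simp only [rzP2, Pi.mul_apply, Pi.add_apply]
  ring

lemma rzP2_nonneg {q ε : ℝ} (hq : 1/2 < q) (hq1 : q ≤ 1) (hε : 0 < ε) (w a b : ℂ) :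
    0 ≤ rzP2 (2*q/(2*q-1)) q ε w a a b +
      rzP2 (2*q/(2*q-1)) q ε w (Complex.I*a) (Complex.I*a) (-b) := by
  obtain ⟨C, hC⟩ : ∃ C, C = 2*q/(2*q-1) := ⟨_, rfl⟩
  rw [← hC]
  have hC1 : C * (2*q-1) = 2*q := by rw [hC]; field_simp [show 2*q-1 ≠ 0 by linarith]
  have hC2 : 2 ≤ C := by rw [hC, le_div_iff₀ (by linarith)]; linarith
  simp only [rzP2, Complex.mul_re, Complex.mul_im, Complex.I_re, Complex.I_im, Complex.neg_re,
    Complex.neg_im]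
  have p1 : 0 < w.re^2+ε := by positivity
  have p2 : 0 < w.re^2+w.im^2+ε := by positivity
  have e1 : (w.re^2+ε)^(q-1) = (w.re^2+ε) * (w.re^2+ε)^(q-1-1) := by
    rw [rpow_sub_one p1.ne' (q-1)]; field_simp
  have e2 : (w.re^2+w.im^2+ε)^(q-1) = (w.re^2+w.im^2+ε) * (w.re^2+w.im^2+ε)^(q-1-1) := by
    rw [rpow_sub_one p2.ne' (q-1)]; field_simp
  have hle : w.re^2+ε ≤ w.re^2+w.im^2+ε := by nlinarith [sq_nonneg w.im]
  have m1 : (w.re^2+w.im^2+ε)^(q-1) ≤ (w.re^2+ε)^(q-1) :=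
    rpow_le_rpow_of_nonpos p1 hle (by linarith)
  have m2 : (w.re^2+w.im^2+ε)^(q-1-1) ≤ (w.re^2+ε)^(q-1-1) :=
    rpow_le_rpow_of_nonpos p1 hle (by linarith)
  have hX : 0 < (w.re^2+ε)^(q-1-1) := rpow_pos_of_pos p1 _
  rw [e1, e2] at m1 ⊢
  generalize (w.re^2+ε)^(q-1-1) = X at *
  generalize (w.re^2+w.im^2+ε)^(q-1-1) = Y at *
  generalize w.re = u at *
  generalize w.im = v at *
  have key : 0 ≤ C*(4*(q-1)*u^2+2*(u^2+ε))*X - (4*(q-1)*(u^2+v^2)+4*(u^2+v^2+ε))*Y := by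
    have k1 := mul_nonneg (by linarith : 0 ≤ 4*q) (sub_nonneg.2 m1)
    have k2 := mul_nonneg (mul_nonneg (by linarith : 0 ≤ 4*(1-q)) hε.le) (sub_nonneg.2 m2)
    have k3 := mul_nonneg (mul_nonneg (sub_nonneg.2 hC2) hε.le) hX.le
    have k4 : C*(4*(q-1)*u^2+2*(u^2+ε))*X = 4*q*u^2*X + 2*C*ε*X := by
      linear_combination 2*u^2*X*hC1
    rw [k4]; linarith
  have := mul_nonneg (mul_nonneg (by linarith : 0 ≤ q) (add_nonneg (sq_nonneg a.re) (sq_nonneg a.im))) key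
  refine this.trans_eq ?_
  ring

lemma rz_comp {X : Type*} [TopologicalSpace X] {s : Set X} {C q ε : ℝ} (hε : 0 < ε) {w : X → ℂ}
    (hw : ContinuousOn w s) : ContinuousOn (fun x => rzP C q ε (w x)) s := by
  have hr := Complex.continuous_re.comp_continuousOn hw
  have hi := Complex.continuous_im.comp_continuousOn hw
  simp only [Function.comp_def] at hr hi
  unfold rzP
  have A : ContinuousOn (fun x => ((w x).re^2+ε)^q) s := by
    refine ContinuousOn.rpow_const (by fun_prop) fun x _ => Or.inl (by positivity)
  have B : ContinuousOn (fun x => ((w x).re^2+(w x).im^2+ε)^q) s := by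
    refine ContinuousOn.rpow_const (by fun_prop) fun x _ => Or.inl (by positivity)
  fun_prop

lemma rz_comp1 {X : Type*} [TopologicalSpace X] {s : Set X} {C q ε : ℝ} (hε : 0 < ε) {w a : X → ℂ}
    (hw : ContinuousOn w s) (ha : ContinuousOn a s) :
    ContinuousOn (fun x => rzP1 C q ε (w x) (a x)) s := by
  have hr := Complex.continuous_re.comp_continuousOn hw
  have hi := Complex.continuous_im.comp_continuousOn hw
  have har := Complex.continuous_re.comp_continuousOn ha
  have hai := Complex.continuous_im.comp_continuousOn ha
  simp only [Function.comp_def] at hr hi har hai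
  unfold rzP1
  have A : ContinuousOn (fun x => ((w x).re^2+ε)^(q-1)) s := by
    refine ContinuousOn.rpow_const (by fun_prop) fun x _ => Or.inl (by positivity)
  have B : ContinuousOn (fun x => ((w x).re^2+(w x).im^2+ε)^(q-1)) s := by
    refine ContinuousOn.rpow_const (by fun_prop) fun x _ => Or.inl (by positivity)
  fun_prop

lemma rz_comp2 {X : Type*} [TopologicalSpace X] {s : Set X} {C q ε : ℝ} (hε : 0 < ε)
    {w a c d : X → ℂ}
    (hw : ContinuousOn w s) (ha : ContinuousOn a s) (hc : ContinuousOn c s)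
    (hd : ContinuousOn d s) :
    ContinuousOn (fun x => rzP2 C q ε (w x) (a x) (c x) (d x)) s := by
  have hr := Complex.continuous_re.comp_continuousOn hw
  have hi := Complex.continuous_im.comp_continuousOn hw
  have har := Complex.continuous_re.comp_continuousOn ha
  have hai := Complex.continuous_im.comp_continuousOn ha
  have hcr := Complex.continuous_re.comp_continuousOn hc
  have hci := Complex.continuous_im.comp_continuousOn hc
  have hdr := Complex.continuous_re.comp_continuousOn hd
  have hdi := Complex.continuous_im.comp_continuousOn hd
  simp only [Function.comp_def] at hr hi har hai hcr hci hdr hdi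
  unfold rzP2
  have A : ContinuousOn (fun x => ((w x).re^2+ε)^(q-1)) s := by
    refine ContinuousOn.rpow_const (by fun_prop) fun x _ => Or.inl (by positivity)
  have B : ContinuousOn (fun x => ((w x).re^2+(w x).im^2+ε)^(q-1)) s := by
    refine ContinuousOn.rpow_const (by fun_prop) fun x _ => Or.inl (by positivity)
  have A' : ContinuousOn (fun x => ((w x).re^2+ε)^(q-1-1)) s := by
    refine ContinuousOn.rpow_const (by fun_prop) fun x _ => Or.inl (by positivity)
  have B' : ContinuousOn (fun x => ((w x).re^2+(w x).im^2+ε)^(q-1-1)) s := by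
    refine ContinuousOn.rpow_const (by fun_prop) fun x _ => Or.inl (by positivity)
  fun_prop

lemma rz_param_cont {G : ℝ → ℝ → ℝ} {b : ℝ}
    (hG : ContinuousOn (Function.uncurry G) (Icc 0 1 ×ˢ uIcc 0 b)) :
    ContinuousOn (fun s => ∫ t in (0:ℝ)..b, G s t) (Icc 0 1) := by
  obtain ⟨K, hK⟩ := (isCompact_Icc.prod isCompact_uIcc).exists_bound_of_continuousOn hG
  have hs : ∀ s ∈ Icc (0:ℝ) 1, ContinuousOn (G s) (uIcc 0 b) := fun s hs =>
    hG.comp (f := fun t => (s, t)) (by fun_prop) (fun t ht => ⟨hs, ht⟩)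
  intro s₀ hs₀
  refine intervalIntegral.continuousWithinAt_of_dominated_interval (bound := fun _ => K) ?_ ?_ ?_ ?_
  · filter_upwards [self_mem_nhdsWithin] with s h
    exact ((hs s h).mono uIoc_subset_uIcc).aestronglyMeasurable measurableSet_uIoc
  · filter_upwards [self_mem_nhdsWithin] with s h
    exact Filter.Eventually.of_forall fun t ht => hK (s, t) ⟨h, uIoc_subset_uIcc ht⟩
  · exact intervalIntegrable_const
  · refine Filter.Eventually.of_forall fun t ht => ?_
    exact (hG.comp (f := fun s => (s, t)) (by fun_prop) (fun s h => ⟨h, uIoc_subset_uIcc ht⟩)) s₀ hs₀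

lemma rz_param_deriv {G G' : ℝ → ℝ → ℝ} {b : ℝ}
    (hG : ContinuousOn (Function.uncurry G) (Icc 0 1 ×ˢ uIcc 0 b))
    (hG' : ContinuousOn (Function.uncurry G') (Icc 0 1 ×ˢ uIcc 0 b))
    (hd : ∀ s ∈ Ioo (0:ℝ) 1, ∀ t, HasDerivAt (fun s => G s t) (G' s t) s)
    {s : ℝ} (h : s ∈ Ioo (0:ℝ) 1) :
    HasDerivAt (fun s => ∫ t in (0:ℝ)..b, G s t) (∫ t in (0:ℝ)..b, G' s t) s := by
  obtain ⟨K, hK⟩ := (isCompact_Icc.prod isCompact_uIcc).exists_bound_of_continuousOn hG'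
  have hs : ∀ s ∈ Icc (0:ℝ) 1, ContinuousOn (G s) (uIcc 0 b) := fun s hs =>
    hG.comp (f := fun t => (s, t)) (by fun_prop) (fun t ht => ⟨hs, ht⟩)
  have hs' : ∀ s ∈ Icc (0:ℝ) 1, ContinuousOn (G' s) (uIcc 0 b) := fun s hs =>
    hG'.comp (f := fun t => (s, t)) (by fun_prop) (fun t ht => ⟨hs, ht⟩)
  have hn : Ioo (0:ℝ) 1 ∈ nhds s := isOpen_Ioo.mem_nhds h
  refine (intervalIntegral.hasDerivAt_integral_of_dominated_loc_of_deriv_le (bound := fun _ => K)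
    hn ?_ ?_ ?_ ?_ ?_ ?_).2
  · filter_upwards [hn] with s h
    exact ((hs s (Ioo_subset_Icc_self h)).mono uIoc_subset_uIcc).aestronglyMeasurable measurableSet_uIoc
  · exact (hs s (Ioo_subset_Icc_self h)).intervalIntegrable
  · exact ((hs' s (Ioo_subset_Icc_self h)).mono uIoc_subset_uIcc).aestronglyMeasurable measurableSet_uIoc
  · exact Filter.Eventually.of_forall fun t ht x hx =>
      hK (x, t) ⟨Ioo_subset_Icc_self hx, uIoc_subset_uIcc ht⟩
  · exact intervalIntegrable_const
  · exact Filter.Eventually.of_forall fun t _ x hx => hd x hx t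

/-- point on circle -/
noncomputable def rzE (t : ℝ) : ℂ := Complex.exp (t * Complex.I)

lemma rzE_norm (t : ℝ) : ‖rzE t‖ = 1 := Complex.norm_exp_ofReal_mul_I t
lemma rzE_cont : Continuous rzE := by unfold rzE; fun_prop
lemma rzE_deriv (t : ℝ) : HasDerivAt rzE (Complex.I * rzE t) t := by
  have h : HasDerivAt (fun t : ℝ => (t:ℂ) * Complex.I) Complex.I t := by
    simpa using (Complex.ofRealCLM.hasDerivAt (x := t)).mul_const Complex.I
  exact (h.cexp).congr_deriv (by rw [rzE, mul_comm])

lemma rz_disc_eps {F : ℂ → ℂ} {U : Set ℂ} (hU : IsOpen U) (hb : Metric.closedBall 0 1 ⊆ U)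
    (hF : DifferentiableOn ℂ F U) {q ε : ℝ} (hq : 1/2 < q) (hq1 : q ≤ 1) (hε : 0 < ε) :
    2 * π * rzP (2*q/(2*q-1)) q ε (F 0) ≤
      ∫ t in (0:ℝ)..(2*π), rzP (2*q/(2*q-1)) q ε (F (rzE t)) := by
  have hnn := fun w a b => rzP2_nonneg hq hq1 hε w a b
  generalize 2*q/(2*q-1) = C at *
  have hF1 : DifferentiableOn ℂ (deriv F) U := hF.deriv hU
  have hF2 : DifferentiableOn ℂ (deriv (deriv F)) U := hF1.deriv hU
  set D : Set (ℝ × ℝ) := Icc 0 1 ×ˢ uIcc 0 (2*π) with hD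
  have hmem : ∀ s ∈ Icc (0:ℝ) 1, ∀ t, (s:ℂ) * rzE t ∈ U := by
    intro s hs t
    apply hb
    simp [rzE_norm, abs_of_nonneg hs.1, hs.2]
  have cE : Continuous (fun x : ℝ × ℝ => rzE x.2) := rzE_cont.comp continuous_snd
  have cz : Continuous (fun x : ℝ × ℝ => (x.1:ℂ) * rzE x.2) := by fun_prop
  have mz : MapsTo (fun x : ℝ × ℝ => (x.1:ℂ) * rzE x.2) D U := fun x hx => hmem x.1 hx.1 x.2
  have c0 : ContinuousOn (fun x : ℝ × ℝ => F (x.1 * rzE x.2)) D :=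
    hF.continuousOn.comp cz.continuousOn mz
  have c1 : ContinuousOn (fun x : ℝ × ℝ => deriv F (x.1 * rzE x.2)) D :=
    hF1.continuousOn.comp cz.continuousOn mz
  have c2 : ContinuousOn (fun x : ℝ × ℝ => deriv (deriv F) (x.1 * rzE x.2)) D :=
    hF2.continuousOn.comp cz.continuousOn mz
  have d0 : ∀ z ∈ U, HasDerivAt F (deriv F z) z := fun z hz =>
    (hF.differentiableAt (hU.mem_nhds hz)).hasDerivAt
  have d1 : ∀ z ∈ U, HasDerivAt (deriv F) (deriv (deriv F) z) z := fun z hz =>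
    (hF1.differentiableAt (hU.mem_nhds hz)).hasDerivAt
  -- radial derivative of the point
  have dr : ∀ s t : ℝ, HasDerivAt (fun s : ℝ => (s:ℂ) * rzE t) (rzE t) s := fun s t => by
    simpa using (Complex.ofRealCLM.hasDerivAt (x := s)).mul_const (rzE t)
  have dt : ∀ s t : ℝ, HasDerivAt (fun t : ℝ => (s:ℂ) * rzE t) (Complex.I * (s * rzE t)) t :=
    fun s t => ((rzE_deriv t).const_mul (s:ℂ)).congr_deriv (by ring)
  set M : ℝ → ℝ := fun s => ∫ t in (0:ℝ)..(2*π), rzP C q ε (F (s * rzE t)) with hM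
  set N : ℝ → ℝ := fun s => ∫ t in (0:ℝ)..(2*π), rzP1 C q ε (F (s * rzE t))
    (s * rzE t * deriv F (s * rzE t)) with hN
  have Mc : ContinuousOn M (Icc 0 1) := rz_param_cont (rz_comp hε c0)
  have gN : ContinuousOn (Function.uncurry fun s t : ℝ => rzP1 C q ε (F (s * rzE t))
    (s * rzE t * deriv F (s * rzE t))) D := rz_comp1 hε c0 (cz.continuousOn.mul c1)
  have Nc : ContinuousOn N (Icc 0 1) := rz_param_cont gN
  have Md : ∀ s ∈ Ioo (0:ℝ) 1, HasDerivAt M (∫ t in (0:ℝ)..(2*π), rzP1 C q ε (F (s * rzE t))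
      (rzE t * deriv F (s * rzE t))) s := by
    intro s hs
    refine rz_param_deriv (G := fun s t => rzP C q ε (F (s * rzE t))) (G' := fun s t => rzP1 C q ε (F (s * rzE t))
      (rzE t * deriv F (s * rzE t))) (rz_comp hε c0) (rz_comp1 hε c0 (cE.continuousOn.mul c1)) ?_ hs
    intro s hs t
    have := (d0 _ (hmem s (Ioo_subset_Icc_self hs) t)).comp s (dr s t)
    rw [mul_comm] at this
    exact rzP_deriv C q hε this
  have Nd : ∀ s ∈ Ioo (0:ℝ) 1, HasDerivAt N (∫ t in (0:ℝ)..(2*π), rzP2 C q ε (F (s * rzE t))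
      (s * rzE t * deriv F (s * rzE t)) (rzE t * deriv F (s * rzE t))
      (rzE t * deriv F (s * rzE t) + s * rzE t * (rzE t * deriv (deriv F) (s * rzE t)))) s := by
    intro s hs
    refine rz_param_deriv (G' := fun s t => rzP2 C q ε (F (s * rzE t))
      (s * rzE t * deriv F (s * rzE t)) (rzE t * deriv F (s * rzE t))
      (rzE t * deriv F (s * rzE t) + s * rzE t * (rzE t * deriv (deriv F) (s * rzE t))))
      gN (rz_comp2 hε c0 (cz.continuousOn.mul c1) (cE.continuousOn.mul c1)
        ((cE.continuousOn.mul c1).add (cz.continuousOn.mul (cE.continuousOn.mul c2)))) ?_ hs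
    intro s hs t
    have h0 := (d0 _ (hmem s (Ioo_subset_Icc_self hs) t)).comp s (dr s t)
    rw [mul_comm] at h0
    have h1 := (d1 _ (hmem s (Ioo_subset_Icc_self hs) t)).comp s (dr s t)
    rw [mul_comm] at h1
    exact rzP1_deriv C q hε h0 ((dr s t).mul h1)
  have cs : ∀ s ∈ Icc (0:ℝ) 1, ∀ g : ℝ × ℝ → ℝ, ContinuousOn g D →
      IntervalIntegrable (fun t => g (s, t)) volume 0 (2*π) := fun s hs g hg =>
    (hg.comp (f := fun t => (s, t)) (by fun_prop) (fun t ht => ⟨hs, ht⟩)).intervalIntegrable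
  have Nd0 : ∀ s ∈ Ioo (0:ℝ) 1, 0 ≤ (∫ t in (0:ℝ)..(2*π), rzP2 C q ε (F (s * rzE t))
      (s * rzE t * deriv F (s * rzE t)) (rzE t * deriv F (s * rzE t))
      (rzE t * deriv F (s * rzE t) + s * rzE t * (rzE t * deriv (deriv F) (s * rzE t)))) := by
    intro s hs
    have hs' := Ioo_subset_Icc_self hs
    refine nonneg_of_mul_nonneg_right (a := s) ?_ hs.1
    rw [← intervalIntegral.integral_const_mul]
    set A : ℝ → ℂ := fun t => s * rzE t * deriv F (s * rzE t)
    set B : ℝ → ℂ := fun t => s * rzE t * deriv F (s * rzE t) +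
      s * rzE t * (s * rzE t * deriv (deriv F) (s * rzE t))
    have cA : ContinuousOn (fun x : ℝ × ℝ => x.1 * rzE x.2 * deriv F (x.1 * rzE x.2)) D :=
      cz.continuousOn.mul c1
    have cB : ContinuousOn (fun x : ℝ × ℝ => x.1 * rzE x.2 * deriv F (x.1 * rzE x.2) +
      x.1 * rzE x.2 * (x.1 * rzE x.2 * deriv (deriv F) (x.1 * rzE x.2))) D :=
      cA.add (cz.continuousOn.mul (cz.continuousOn.mul c2))
    have i1 : IntervalIntegrable (fun t => rzP2 C q ε (F (s * rzE t)) (A t) (A t) (B t))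
      volume 0 (2*π) := cs s hs' _ (rz_comp2 hε c0 cA cA cB)
    have i2 : IntervalIntegrable (fun t => rzP2 C q ε (F (s * rzE t)) (Complex.I * A t)
      (Complex.I * A t) (-B t)) volume 0 (2*π) :=
      cs s hs' _ (rz_comp2 hε c0 (continuousOn_const.mul cA) (continuousOn_const.mul cA) cB.neg)
    have e1 : (∫ t in (0:ℝ)..(2*π), s * rzP2 C q ε (F (s * rzE t))
      (s * rzE t * deriv F (s * rzE t)) (rzE t * deriv F (s * rzE t))
      (rzE t * deriv F (s * rzE t) + s * rzE t * (rzE t * deriv (deriv F) (s * rzE t))))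
      = ∫ t in (0:ℝ)..(2*π), rzP2 C q ε (F (s * rzE t)) (A t) (A t) (B t) := by
      refine intervalIntegral.integral_congr fun t _ => ?_
      have a1 : A t = (s:ℂ) * (rzE t * deriv F (s * rzE t)) := by simp only [A]; ring
      have b1 : B t = (s:ℂ) * (rzE t * deriv F (s * rzE t) +
        s * rzE t * (rzE t * deriv (deriv F) (s * rzE t))) := by simp only [B]; ring
      change s * rzP2 C q ε (F (s * rzE t)) (A t) _ _ = _
      rw [b1]
      conv_rhs => rw [show rzP2 C q ε (F (s * rzE t)) (A t) (A t) = rzP2 C q ε (F (s * rzE t)) (A t) ((s:ℂ) * (rzE t * deriv F (s * rzE t))) by rw [← a1]]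
      simp only [rzP2, Complex.re_ofReal_mul, Complex.im_ofReal_mul]
      ring
    have e2 : (∫ t in (0:ℝ)..(2*π), rzP2 C q ε (F (s * rzE t)) (Complex.I * A t)
      (Complex.I * A t) (-B t)) = 0 := by
      rw [intervalIntegral.integral_eq_sub_of_hasDerivAt
        (f := fun t => rzP1 C q ε (F (s * rzE t)) (Complex.I * A t)) _ i2]
      · have : rzE (2*π) = rzE 0 := by simp [rzE]
        simp only [A, this, sub_self]
      · intro t _
        have h0 := (d0 _ (hmem s hs' t)).comp t (dt s t)
        have h1 := (d1 _ (hmem s hs' t)).comp t (dt s t)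
        have h2 := ((dt s t).mul h1).const_mul Complex.I
        have h0' : HasDerivAt (fun t => F (s * rzE t)) (Complex.I * A t) t :=
          h0.congr_deriv (by simp only [A]; ring)
        have h2' : HasDerivAt (fun t => Complex.I * A t) (-B t) t :=
          h2.congr_deriv (by
            simp only [B, Function.comp]
            linear_combination (s * rzE t * deriv F (s * rzE t) +
              s * rzE t * (s * rzE t * deriv (deriv F) (s * rzE t))) * Complex.I_sq)
        exact rzP1_deriv C q hε h0' h2'
    have e3 := intervalIntegral.integral_add i1 i2
    rw [e2, add_zero] at e3
    rw [e1, ← e3]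
    exact intervalIntegral.integral_nonneg (by positivity) fun t _ => hnn _ _ _
  have Nmono : MonotoneOn N (Icc 0 1) := by
    refine monotoneOn_of_deriv_nonneg (convex_Icc 0 1) Nc ?_ ?_
    · rw [interior_Icc]; exact fun s hs => (Nd s hs).differentiableAt.differentiableWithinAt
    · rw [interior_Icc]; intro s hs; rw [(Nd s hs).deriv]; exact Nd0 s hs
  have N0 : N 0 = 0 := by simp [hN, rzP1]
  have Mmono : MonotoneOn M (Icc 0 1) := by
    refine monotoneOn_of_deriv_nonneg (convex_Icc 0 1) Mc ?_ ?_
    · rw [interior_Icc]; exact fun s hs => (Md s hs).differentiableAt.differentiableWithinAt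
    · rw [interior_Icc]; intro s hs; rw [(Md s hs).deriv]
      refine nonneg_of_mul_nonneg_right (a := s) ?_ hs.1
      have : 0 ≤ N s := by
        rw [← N0]; exact Nmono (by simp) (Ioo_subset_Icc_self hs) hs.1.le
      refine this.trans_eq ?_
      rw [← intervalIntegral.integral_const_mul]
      refine intervalIntegral.integral_congr fun t _ => ?_
      simp only [rzP1, mul_assoc, Complex.re_ofReal_mul, Complex.im_ofReal_mul]
      ring
  have := Mmono (a := 0) (b := 1) (by simp) (by simp) zero_le_one
  simpa [hM] using this

lemma rz_disc {F : ℂ → ℂ} {U : Set ℂ} (hU : IsOpen U) (hb : Metric.closedBall 0 1 ⊆ U)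
    (hF : DifferentiableOn ℂ F U) (h0 : (F 0).im = 0) {p : ℝ} (hp : 1 < p) (hp2 : p ≤ 2) :
    ∫ t in (0:ℝ)..(2*π), ‖F (rzE t)‖ ^ p ≤
      (p / (p-1)) * ∫ t in (0:ℝ)..(2*π), |(F (rzE t)).re| ^ p := by
  have hC : 1 ≤ p/(p-1) := by rw [le_div_iff₀ (by linarith)]; linarith
  have cF : Continuous (fun t => F (rzE t)) := by
    refine hF.continuousOn.comp_continuous rzE_cont fun t => hb ?_
    simp [rzE_norm]
  have key : ∀ ε : ℝ, 0 < ε → ∫ t in (0:ℝ)..(2*π), ‖F (rzE t)‖ ^ p ≤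
      (p / (p-1)) * (∫ t in (0:ℝ)..(2*π), |(F (rzE t)).re| ^ p) + (p/(p-1)) * (2*π) * ε^(p/2) := by
    intro ε hε
    have h := rz_disc_eps hU hb hF (q := p/2) (by linarith) (by linarith) hε
    rw [show 2*(p/2)/(2*(p/2)-1) = p/(p-1) by rw [mul_div_cancel₀ p two_ne_zero]] at h
    have h1 : 0 ≤ 2 * π * rzP (p/(p-1)) (p/2) ε (F 0) := by
      rw [rzP, h0]
      have : 0 ≤ ((F 0).re^2+ε)^(p/2) := by positivity
      refine mul_nonneg (by positivity) ?_
      norm_num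
      nlinarith
    have h2 := h1.trans h
    have c1 : Continuous (fun t => ‖F (rzE t)‖ ^ p) :=
      cF.norm.rpow_const fun _ => Or.inr (by linarith)
    have c2 : Continuous (fun t => |(F (rzE t)).re| ^ p) :=
      (Complex.continuous_re.comp cF).abs.rpow_const fun _ => Or.inr (by linarith)
    have c3 : Continuous (fun t => rzP (p/(p-1)) (p/2) ε (F (rzE t))) := by
      rw [← continuousOn_univ] at cF ⊢
      exact rz_comp hε cF
    have h3 : ∫ t in (0:ℝ)..(2*π), rzP (p/(p-1)) (p/2) ε (F (rzE t)) ≤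
      ∫ t in (0:ℝ)..(2*π), ((p/(p-1)) * |(F (rzE t)).re| ^ p + (p/(p-1)) * ε^(p/2) - ‖F (rzE t)‖ ^ p) := by
      refine intervalIntegral.integral_mono_on (by positivity) (c3.intervalIntegrable _ _)
        (Continuous.intervalIntegrable (by fun_prop) _ _) fun t _ => ?_
      generalize F (rzE t) = w
      rw [rzP, ← mul_add]
      refine sub_le_sub (mul_le_mul_of_nonneg_left ?_ (by linarith)) ?_
      · have := Real.rpow_add_le_add_rpow (sq_nonneg w.re) hε.le (p := p/2) (by linarith) (by linarith)
        have e : (w.re^2)^(p/2) = |w.re|^p := by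
          rw [← sq_abs, ← rpow_natCast, ← rpow_mul (abs_nonneg _), Nat.cast_ofNat,
            mul_div_cancel₀ p two_ne_zero]
        rwa [e] at this
      · have e : ‖w‖^p = (w.re^2+w.im^2)^(p/2) := by
          rw [show w.re^2+w.im^2 = ‖w‖^2 by rw [Complex.sq_norm, Complex.normSq_apply]; ring, ← rpow_natCast, ← rpow_mul (norm_nonneg _), Nat.cast_ofNat, mul_div_cancel₀ p two_ne_zero]
        rw [e]
        exact rpow_le_rpow (by positivity) (by linarith) (by linarith)
    rw [intervalIntegral.integral_sub (Continuous.intervalIntegrable (by fun_prop) _ _) (c1.intervalIntegrable _ _),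
      intervalIntegral.integral_add (Continuous.intervalIntegrable (by fun_prop) _ _) (by simp),
      intervalIntegral.integral_const_mul, intervalIntegral.integral_const, smul_eq_mul] at h3
    linarith
  refine le_of_forall_pos_le_add fun δ hδ => ?_
  have hK : 0 < (p/(p-1)) * (2*π) := by positivity
  have := key ((δ / ((p/(p-1)) * (2*π)))^(2/p)) (by positivity)
  rw [← rpow_mul (by positivity), show 2/p*(p/2) = 1 by field_simp, rpow_one, mul_div_cancel₀ _ hK.ne'] at this
  exact this

lemma rz_sphere_finite (n : ℕ) (z₀ : EuclideanSpace ℂ (Fin n)) (r : ℝ) :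
    IsFiniteMeasure (sphereUnifMeasure n z₀ r) := by
  refine ⟨?_⟩
  rw [sphereUnifMeasure, Measure.smul_apply, Measure.restrict_apply_univ, smul_eq_mul]
  exact (ENNReal.inv_mul_le_one _).trans_lt ENNReal.one_lt_top

lemma rz_sphere_restrict (n : ℕ) (z₀ : EuclideanSpace ℂ (Fin n)) (r : ℝ) :
    (sphereUnifMeasure n z₀ r).restrict (Metric.sphere z₀ r) = sphereUnifMeasure n z₀ r := by
  rw [sphereUnifMeasure, Measure.restrict_smul, Measure.restrict_restrict Metric.isClosed_sphere.measurableSet, inter_self]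

noncomputable def rzIso (n : ℕ) (z₀ : EuclideanSpace ℂ (Fin n)) (c : ℂ) (hc : ‖c‖ = 1) :
    EuclideanSpace ℂ (Fin n) ≃ᵢ EuclideanSpace ℂ (Fin n) where
  toFun z := z₀ + c • (z - z₀)
  invFun z := z₀ + c⁻¹ • (z - z₀)
  left_inv z := by
    have : c ≠ 0 := by rintro rfl; simp at hc
    simp [smul_smul, inv_mul_cancel₀ this]
  right_inv z := by
    have : c ≠ 0 := by rintro rfl; simp at hc
    simp [smul_smul, mul_inv_cancel₀ this]
  isometry_toFun := by
    refine Isometry.of_dist_eq fun x y => ?_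
    rw [dist_add_left, dist_smul₀, hc, one_mul, dist_sub_right]

lemma rz_sphere_inv (n : ℕ) (z₀ : EuclideanSpace ℂ (Fin n)) (r : ℝ) (c : ℂ) (hc : ‖c‖ = 1)
    (g : EuclideanSpace ℂ (Fin n) → ℝ) :
    ∫ z, g (z₀ + c • (z - z₀)) ∂(sphereUnifMeasure n z₀ r) = ∫ z, g z ∂(sphereUnifMeasure n z₀ r) := by
  have hm := ((rzIso n z₀ c hc).measurePreserving_hausdorffMeasure (2 * (n:ℝ) - 1)).restrict_preimage
    (s := Metric.sphere z₀ r) Metric.isClosed_sphere.measurableSet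
  have hpre : (rzIso n z₀ c hc) ⁻¹' Metric.sphere z₀ r = Metric.sphere z₀ r := by
    ext z
    change dist (z₀ + c • (z - z₀)) z₀ = r ↔ dist z z₀ = r
    rw [dist_eq_norm, dist_eq_norm, add_sub_cancel_left, norm_smul, hc, one_mul]
  rw [hpre] at hm
  simp only [sphereUnifMeasure, integral_smul_measure]
  congr 1
  exact hm.integral_comp (rzIso n z₀ c hc).toHomeomorph.measurableEmbedding g

lemma rz_slice (n : ℕ) (z₀ : EuclideanSpace ℂ (Fin n)) (r : ℝ)
    (g : EuclideanSpace ℂ (Fin n) → ℝ) (hg : ContinuousOn g (Metric.sphere z₀ r)) :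
    Integrable (fun z => ∫ t in (0:ℝ)..(2*π), g (z₀ + rzE t • (z - z₀))) (sphereUnifMeasure n z₀ r) ∧
    2 * π * ∫ z, g z ∂(sphereUnifMeasure n z₀ r) =
      ∫ z, (∫ t in (0:ℝ)..(2*π), g (z₀ + rzE t • (z - z₀))) ∂(sphereUnifMeasure n z₀ r) := by
  have := rz_sphere_finite n z₀ r
  have hpi : (0:ℝ) ≤ 2*π := by positivity
  have hcont : ContinuousOn (fun x : EuclideanSpace ℂ (Fin n) × ℝ => g (z₀ + rzE x.2 • (x.1 - z₀)))
      (Metric.sphere z₀ r ×ˢ Icc 0 (2*π)) := by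
    have hE := rzE_cont
    refine hg.comp (f := fun x : EuclideanSpace ℂ (Fin n) × ℝ => z₀ + rzE x.2 • (x.1 - z₀))
      (Continuous.continuousOn (by fun_prop)) ?_
    rintro ⟨z, t⟩ ⟨hz, -⟩
    simp only [mem_sphere_iff_norm] at hz ⊢
    rw [add_sub_cancel_left, norm_smul, rzE_norm, one_mul, hz]
  have hint : Integrable (Function.uncurry fun (z : EuclideanSpace ℂ (Fin n)) (t : ℝ) =>
      g (z₀ + rzE t • (z - z₀)))
      ((sphereUnifMeasure n z₀ r).prod (volume.restrict (Icc 0 (2*π)))) := by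
    have h := hcont.integrableOn_compact (μ := (sphereUnifMeasure n z₀ r).prod volume)
      ((isCompact_sphere z₀ r).prod isCompact_Icc)
    rw [IntegrableOn, ← Measure.prod_restrict, rz_sphere_restrict] at h
    exact h
  have e : ∀ z, ∫ t in (0:ℝ)..(2*π), g (z₀ + rzE t • (z - z₀)) =
      ∫ t in Icc 0 (2*π), g (z₀ + rzE t • (z - z₀)) := fun z => by
    rw [intervalIntegral.integral_of_le hpi, integral_Icc_eq_integral_Ioc]
  simp only [e]
  refine ⟨hint.integral_prod_left, ?_⟩
  rw [integral_integral_swap hint]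
  simp only [rz_sphere_inv n z₀ r _ (rzE_norm _) g]
  simp [hpi]

theorem riesz_sphere_small_p (n : ℕ) (hn : 1 ≤ n) (Ω : Set (EuclideanSpace ℂ (Fin n)))
    (hΩ : IsOpen Ω) (z₀ : EuclideanSpace ℂ (Fin n)) (hz₀ : z₀ ∈ Ω) (r : ℝ) (hr : 0 < r)
    (hball : Metric.closedBall z₀ r ⊆ Ω) (f : EuclideanSpace ℂ (Fin n) → ℂ)
    (hf : DifferentiableOn ℂ f Ω) (hv : (f z₀).im = 0) (p : ℝ) (hp : 1 < p) (hp2 : p ≤ 2) :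
    ∫ z, ‖f z‖ ^ p ∂(sphereUnifMeasure n z₀ r)
      ≤ (p / (p - 1)) * ∫ z, |(f z).re| ^ p ∂(sphereUnifMeasure n z₀ r) := by
  have cf : ContinuousOn f (Metric.sphere z₀ r) :=
    hf.continuousOn.mono (Metric.sphere_subset_closedBall.trans hball)
  obtain ⟨i1, h1⟩ := rz_slice n z₀ r (fun z => ‖f z‖ ^ p)
    (cf.norm.rpow_const fun _ _ => Or.inr (by linarith))
  obtain ⟨i2, h2⟩ := rz_slice n z₀ r (fun z => |(f z).re| ^ p)
    ((Complex.continuous_re.comp_continuousOn cf).abs.rpow_const fun _ _ => Or.inr (by linarith))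
  have hpi : (0:ℝ) < 2*π := by positivity
  refine le_of_mul_le_mul_left ?_ hpi
  rw [mul_left_comm, h1, h2, ← integral_const_mul]
  refine integral_mono_ae i1 (i2.const_mul _) ?_
  have hae : ∀ᵐ z ∂(sphereUnifMeasure n z₀ r), z ∈ Metric.sphere z₀ r := by
    rw [← rz_sphere_restrict]
    exact ae_restrict_mem Metric.isClosed_sphere.measurableSet
  filter_upwards [hae] with z hz
  have hL : Differentiable ℂ (fun c : ℂ => z₀ + c • (z - z₀)) := by fun_prop
  refine rz_disc (F := fun c => f (z₀ + c • (z - z₀))) (U := (fun c : ℂ => z₀ + c • (z - z₀)) ⁻¹' Ω)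
    (hΩ.preimage hL.continuous) ?_ (hf.comp hL.differentiableOn fun c hc => hc) (by simpa using hv) hp hp2
  intro c hc
  apply hball
  rw [mem_sphere_iff_norm] at hz
  rw [mem_closedBall_zero_iff] at hc
  rw [mem_closedBall_iff_norm, add_sub_cancel_left, norm_smul, hz]
  nlinarith
end

section
/- Let Ω be an open subset of ℂⁿ, let z₀ ∈ Ω and r > 0 be such that the closed ball {z : |z − z₀| ≤ r} is contained in Ω, let f = u + iv be holomorphic on Ω with v(z₀) = 0, and let 1 < p ≤ 2 and τ > 0. Then ∫_{S(z₀,r)} (|f|² + τ)^{p/2} dσ_{z₀,r} ≤ (p/(p−1)) · ∫_{S(z₀,r)} (u² + τ)^{p/2} dσ_{z₀,r}. -/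
open Real MeasureTheory Set

namespace RieszAux

noncomputable def Ph (C q τ : ℝ) (w : ℂ) : ℝ :=
  C * (w.re ^ 2 + τ) ^ q - (w.re ^ 2 + w.im ^ 2 + τ) ^ q

noncomputable def D1 (C q τ : ℝ) (w h : ℂ) : ℝ :=
  C * (2 * w.re * h.re * q * (w.re ^ 2 + τ) ^ (q - 1)) -
    (2 * w.re * h.re + 2 * w.im * h.im) * q * (w.re ^ 2 + w.im ^ 2 + τ) ^ (q - 1)

noncomputable def D2 (C q τ : ℝ) (w h k : ℂ) : ℝ :=
  C * ((2 * h.re * h.re + 2 * w.re * k.re) * q * (w.re ^ 2 + τ) ^ (q - 1) +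
      2 * w.re * h.re * q * (2 * w.re * h.re * (q - 1) * (w.re ^ 2 + τ) ^ (q - 1 - 1))) -
    ((2 * h.re * h.re + 2 * w.re * k.re + (2 * h.im * h.im + 2 * w.im * k.im)) * q *
        (w.re ^ 2 + w.im ^ 2 + τ) ^ (q - 1) +
      (2 * w.re * h.re + 2 * w.im * h.im) * q *
        ((2 * w.re * h.re + 2 * w.im * h.im) * (q - 1) *
          (w.re ^ 2 + w.im ^ 2 + τ) ^ (q - 1 - 1)))

lemma hasDerivAt_re {γ : ℝ → ℂ} {h : ℂ} {t : ℝ} (hγ : HasDerivAt γ h t) :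
    HasDerivAt (fun s => (γ s).re) h.re t :=
  (Complex.reCLM.hasFDerivAt (x := γ t)).comp_hasDerivAt t hγ

lemma hasDerivAt_im {γ : ℝ → ℂ} {h : ℂ} {t : ℝ} (hγ : HasDerivAt γ h t) :
    HasDerivAt (fun s => (γ s).im) h.im t :=
  (Complex.imCLM.hasFDerivAt (x := γ t)).comp_hasDerivAt t hγ

lemma hasDerivAt_pow1 {γ : ℝ → ℂ} {h : ℂ} {t τ : ℝ} (hτ : 0 < τ) (q : ℝ)
    (hγ : HasDerivAt γ h t) :
    HasDerivAt (fun s => ((γ s).re ^ 2 + τ) ^ q)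
      (2 * (γ t).re * h.re * q * ((γ t).re ^ 2 + τ) ^ (q - 1)) t := by
  have h1 : HasDerivAt (fun s => (γ s).re ^ 2 + τ) (2 * (γ t).re * h.re) t := by
    simpa using ((hasDerivAt_re hγ).pow 2).add_const τ
  exact h1.rpow_const (Or.inl (by positivity))

lemma hasDerivAt_pow2 {γ : ℝ → ℂ} {h : ℂ} {t τ : ℝ} (hτ : 0 < τ) (q : ℝ)
    (hγ : HasDerivAt γ h t) :
    HasDerivAt (fun s => ((γ s).re ^ 2 + (γ s).im ^ 2 + τ) ^ q)
      ((2 * (γ t).re * h.re + 2 * (γ t).im * h.im) * q *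
        ((γ t).re ^ 2 + (γ t).im ^ 2 + τ) ^ (q - 1)) t := by
  have h1 : HasDerivAt (fun s => (γ s).re ^ 2 + (γ s).im ^ 2 + τ)
      (2 * (γ t).re * h.re + 2 * (γ t).im * h.im) t := by
    simpa using (((hasDerivAt_re hγ).pow 2).add ((hasDerivAt_im hγ).pow 2)).add_const τ
  exact h1.rpow_const (Or.inl (by positivity))

lemma hasDerivAt_Ph {γ : ℝ → ℂ} {h : ℂ} {t τ : ℝ} (hτ : 0 < τ) (C q : ℝ)
    (hγ : HasDerivAt γ h t) :
    HasDerivAt (fun s => Ph C q τ (γ s)) (D1 C q τ (γ t) h) t :=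
  ((hasDerivAt_pow1 hτ q hγ).const_mul C).sub (hasDerivAt_pow2 hτ q hγ)

lemma hasDerivAt_D1 {γ γ1 : ℝ → ℂ} {k : ℂ} {t τ : ℝ} (hτ : 0 < τ) (C q : ℝ)
    (hγ : HasDerivAt γ (γ1 t) t) (hγ1 : HasDerivAt γ1 k t) :
    HasDerivAt (fun s => D1 C q τ (γ s) (γ1 s)) (D2 C q τ (γ t) (γ1 t) k) t := by
  have a := hasDerivAt_re hγ
  have b := hasDerivAt_im hγ
  have a1 := hasDerivAt_re hγ1
  have b1 := hasDerivAt_im hγ1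
  have e1 : HasDerivAt (fun s => 2 * (γ s).re * (γ1 s).re)
      (2 * (γ1 t).re * (γ1 t).re + 2 * (γ t).re * k.re) t := (a.const_mul 2).mul a1
  have e2 : HasDerivAt (fun s => 2 * (γ s).im * (γ1 s).im)
      (2 * (γ1 t).im * (γ1 t).im + 2 * (γ t).im * k.im) t := (b.const_mul 2).mul b1
  exact (((e1.mul_const q).mul (hasDerivAt_pow1 hτ (q - 1) hγ)).const_mul C).sub
    (((e1.add e2).mul_const q).mul (hasDerivAt_pow2 hτ (q - 1) hγ))

lemma continuous_pow1 {τ : ℝ} (hτ : 0 < τ) (q : ℝ) :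
    Continuous (fun w : ℂ => (w.re ^ 2 + τ) ^ q) := by
  refine Continuous.rpow_const (by fun_prop) (fun w => Or.inl (by positivity))

lemma continuous_pow2 {τ : ℝ} (hτ : 0 < τ) (q : ℝ) :
    Continuous (fun w : ℂ => (w.re ^ 2 + w.im ^ 2 + τ) ^ q) := by
  refine Continuous.rpow_const (by fun_prop) (fun w => Or.inl (by positivity))

lemma continuous_Ph {τ : ℝ} (hτ : 0 < τ) (C q : ℝ) : Continuous (Ph C q τ) := by
  have h1 := continuous_pow1 hτ q
  have h2 := continuous_pow2 hτ q
  unfold Ph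
  fun_prop

lemma continuous_D1 {τ : ℝ} (hτ : 0 < τ) (C q : ℝ) :
    Continuous (fun x : ℂ × ℂ => D1 C q τ x.1 x.2) := by
  have h1 := (continuous_pow1 hτ (q-1)).comp (continuous_fst (X := ℂ) (Y := ℂ))
  have h2 := (continuous_pow2 hτ (q-1)).comp (continuous_fst (X := ℂ) (Y := ℂ))
  simp only [Function.comp_def] at h1 h2
  unfold D1
  fun_prop

lemma continuous_D2 {τ : ℝ} (hτ : 0 < τ) (C q : ℝ) :
    Continuous (fun x : ℂ × ℂ × ℂ => D2 C q τ x.1 x.2.1 x.2.2) := by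
  have h1 := (continuous_pow1 hτ (q-1)).comp (continuous_fst (X := ℂ) (Y := ℂ × ℂ))
  have h2 := (continuous_pow2 hτ (q-1)).comp (continuous_fst (X := ℂ) (Y := ℂ × ℂ))
  have h3 := (continuous_pow1 hτ (q-1-1)).comp (continuous_fst (X := ℂ) (Y := ℂ × ℂ))
  have h4 := (continuous_pow2 hτ (q-1-1)).comp (continuous_fst (X := ℂ) (Y := ℂ × ℂ))
  simp only [Function.comp_def] at h1 h2 h3 h4
  unfold D2
  fun_prop

/-- the Laplacian is nonnegative -/
lemma lap_nonneg {p τ : ℝ} (hp : 1 < p) (hp2 : p ≤ 2) (hτ : 0 < τ) (w h k : ℂ) :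
    0 ≤ D2 (p / (p - 1)) (p / 2) τ w h k +
      D2 (p / (p - 1)) (p / 2) τ w (Complex.I * h) (-k) := by
  obtain ⟨a, b⟩ := w
  obtain ⟨x, y⟩ := h
  obtain ⟨X, Y⟩ := k
  simp only [D2, Complex.mul_re, Complex.mul_im, Complex.I_re, Complex.I_im, Complex.neg_re,
    Complex.neg_im]
  have hA : 0 < a ^ 2 + τ := by positivity
  have hS : 0 < a ^ 2 + b ^ 2 + τ := by positivity
  have hAS : a ^ 2 + τ ≤ a ^ 2 + b ^ 2 + τ := by nlinarith [sq_nonneg b]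
  rw [Real.rpow_sub_one hA.ne' (p / 2 - 1), Real.rpow_sub_one hS.ne' (p / 2 - 1)]
  have hpow : (a ^ 2 + b ^ 2 + τ) ^ (p / 2 - 1) ≤ (a ^ 2 + τ) ^ (p / 2 - 1) :=
    Real.rpow_le_rpow_of_nonpos hA hAS (by linarith)
  have hPA : 0 < (a ^ 2 + τ) ^ (p / 2 - 1) := Real.rpow_pos_of_pos hA _
  have hPS : 0 < (a ^ 2 + b ^ 2 + τ) ^ (p / 2 - 1) := Real.rpow_pos_of_pos hS _
  generalize (a ^ 2 + b ^ 2 + τ) ^ (p / 2 - 1) = U at *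
  generalize (a ^ 2 + τ) ^ (p / 2 - 1) = V at *
  have hp1 : 0 < p - 1 := by linarith
  have key : (p * (a ^ 2 + b ^ 2) + 2 * τ) / (a ^ 2 + b ^ 2 + τ) ≤
      (p * a ^ 2 + p / (p - 1) * τ) / (a ^ 2 + τ) := by
    have h2 : 2 ≤ p / (p - 1) := by rw [le_div_iff₀ hp1]; linarith
    rw [div_le_div_iff₀ hS hA]
    have : 0 ≤ τ * (a ^ 2 + b ^ 2) * (p / (p - 1) - 2) + τ * b ^ 2 * (2 - p) +
      τ ^ 2 * (p / (p - 1) - 2) := by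
      have := sub_nonneg.2 h2
      have := sub_nonneg.2 hp2
      positivity
    nlinarith
  have hkey : 0 ≤ (p * (a ^ 2 + b ^ 2) + 2 * τ) / (a ^ 2 + b ^ 2 + τ) := by positivity
  have fin : 0 ≤ p * (x ^ 2 + y ^ 2) *
      (V * ((p * a ^ 2 + p / (p - 1) * τ) / (a ^ 2 + τ)) -
        U * ((p * (a ^ 2 + b ^ 2) + 2 * τ) / (a ^ 2 + b ^ 2 + τ))) := by
    have := sub_nonneg.2 (mul_le_mul hpow key hkey hPA.le)
    positivity
  convert fin using 1
  field_simp
  ring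

end RieszAux

namespace RieszAux

open Filter Topology

lemma cont_slice {L : ℝ} {φ : ℝ → ℝ → ℝ}
    (hφ : ContinuousOn (fun x : ℝ × ℝ => φ x.1 x.2) (Iio L ×ˢ univ)) {t : ℝ} (ht : t < L) :
    Continuous (φ t) := by
  rw [← continuousOn_univ]
  exact hφ.comp (f := fun θ : ℝ => (t, θ)) (by fun_prop) (fun θ _ => ⟨ht, trivial⟩)

lemma diff_under {L : ℝ} {φ φ' : ℝ → ℝ → ℝ}
    (hφ : ContinuousOn (fun x : ℝ × ℝ => φ x.1 x.2) (Iio L ×ˢ univ))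
    (hφ' : ContinuousOn (fun x : ℝ × ℝ => φ' x.1 x.2) (Iio L ×ˢ univ))
    (hd : ∀ t < L, ∀ θ, HasDerivAt (fun s => φ s θ) (φ' t θ) t) {t : ℝ} (ht : t < L) :
    HasDerivAt (fun s => ∫ θ in (0 : ℝ)..(2 * π), φ s θ)
      (∫ θ in (0 : ℝ)..(2 * π), φ' t θ) t := by
  obtain ⟨b, htb, hbL⟩ := exists_between ht
  have hK : IsCompact (Icc (t - 1) b ×ˢ uIcc (0 : ℝ) (2 * π)) := isCompact_Icc.prod isCompact_uIcc
  obtain ⟨B, hB⟩ := hK.exists_bound_of_continuousOn (hφ'.mono (fun x hx =>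
    (⟨lt_of_le_of_lt hx.1.2 hbL, trivial⟩ : x ∈ Iio L ×ˢ univ)))
  refine (intervalIntegral.hasDerivAt_integral_of_dominated_loc_of_deriv_le
    (bound := fun _ => B) (s := Icc (t - 1) b) (F' := φ')
    (Icc_mem_nhds (by linarith) htb) ?_ ?_ ?_ ?_ ?_ ?_).2
  · filter_upwards [Iio_mem_nhds ht] with s hs
    exact (cont_slice hφ hs).aestronglyMeasurable
  · exact (cont_slice hφ ht).intervalIntegrable _ _
  · exact (cont_slice hφ' ht).aestronglyMeasurable
  · refine Eventually.of_forall (fun θ hθ s hs => hB (s, θ) ⟨hs, uIoc_subset_uIcc hθ⟩)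
  · exact intervalIntegrable_const
  · exact Eventually.of_forall (fun θ _ s hs => hd s (lt_of_le_of_lt hs.2 hbL) θ)

/-- a function with nondecreasing derivative, bounded above at `-∞`, is nondecreasing -/
lemma mono_of_convex {L : ℝ} {M M1 M2 : ℝ → ℝ} (h1 : ∀ t < L, HasDerivAt M (M1 t) t)
    (h2 : ∀ t < L, HasDerivAt M1 (M2 t) t) (h3 : ∀ t < L, 0 ≤ M2 t)
    {B : ℝ} (hL : 0 < L) (hB : ∀ t ≤ 0, M t ≤ B) {s : ℝ} (hs : s ≤ 0) : M s ≤ M 0 := by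
  have hmono1 : MonotoneOn M1 (Iio L) := by
    refine monotoneOn_of_hasDerivWithinAt_nonneg (f' := M2) (convex_Iio L)
      (fun t ht => (h2 t ht).continuousAt.continuousWithinAt) ?_ ?_
    · intro t ht
      rw [interior_Iio] at ht
      exact (h2 t ht).hasDerivWithinAt
    · intro t ht
      rw [interior_Iio] at ht
      exact h3 t ht
  have hpos : ∀ t ≤ 0, 0 ≤ M1 t := by
    intro t0 ht0
    by_contra! hneg
    -- for `t < t0`, `M t ≥ M t0 + (t0 - t) * (-M1 t0)`
    have hlow : ∀ t < t0, M t0 + (t0 - t) * (-M1 t0) ≤ M t := by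
      intro t ht
      obtain ⟨c, hc, hc'⟩ := exists_hasDerivAt_eq_slope M M1 ht
        (fun x hx => (h1 x (by linarith [hx.2])).continuousAt.continuousWithinAt)
        (fun x hx => h1 x (by linarith [hx.2]))
      have hle : M1 c ≤ M1 t0 := hmono1 (show c < L by linarith [hc.2])
        (show t0 < L by linarith) hc.2.le
      rw [hc', div_le_iff₀ (by linarith)] at hle
      nlinarith
    have hd : 0 < (|B| + |M t0| + 1) / (-M1 t0) := by
      have : 0 < -M1 t0 := by linarith
      positivity
    have := hlow (t0 - (|B| + |M t0| + 1) / (-M1 t0)) (by linarith)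
    have hb := hB (t0 - (|B| + |M t0| + 1) / (-M1 t0)) (by linarith)
    have e : (t0 - (t0 - (|B| + |M t0| + 1) / (-M1 t0))) * (-M1 t0) = |B| + |M t0| + 1 := by
      have : M1 t0 ≠ 0 := hneg.ne
      field_simp
      ring
    rw [e] at this
    linarith [neg_abs_le (M t0), le_abs_self B]
  have hmono : MonotoneOn M (Iic 0) := by
    refine monotoneOn_of_hasDerivWithinAt_nonneg (f' := M1) (convex_Iic 0)
      (fun t ht => (h1 t (lt_of_le_of_lt ht hL)).continuousAt.continuousWithinAt) ?_ ?_
    · intro t ht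
      rw [interior_Iic] at ht
      exact (h1 t (lt_trans ht hL)).hasDerivWithinAt
    · intro t ht
      rw [interior_Iic] at ht
      exact hpos t (le_of_lt ht)
  exact hmono hs (mem_Iic.2 (le_refl 0)) hs

/-- parametrization of the half plane -/
noncomputable def ell (x : ℝ × ℝ) : ℂ := (x.1 : ℂ) + x.2 * Complex.I

lemma continuous_ell : Continuous ell := by
  unfold ell; fun_prop

lemma contOn_D1 {X : Type*} [TopologicalSpace X] {s : Set X} {f g : X → ℂ} {τ : ℝ} (hτ : 0 < τ)
    (C q : ℝ) (hf : ContinuousOn f s) (hg : ContinuousOn g s) :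
    ContinuousOn (fun x => D1 C q τ (f x) (g x)) s :=
  (continuous_D1 hτ C q).comp_continuousOn (f := fun x => (f x, g x)) (hf.prodMk hg)

lemma contOn_D2 {X : Type*} [TopologicalSpace X] {s : Set X} {f g h : X → ℂ} {τ : ℝ} (hτ : 0 < τ)
    (C q : ℝ) (hf : ContinuousOn f s) (hg : ContinuousOn g s) (hh : ContinuousOn h s) :
    ContinuousOn (fun x => D2 C q τ (f x) (g x) (h x)) s :=
  (continuous_D2 hτ C q).comp_continuousOn (f := fun x => (f x, g x, h x))
    (hf.prodMk (hg.prodMk hh))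

lemma hor (θ t : ℝ) : HasDerivAt (fun s : ℝ => ell (s, θ)) 1 t := by
  simpa [ell] using (Complex.ofRealCLM.hasDerivAt (x := t)).add_const ((θ : ℂ) * Complex.I)

lemma ver (θ t : ℝ) : HasDerivAt (fun s : ℝ => ell (t, s)) Complex.I θ := by
  simpa [ell] using
    ((Complex.ofRealCLM.hasDerivAt (x := θ)).mul_const Complex.I).const_add (t : ℂ)

lemma horH {G : ℂ → ℂ} {S : Set ℂ} (hSo : IsOpen S) (dG : DifferentiableOn ℂ G S) {t θ : ℝ}
    (h : ell (t, θ) ∈ S) :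
    HasDerivAt (fun s : ℝ => G (ell (s, θ))) (deriv G (ell (t, θ))) t := by
  have := ((dG.differentiableAt (hSo.mem_nhds h)).hasDerivAt).comp t (hor θ t)
  rw [mul_one] at this
  exact this

lemma verH {G : ℂ → ℂ} {S : Set ℂ} (hSo : IsOpen S) (dG : DifferentiableOn ℂ G S) {t θ : ℝ}
    (h : ell (t, θ) ∈ S) :
    HasDerivAt (fun s : ℝ => G (ell (t, s))) (Complex.I * deriv G (ell (t, θ))) θ := by
  have := ((dG.differentiableAt (hSo.mem_nhds h)).hasDerivAt).comp θ (ver θ t)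
  rw [mul_comm]
  exact this

lemma strip {L : ℝ} (hL : 0 < L) {H : ℂ → ℂ} (dH : DifferentiableOn ℂ H {w | w.re < L})
    (per : ∀ w, H (w + 2 * π * Complex.I) = H w) {C q τ : ℝ} (hτ : 0 < τ)
    (hlap : ∀ w h k : ℂ, 0 ≤ D2 C q τ w h k + D2 C q τ w (Complex.I * h) (-k))
    {B : ℝ} (hMB : ∀ t ≤ 0, ∫ θ in (0 : ℝ)..(2 * π), Ph C q τ (H (ell (t, θ))) ≤ B)
    {s : ℝ} (hs : s ≤ 0) :
    ∫ θ in (0 : ℝ)..(2 * π), Ph C q τ (H (ell (s, θ))) ≤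
      ∫ θ in (0 : ℝ)..(2 * π), Ph C q τ (H (ell (0, θ))) := by
  obtain ⟨S, hS⟩ : ∃ S : Set ℂ, S = {w | w.re < L} := ⟨_, rfl⟩
  rw [← hS] at dH
  have hSo : IsOpen S := hS ▸ isOpen_lt Complex.continuous_re continuous_const
  have dH1 : DifferentiableOn ℂ (deriv H) S := dH.deriv hSo
  have dH2 : DifferentiableOn ℂ (deriv (deriv H)) S := dH1.deriv hSo
  have per1 : ∀ w, deriv H (w + 2 * π * Complex.I) = deriv H w := by
    intro w
    rw [← deriv_comp_add_const]
    congr 1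
    funext x; exact per x
  have cell : ContinuousOn ell (Iio L ×ˢ univ) := continuous_ell.continuousOn
  have mem : ∀ t < L, ∀ θ : ℝ, ell (t, θ) ∈ S := by
    intro t ht θ; simpa [hS, ell] using ht
  have mell : MapsTo ell (Iio L ×ˢ univ) S := fun x hx => mem x.1 hx.1 x.2
  have cH : ContinuousOn (fun x => H (ell x)) (Iio L ×ˢ univ) := dH.continuousOn.comp cell mell
  have cH1 : ContinuousOn (fun x => deriv H (ell x)) (Iio L ×ˢ univ) := dH1.continuousOn.comp cell mell
  have cH2 : ContinuousOn (fun x => deriv (deriv H) (ell x)) (Iio L ×ˢ univ) :=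
    dH2.continuousOn.comp cell mell
  have cφ : ContinuousOn (fun x : ℝ × ℝ => Ph C q τ (H (ell x))) (Iio L ×ˢ univ) :=
    (continuous_Ph hτ C q).comp_continuousOn cH
  have cφ1 : ContinuousOn (fun x : ℝ × ℝ => D1 C q τ (H (ell x)) (deriv H (ell x)))
      (Iio L ×ˢ univ) :=
    contOn_D1 hτ C q cH cH1
  have cφ2 : ContinuousOn (fun x : ℝ × ℝ => D2 C q τ (H (ell x)) (deriv H (ell x))
      (deriv (deriv H) (ell x))) (Iio L ×ˢ univ) :=
    contOn_D2 hτ C q cH cH1 cH2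
  have cψ2 : ContinuousOn (fun x : ℝ × ℝ => D2 C q τ (H (ell x)) (Complex.I * deriv H (ell x))
      (-deriv (deriv H) (ell x))) (Iio L ×ˢ univ) :=
    contOn_D2 hτ C q cH (continuousOn_const.mul cH1) cH2.neg
  have hM1 := fun t (ht : t < L) => diff_under (φ := fun t θ => Ph C q τ (H (ell (t, θ))))
    (φ' := fun t θ => D1 C q τ (H (ell (t, θ))) (deriv H (ell (t, θ)))) cφ cφ1
    (fun t ht θ => hasDerivAt_Ph hτ C q (horH hSo dH (mem t ht θ))) ht
  have hM2 := fun t (ht : t < L) => diff_under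
    (φ := fun t θ => D1 C q τ (H (ell (t, θ))) (deriv H (ell (t, θ))))
    (φ' := fun t θ => D2 C q τ (H (ell (t, θ))) (deriv H (ell (t, θ))) (deriv (deriv H) (ell (t, θ))))
    cφ1 cφ2
    (fun t ht θ => hasDerivAt_D1 (γ := fun s : ℝ => H (ell (s, θ)))
      (γ1 := fun s : ℝ => deriv H (ell (s, θ))) hτ C q (horH hSo dH (mem t ht θ)) (horH hSo dH1 (mem t ht θ))) ht
  have hM3 : ∀ t < L, 0 ≤ ∫ θ in (0 : ℝ)..(2 * π),
      D2 C q τ (H (ell (t, θ))) (deriv H (ell (t, θ))) (deriv (deriv H) (ell (t, θ))) := by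
    intro t ht
    have i1 : IntervalIntegrable (fun θ => D2 C q τ (H (ell (t, θ))) (deriv H (ell (t, θ)))
        (deriv (deriv H) (ell (t, θ)))) volume 0 (2 * π) :=
      (cont_slice (φ := fun t θ => D2 C q τ (H (ell (t, θ))) (deriv H (ell (t, θ)))
        (deriv (deriv H) (ell (t, θ)))) cφ2 ht).intervalIntegrable _ _
    have i2 : IntervalIntegrable (fun θ => D2 C q τ (H (ell (t, θ))) (Complex.I * deriv H (ell (t, θ)))
        (-deriv (deriv H) (ell (t, θ)))) volume 0 (2 * π) :=
      (cont_slice (φ := fun t θ => D2 C q τ (H (ell (t, θ))) (Complex.I * deriv H (ell (t, θ)))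
        (-deriv (deriv H) (ell (t, θ)))) cψ2 ht).intervalIntegrable _ _
    have z : ∫ θ in (0 : ℝ)..(2 * π), D2 C q τ (H (ell (t, θ))) (Complex.I * deriv H (ell (t, θ)))
        (-deriv (deriv H) (ell (t, θ))) = 0 := by
      rw [intervalIntegral.integral_eq_sub_of_hasDerivAt
        (f := fun θ => D1 C q τ (H (ell (t, θ))) (Complex.I * deriv H (ell (t, θ)))) _ i2]
      · have e : ell (t, 2 * π) = ell (t, 0) + 2 * π * Complex.I := by simp [ell]
        rw [e, per, per1, sub_self]
      · intro θ _
        have hk : HasDerivAt (fun s : ℝ => Complex.I * deriv H (ell (t, s)))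
            (-deriv (deriv H) (ell (t, θ))) θ := by
          have := (verH hSo dH1 (mem t ht θ)).const_mul Complex.I
          rw [← mul_assoc, Complex.I_mul_I, neg_one_mul] at this
          exact this
        exact hasDerivAt_D1 (γ := fun s : ℝ => H (ell (t, s)))
          (γ1 := fun s : ℝ => Complex.I * deriv H (ell (t, s))) hτ C q (verH hSo dH (mem t ht θ)) hk
    have hadd := intervalIntegral.integral_add i1 i2
    rw [z, add_zero] at hadd
    rw [← hadd]
    exact intervalIntegral.integral_nonneg (by positivity)
      (fun θ _ => hlap _ _ _)
  exact mono_of_convex hM1 hM2 hM3 hL hMB hs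

set_option maxHeartbeats 2000000 in
/-- the one-variable inequality on the unit circle -/
lemma disc {R : ℝ} (hR : 1 < R) {F : ℂ → ℂ} (hF : DifferentiableOn ℂ F (Metric.ball 0 R))
    (h0 : (F 0).im = 0) {p τ : ℝ} (hp : 1 < p) (hp2 : p ≤ 2) (hτ : 0 < τ) :
    0 ≤ ∫ θ in (0 : ℝ)..(2 * π),
      Ph (p / (p - 1)) (p / 2) τ (F (Complex.exp (θ * Complex.I))) := by
  obtain ⟨C, hC⟩ : ∃ C, C = p / (p - 1) := ⟨_, rfl⟩
  obtain ⟨q, hq⟩ : ∃ q, q = p / 2 := ⟨_, rfl⟩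
  obtain ⟨L, hLdef⟩ : ∃ L, L = Real.log R := ⟨_, rfl⟩
  rw [← hC, ← hq]
  have hL : 0 < L := hLdef ▸ Real.log_pos hR
  obtain ⟨H, hH⟩ : ∃ H : ℂ → ℂ, H = fun w => F (Complex.exp w) := ⟨_, rfl⟩
  have hexp : MapsTo Complex.exp {w | w.re < L} (Metric.ball 0 R) := by
    intro w hw
    rw [mem_ball_zero_iff, Complex.norm_exp]
    rw [mem_ofPred_eq, hLdef] at hw
    exact (Real.lt_log_iff_exp_lt (by linarith)).1 hw
  have dH : DifferentiableOn ℂ H {w | w.re < L} := hH ▸ hF.comp Complex.differentiable_exp.differentiableOn hexp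
  have per : ∀ w, H (w + 2 * π * Complex.I) = H w := by
    intro w; simp only [hH, Complex.exp_periodic w]
  -- boundedness
  have cP : ContinuousOn (fun z => Ph C q τ (F z)) (Metric.ball 0 R) :=
    (continuous_Ph hτ C q).comp_continuousOn hF.continuousOn
  obtain ⟨B, hB⟩ := (isCompact_closedBall (0 : ℂ) 1).exists_bound_of_continuousOn
    (cP.mono (Metric.closedBall_subset_ball hR))
  have nrm : ∀ t θ : ℝ, ‖Complex.exp (ell (t, θ))‖ = Real.exp t := by
    intro t θ; simp [ell, Complex.norm_exp]
  have iφ : ∀ t < L, IntervalIntegrable (fun θ => Ph C q τ (H (ell (t, θ)))) volume 0 (2 * π) := by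
    intro t ht
    refine Continuous.intervalIntegrable ?_ _ _
    refine (continuous_Ph hτ C q).comp (dH.continuousOn.comp_continuous
      (continuous_ell.comp (Continuous.prodMk_right t)) (fun θ => ?_))
    simpa [ell] using ht
  have hPB : ∀ t ≤ 0, ∀ θ : ℝ, Ph C q τ (H (ell (t, θ))) ≤ B := by
    intro t ht θ
    have h1 := hB (Complex.exp (ell (t, θ))) (by
      rw [mem_closedBall_zero_iff, nrm]; exact Real.exp_le_one_iff.2 ht)
    rw [hH]
    exact (le_abs_self _).trans h1
  have hMB : ∀ t ≤ 0, ∫ θ in (0 : ℝ)..(2 * π), Ph C q τ (H (ell (t, θ))) ≤ 2 * π * B := by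
    intro t ht
    have := intervalIntegral.integral_mono (by positivity) (iφ t (by linarith))
      (intervalIntegrable_const (c := B)) (fun θ => hPB t ht θ)
    simpa using this
  have hlap : ∀ w h k : ℂ, 0 ≤ D2 C q τ w h k + D2 C q τ w (Complex.I * h) (-k) := by
    rw [hC, hq]; exact lap_nonneg hp hp2 hτ
  have hmono := fun s (hs : s ≤ 0) => strip hL dH per hτ hlap hMB hs
  -- value at the centre
  have hP0 : 0 ≤ Ph C q τ (F 0) := by
    have h1 : 1 ≤ C := by rw [hC, le_div_iff₀ (by linarith)]; linarith
    have h2 : 0 ≤ ((F 0).re ^ 2 + τ) ^ q := by positivity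
    simp only [Ph, h0]
    norm_num
    nlinarith
  have hM0 : ∫ θ in (0 : ℝ)..(2 * π), Ph C q τ (H (ell (0, θ))) = ∫ θ in (0 : ℝ)..(2 * π), Ph C q τ (F (Complex.exp (θ * Complex.I))) := by
    simp [hH, ell]
  rw [← hM0]
  refine le_of_forall_pos_le_add (fun ε hε => ?_)
  have hca : ContinuousAt (fun z => Ph C q τ (F z)) 0 :=
    cP.continuousAt (Metric.ball_mem_nhds _ (by linarith))
  have hε' : 0 < ε / (2 * π) := by positivity
  obtain ⟨δ, hδ, hδ'⟩ := Metric.continuousAt_iff.1 hca _ hε'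
  obtain ⟨s, hs⟩ : ∃ s, s = min (Real.log (δ / 2)) 0 := ⟨_, rfl⟩
  have hs0 : s ≤ 0 := hs ▸ min_le_right _ _
  have hsδ : Real.exp s < δ := by
    calc Real.exp s ≤ Real.exp (Real.log (δ / 2)) := Real.exp_le_exp.2 (hs ▸ min_le_left _ _)
      _ = δ / 2 := Real.exp_log (by positivity)
      _ < δ := by linarith
  have hlow : -ε ≤ ∫ θ in (0 : ℝ)..(2 * π), Ph C q τ (H (ell (s, θ))) := by
    have := intervalIntegral.integral_mono (by positivity : (0 : ℝ) ≤ 2 * π)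
      (intervalIntegrable_const (c := -(ε / (2 * π)))) (iφ s (by linarith)) (fun θ => by
        have := hδ' (x := Complex.exp (ell (s, θ))) (by rw [dist_zero_right, nrm]; exact hsδ)
        rw [Real.dist_eq, abs_lt] at this
        rw [hH]
        show -(ε / (2 * π)) ≤ Ph C q τ (F (Complex.exp (ell (s, θ))))
        linarith [this.1])
    rw [intervalIntegral.integral_const, smul_eq_mul] at this
    have e : (2 * π - 0) * -(ε / (2 * π)) = -ε := by field_simp; ring
    rw [e] at this
    exact this
  linarith [hmono s hs0]

end RieszAux

namespace RieszAux

/-- rotation about `z₀` by the unimodular number `c` -/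
noncomputable def rot {E : Type*} [NormedAddCommGroup E] [NormedSpace ℂ E] (z₀ : E) (c : ℂ)
    (hc : ‖c‖ = 1) : E ≃ᵢ E where
  toFun z := z₀ + c • (z - z₀)
  invFun z := z₀ + c⁻¹ • (z - z₀)
  left_inv z := by
    have : c ≠ 0 := by rintro rfl; simp at hc
    simp [smul_smul, this]
  right_inv z := by
    have : c ≠ 0 := by rintro rfl; simp at hc
    simp [smul_smul, this]
  isometry_toFun := by
    refine Isometry.of_dist_eq (fun x y => ?_)
    simp [dist_eq_norm, ← smul_sub, norm_smul, hc]

lemma mp_rot (n : ℕ) (z₀ : EuclideanSpace ℂ (Fin n)) (r : ℝ) (c : ℂ) (hc : ‖c‖ = 1) :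
    MeasurePreserving (rot z₀ c hc) (sphereUnifMeasure n z₀ r) (sphereUnifMeasure n z₀ r) := by
  have h := (rot z₀ c hc).measurePreserving_hausdorffMeasure (2 * (n : ℝ) - 1)
  have hs : (rot z₀ c hc) ⁻¹' (Metric.sphere z₀ r) = Metric.sphere z₀ r := by
    ext z
    simp [rot, norm_smul, hc]
  have h2 := h.restrict_preimage (s := Metric.sphere z₀ r) Metric.isClosed_sphere.measurableSet
  rw [hs] at h2
  exact h2.smul_measure _

lemma sphere_finite (n : ℕ) (z₀ : EuclideanSpace ℂ (Fin n)) (r : ℝ) :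
    IsFiniteMeasure (sphereUnifMeasure n z₀ r) := by
  refine ⟨?_⟩
  simp only [sphereUnifMeasure, Measure.smul_apply, Measure.restrict_apply_univ, smul_eq_mul]
  exact lt_of_le_of_lt (ENNReal.inv_mul_le_one _) ENNReal.one_lt_top

lemma ae_sphere (n : ℕ) (z₀ : EuclideanSpace ℂ (Fin n)) (r : ℝ) :
    ∀ᵐ z ∂(sphereUnifMeasure n z₀ r), z ∈ Metric.sphere z₀ r :=
  Measure.ae_smul_measure (ae_restrict_mem Metric.isClosed_sphere.measurableSet) _

lemma sphere_nonneg (n : ℕ) (z₀ : EuclideanSpace ℂ (Fin n)) (r : ℝ)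
    (G : EuclideanSpace ℂ (Fin n) → ℝ) (hG : ContinuousOn G (Metric.sphere z₀ r))
    (hpos : ∀ z ∈ Metric.sphere z₀ r, 0 ≤ ∫ θ in (0 : ℝ)..(2 * π),
      G (z₀ + Complex.exp (θ * Complex.I) • (z - z₀))) :
    0 ≤ ∫ z, G z ∂(sphereUnifMeasure n z₀ r) := by
  have := sphere_finite n z₀ r
  set μ := sphereUnifMeasure n z₀ r with hμ
  have hSm : MeasurableSet (Metric.sphere z₀ r) := Metric.isClosed_sphere.measurableSet
  set K := (Metric.sphere z₀ r).indicator G with hK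
  have hKm : Measurable K := by
    classical
    rw [hK, ← piecewise_eq_indicator]
    exact hG.measurable_piecewise continuousOn_const hSm
  obtain ⟨B, hB⟩ := (isCompact_sphere z₀ r).exists_bound_of_continuousOn hG
  have hKB : ∀ z, ‖K z‖ ≤ |B| := by
    intro z
    by_cases hz : z ∈ Metric.sphere z₀ r
    · rw [hK, indicator_of_mem hz]; exact (hB z hz).trans (le_abs_self B)
    · rw [hK, indicator_of_notMem hz]; simp
  have nrm : ∀ θ : ℝ, ‖Complex.exp (θ * Complex.I)‖ = 1 := Complex.norm_exp_ofReal_mul_I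
  have hrot : ∀ θ : ℝ, ∫ z, K (z₀ + Complex.exp (θ * Complex.I) • (z - z₀)) ∂μ = ∫ z, K z ∂μ :=
    fun θ => (mp_rot n z₀ r _ (nrm θ)).integral_comp
      (rot z₀ _ (nrm θ)).toHomeomorph.measurableEmbedding K
  have hrm : ∀ z ∈ Metric.sphere z₀ r, ∀ θ : ℝ,
      z₀ + Complex.exp (θ * Complex.I) • (z - z₀) ∈ Metric.sphere z₀ r := by
    intro z hz θ
    rw [mem_sphere_iff_norm] at hz ⊢
    rw [add_sub_cancel_left, norm_smul, nrm, one_mul, hz]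
  have hGK : ∫ z, G z ∂μ = ∫ z, K z ∂μ := by
    refine integral_congr_ae ?_
    filter_upwards [ae_sphere n z₀ r] with z hz
    rw [hK, indicator_of_mem hz]
  have hint : Integrable (Function.uncurry (fun (z : EuclideanSpace ℂ (Fin n)) (θ : ℝ) =>
      K (z₀ + Complex.exp (θ * Complex.I) • (z - z₀))))
      (μ.prod (volume.restrict (Ioc 0 (2 * π)))) := by
    refine Integrable.of_bound (C := |B|) ?_ (Filter.Eventually.of_forall fun x => hKB _)
    refine (hKm.comp (Continuous.measurable ?_)).aestronglyMeasurable
    fun_prop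
  have hsw := integral_integral_swap hint
  simp only [hrot] at hsw
  have hl : 0 ≤ ∫ z, (∫ θ in Ioc (0 : ℝ) (2 * π),
      K (z₀ + Complex.exp ((θ : ℂ) * Complex.I) • (z - z₀))) ∂μ := by
    refine integral_nonneg_of_ae ?_
    filter_upwards [ae_sphere n z₀ r] with z hz
    have := hpos z hz
    rw [intervalIntegral.integral_of_le (by positivity)] at this
    simpa [hK, indicator_of_mem (hrm z hz _)] using this
  rw [hsw] at hl
  rw [hGK]
  have hr : ∫ _θ in Ioc 0 (2 * π), (∫ z, K z ∂μ) = (2 * π) * ∫ z, K z ∂μ := by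
    rw [← intervalIntegral.integral_of_le (by positivity), intervalIntegral.integral_const]
    simp
  rw [hr] at hl
  exact nonneg_of_mul_nonneg_right hl (by positivity)

end RieszAux

/-- **Sphere version of M. Riesz's theorem with regularization, `1 < p ≤ 2`, `τ > 0`** :
if `f = u + iv` is holomorphic on an open set `Ω ⊆ ℂⁿ` containing the closed ball of center `z₀`
and radius `r`, with `v z₀ = 0`, then
`∫_{S(z₀,r)} (|f|² + τ)^{p/2} dσ ≤ (p/(p−1)) ∫_{S(z₀,r)} (u² + τ)^{p/2} dσ`. -/
theorem riesz_sphere_small_p_tau (n : ℕ) (hn : 1 ≤ n) (Ω : Set (EuclideanSpace ℂ (Fin n)))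
    (hΩ : IsOpen Ω) (z₀ : EuclideanSpace ℂ (Fin n)) (hz₀ : z₀ ∈ Ω) (r : ℝ) (hr : 0 < r)
    (hball : Metric.closedBall z₀ r ⊆ Ω) (f : EuclideanSpace ℂ (Fin n) → ℂ)
    (hf : DifferentiableOn ℂ f Ω) (hv : (f z₀).im = 0)
    (p τ : ℝ) (hp : 1 < p) (hp2 : p ≤ 2) (hτ : 0 < τ) :
    ∫ z, ((‖f z‖) ^ 2 + τ) ^ (p / 2) ∂(sphereUnifMeasure n z₀ r)
      ≤ (p / (p - 1)) * ∫ z, (((f z).re) ^ 2 + τ) ^ (p / 2) ∂(sphereUnifMeasure n z₀ r) := by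
  have := RieszAux.sphere_finite n z₀ r
  have hSΩ : Metric.sphere z₀ r ⊆ Ω := Metric.sphere_subset_closedBall.trans hball
  have cf : ContinuousOn f (Metric.sphere z₀ r) := hf.continuousOn.mono hSΩ
  have hSm : MeasurableSet (Metric.sphere z₀ r) := Metric.isClosed_sphere.measurableSet
  have hnn : ∀ z, ‖f z‖ ^ 2 = (f z).re ^ 2 + (f z).im ^ 2 := by
    intro z
    rw [Complex.sq_norm, Complex.normSq_apply]; ring
  simp only [hnn]
  have integ : ∀ g : ℂ → ℝ, Continuous g →
      Integrable (fun z => g (f z)) (sphereUnifMeasure n z₀ r) := by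
    intro g hg
    have cg := hg.comp_continuousOn cf
    obtain ⟨B, hB⟩ := (isCompact_sphere z₀ r).exists_bound_of_continuousOn cg
    refine Integrable.of_bound (C := B) ?_ ?_
    · exact (cg.aestronglyMeasurable hSm).mono_ac Measure.smul_absolutelyContinuous
    · filter_upwards [RieszAux.ae_sphere n z₀ r] with z hz using hB z hz
  have key := RieszAux.sphere_nonneg n z₀ r (fun z => RieszAux.Ph (p / (p - 1)) (p / 2) τ (f z))
    ((RieszAux.continuous_Ph hτ _ _).comp_continuousOn cf) (by
      intro z hz
      have ca : Differentiable ℂ (fun ζ : ℂ => z₀ + ζ • (z - z₀)) := by fun_prop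
      have hsub : Metric.closedBall (0 : ℂ) 1 ⊆ (fun ζ : ℂ => z₀ + ζ • (z - z₀)) ⁻¹' Ω := by
        intro ζ hζ
        apply hball
        rw [mem_sphere_iff_norm] at hz
        rw [mem_closedBall_zero_iff] at hζ
        rw [mem_closedBall_iff_norm, add_sub_cancel_left, norm_smul, hz]
        nlinarith
      obtain ⟨δ, hδ, hδ'⟩ := (isCompact_closedBall (0 : ℂ) 1).exists_thickening_subset_open
        (hΩ.preimage ca.continuous) hsub
      rw [thickening_closedBall hδ zero_le_one] at hδ'
      refine RieszAux.disc (R := δ + 1) (F := fun ζ : ℂ => f (z₀ + ζ • (z - z₀))) (by linarith)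
        (hf.comp ca.differentiableOn hδ') (by simpa using hv) hp hp2 hτ)
  have e : ∫ z, RieszAux.Ph (p / (p - 1)) (p / 2) τ (f z) ∂(sphereUnifMeasure n z₀ r) =
      (p / (p - 1)) * ∫ z, (((f z).re) ^ 2 + τ) ^ (p / 2) ∂(sphereUnifMeasure n z₀ r) -
      ∫ z, ((f z).re ^ 2 + (f z).im ^ 2 + τ) ^ (p / 2) ∂(sphereUnifMeasure n z₀ r) := by
    rw [← integral_const_mul]
    exact integral_sub ((integ _ (RieszAux.continuous_pow1 hτ _)).const_mul _)
      (integ _ (RieszAux.continuous_pow2 hτ _))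
  rw [e] at key
  linarith
end
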